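/- arXiv:1510.02653 — 5 statements merged into one kernel-verified Lean document; each statement's English description precedes it below -/
import Mathlib

section
/- For every ε > 0 there exist constants C > 0 (depending only on ε) and c₇ > 0 (absolute) with the following property. Let k be an even positive integer, N a squarefree positive integer, and f a nonzero cusp form of weight k on the Hecke congruence subgroup Γ₀(N) whose Fourier coefficients at infinity are all real, i.e. f(z) = ∑_{n≥1} β(n) e^{2πinz} for all z in the upper half-plane with every β(n) real. Then for every real x ≥ C · k^{42} · N^{84} · (log k)^{80} · exp(c₇ · log(N+1)/log log(N+2)), setting h = x^{13/14+ε}, there exist positive integers n₁ and n₂ with x < n₁ ≤ x + h and x < n₂ ≤ x + h such that β(n₁) > 0 and β(n₂) < 0. -/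
section Helpers

open Complex

/-- the Gaussian kernel -/
noncomputable def gk (H μ s : ℝ) : ℂ :=
  (H : ℂ) * cexp (-(Real.pi * H ^ 2 : ℂ) * (s : ℂ) ^ 2 + (-(2 * Real.pi * I * μ)) * s + 0)

lemma gk_norm {H : ℝ} (hH : 0 < H) (μ s : ℝ) :
    ‖gk H μ s‖ = H * Real.exp (-(Real.pi * H ^ 2) * s ^ 2) := by
  unfold gk
  rw [norm_mul, Complex.norm_exp, Complex.norm_real, Real.norm_of_nonneg hH.le]
  congr 2
  have h1 : (-(Real.pi * H ^ 2 : ℂ) * (s : ℂ) ^ 2 + (-(2 * Real.pi * I * μ)) * s + 0)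
      = ((-(Real.pi * H ^ 2) * s ^ 2 : ℝ) : ℂ) + ((-(2 * Real.pi * μ * s) : ℝ) : ℂ) * I := by
    push_cast; ring
  rw [h1, Complex.add_re, Complex.ofReal_re, Complex.re_ofReal_mul, Complex.I_re, mul_zero, add_zero]

lemma gk_term (H μ ξ s : ℝ) :
    cexp (2 * Real.pi * I * (ξ * s)) * gk H μ s =
      (H : ℂ) * cexp (-(Real.pi * H ^ 2 : ℂ) * (s : ℂ) ^ 2 + (2 * Real.pi * I * (ξ - μ)) * s + 0) := by
  unfold gk
  rw [mul_left_comm, ← Complex.exp_add]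
  congr 2; ring

lemma re_aux {H : ℝ} (hH : 0 < H) : (-(Real.pi * H ^ 2 : ℂ)).re < 0 := by
  have : (-(Real.pi * H ^ 2 : ℂ)) = ((-(Real.pi * H ^ 2) : ℝ) : ℂ) := by push_cast; ring
  rw [this, Complex.ofReal_re]
  have := Real.pi_pos
  have : 0 < Real.pi * H ^ 2 := by positivity
  linarith

lemma gk_term_integrable {H : ℝ} (hH : 0 < H) (μ ξ : ℝ) :
    MeasureTheory.Integrable (fun s : ℝ => cexp (2 * Real.pi * I * (ξ * s)) * gk H μ s) := by
  simp_rw [gk_term]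
  exact (integrable_cexp_quadratic' (re_aux hH) _ _).const_mul _

lemma gk_term_integral {H : ℝ} (hH : 0 < H) (μ ξ : ℝ) :
    ∫ s : ℝ, cexp (2 * Real.pi * I * (ξ * s)) * gk H μ s =
      (Real.exp (-Real.pi * (ξ - μ) ^ 2 / H ^ 2) : ℂ) := by
  simp_rw [gk_term]
  rw [MeasureTheory.integral_const_mul, integral_cexp_quadratic (re_aux hH)]
  have hpi : (Real.pi : ℂ) ≠ 0 := by exact_mod_cast Real.pi_ne_zero
  have hHc : (H : ℂ) ≠ 0 := by exact_mod_cast hH.ne'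
  have h1 : (Real.pi : ℂ) / - -(Real.pi * H ^ 2 : ℂ) = (((H ^ 2)⁻¹ : ℝ) : ℂ) := by
    push_cast; field_simp
  rw [h1]
  have h2 : ((((H ^ 2)⁻¹ : ℝ) : ℂ)) ^ (1 / 2 : ℂ) = ((H⁻¹ : ℝ) : ℂ) := by
    have : (1 / 2 : ℂ) = ((1 / 2 : ℝ) : ℂ) := by push_cast; rfl
    rw [this, ← Complex.ofReal_cpow (by positivity)]
    congr 1
    rw [← Real.sqrt_eq_rpow, ← inv_pow, Real.sqrt_sq (by positivity)]
  rw [h2, ← mul_assoc, Complex.ofReal_exp]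
  have h3 : (H : ℂ) * ((H⁻¹ : ℝ) : ℂ) = 1 := by push_cast; field_simp
  rw [h3, one_mul]
  congr 1
  push_cast
  field_simp
  ring_nf
  simp
  ring

lemma gauss_sum {H : ℝ} (hH : 0 < H) (μ lam : ℝ) (a : ℕ → ℂ) (ha : Summable fun n => ‖a n‖) :
    ∫ s : ℝ, (∑' n : ℕ, a n * cexp (2 * Real.pi * I * (((n * lam : ℝ) : ℂ) * s))) * gk H μ s =
      ∑' n : ℕ, a n * (Real.exp (-Real.pi * (n * lam - μ) ^ 2 / H ^ 2) : ℂ) := by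
  have hn : ∀ (n : ℕ) (s : ℝ), ‖cexp (2 * Real.pi * I * (((n * lam : ℝ) : ℂ) * s))‖ = 1 := by
    intro n s
    have : (2 * Real.pi * I * (((n * lam : ℝ) : ℂ) * s)) = ((2 * Real.pi * (n * lam * s) : ℝ) : ℂ) * I := by
      push_cast; ring
    rw [this, Complex.norm_exp_ofReal_mul_I]
  have key := MeasureTheory.hasSum_integral_of_summable_integral_norm
    (F := fun (n : ℕ) (s : ℝ) => a n * (cexp (2 * Real.pi * I * (((n * lam : ℝ) : ℂ) * s)) * gk H μ s))
    (μ := MeasureTheory.volume)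
    (fun n => (gk_term_integrable hH μ (n * lam)).const_mul _) (by
      have : ∀ n : ℕ, ∫ s : ℝ, ‖a n * (cexp (2 * Real.pi * I * (((n * lam : ℝ) : ℂ) * s)) * gk H μ s)‖
          = ‖a n‖ * ∫ s : ℝ, ‖gk H μ s‖ := by
        intro n
        simp_rw [norm_mul (a n), norm_mul (cexp _), hn, one_mul]
        rw [MeasureTheory.integral_const_mul]
      simp_rw [this]
      exact ha.mul_right _)
  have h2 := key.tsum_eq
  rw [show (fun s : ℝ => (∑' n : ℕ, a n * cexp (2 * Real.pi * I * (((n * lam : ℝ) : ℂ) * s))) * gk H μ s)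
     = fun s : ℝ => ∑' n : ℕ, a n * (cexp (2 * Real.pi * I * (((n * lam : ℝ) : ℂ) * s)) * gk H μ s) from ?_, ← h2]
  · refine tsum_congr fun n => ?_
    rw [MeasureTheory.integral_const_mul, gk_term_integral hH]
  · funext s
    rw [← tsum_mul_right]
    exact tsum_congr fun n => by ring

lemma gauss_bound {H : ℝ} (hH : 0 < H) (μ : ℝ) (u : ℝ → ℂ) (K0 : ℝ)
    (hu : ∀ s, ‖u s‖ ≤ K0 * (1 + H ^ 2 * s ^ 2)) :
    ‖∫ s : ℝ, u s * gk H μ s‖ ≤ 2 * K0 := by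
  have hpi := Real.pi_gt_three
  have hK0 : 0 ≤ K0 := by
    have := (norm_nonneg _).trans (hu 0); simpa using this
  have hb : 0 < (Real.pi - 1) * H ^ 2 := by
    have : 0 < Real.pi - 1 := by linarith
    positivity
  refine (MeasureTheory.norm_integral_le_of_norm_le
    (g := fun s => K0 * H * Real.exp (-((Real.pi - 1) * H ^ 2) * s ^ 2))
    ((integrable_exp_neg_mul_sq hb).const_mul _) (Filter.Eventually.of_forall fun s => ?_)).trans ?_
  · rw [norm_mul, gk_norm hH]
    have h1 : 1 + H ^ 2 * s ^ 2 ≤ Real.exp (H ^ 2 * s ^ 2) := by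
      have := Real.add_one_le_exp (H ^ 2 * s ^ 2); linarith
    calc ‖u s‖ * (H * Real.exp (-(Real.pi * H ^ 2) * s ^ 2))
        ≤ (K0 * Real.exp (H ^ 2 * s ^ 2)) * (H * Real.exp (-(Real.pi * H ^ 2) * s ^ 2)) := by
          gcongr
          exact (hu s).trans (by gcongr)
      _ = K0 * H * (Real.exp (H ^ 2 * s ^ 2) * Real.exp (-(Real.pi * H ^ 2) * s ^ 2)) := by ring
      _ = _ := by rw [← Real.exp_add]; ring_nf
  · rw [MeasureTheory.integral_const_mul, integral_gaussian]
    have h1 : √(Real.pi / ((Real.pi - 1) * H ^ 2)) ≤ 2 / H := by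
      rw [Real.sqrt_le_left (by positivity), div_pow, div_le_div_iff₀ hb (by positivity)]
      nlinarith [sq_nonneg H]
    calc K0 * H * √(Real.pi / ((Real.pi - 1) * H ^ 2)) ≤ K0 * H * (2 / H) := by gcongr
      _ = 2 * K0 := by field_simp

lemma gauss_tail {H μ lam D : ℝ} (hH : 0 < H) (hl : 1 ≤ lam) (hD : 0 ≤ D) (n : ℕ)
    (hn : 1 ≤ n) (h : D ≤ |n * lam - μ|) :
    Real.exp (-Real.pi * (n * lam - μ) ^ 2 / H ^ 2) ≤
      (Real.exp (-Real.pi * D ^ 2 / (2 * H ^ 2)) * (4 * μ ^ 2 + 3 * H ^ 2)) * (1 / (n : ℝ) ^ 2) := by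
  set X := n * lam - μ with hX
  have hpi := Real.pi_gt_three
  have hn' : (1 : ℝ) ≤ n := by exact_mod_cast hn
  have hH2 : 0 < H ^ 2 := by positivity
  have e : Real.exp (-Real.pi * X ^ 2 / H ^ 2) =
      Real.exp (-Real.pi * X ^ 2 / (2 * H ^ 2)) * Real.exp (-Real.pi * X ^ 2 / (2 * H ^ 2)) := by
    rw [← Real.exp_add]; congr 1; field_simp; ring
  have hDX : D ^ 2 ≤ X ^ 2 := by rw [← sq_abs X]; gcongr
  have h1 : Real.exp (-Real.pi * X ^ 2 / (2 * H ^ 2)) ≤ Real.exp (-Real.pi * D ^ 2 / (2 * H ^ 2)) := by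
    rw [Real.exp_le_exp]
    rw [div_le_div_iff_of_pos_right (by positivity)]
    nlinarith
  have h2 : Real.exp (-Real.pi * X ^ 2 / (2 * H ^ 2)) ≤ (4 * μ ^ 2 + 3 * H ^ 2) * (1 / (n : ℝ) ^ 2) := by
    rw [mul_one_div, le_div_iff₀ (by positivity)]
    by_cases hc : (n : ℝ) ≤ 2 * μ
    · have : Real.exp (-Real.pi * X ^ 2 / (2 * H ^ 2)) ≤ 1 := by
        rw [Real.exp_le_one_iff]
        apply div_nonpos_of_nonpos_of_nonneg _ (by positivity)
        nlinarith [sq_nonneg X]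
      have h3 : (n : ℝ) ^ 2 ≤ 4 * μ ^ 2 := by nlinarith
      nlinarith [sq_nonneg (n : ℝ)]
    · push Not at hc
      have hXn : (n : ℝ) / 2 ≤ X := by rw [hX]; nlinarith
      have hX2 : (n : ℝ) ^ 2 / 4 ≤ X ^ 2 := by nlinarith
      set u := Real.pi * X ^ 2 / (2 * H ^ 2) with hu
      have hu0 : 0 < u := by rw [hu]; have : 0 < X ^ 2 := by nlinarith
                             positivity
      have hee : -Real.pi * X ^ 2 / (2 * H ^ 2) = -u := by rw [hu]; ring
      rw [hee, Real.exp_neg]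
      have h4 : u ≤ Real.exp u := by have := Real.add_one_le_exp u; linarith
      have h5 : (n : ℝ) ^ 2 ≤ 3 * H ^ 2 * u := by
        have : 3 * H ^ 2 * u = 3 / 2 * Real.pi * X ^ 2 := by rw [hu]; field_simp
        rw [this]; nlinarith [sq_nonneg (n : ℝ)]
      rw [inv_mul_le_iff₀ (Real.exp_pos _)]
      nlinarith [sq_nonneg μ, Real.exp_pos u]
  rw [e, mul_assoc]
  gcongr

lemma tail_sum {c : ℕ → ℂ} {A : ℝ} (hA : 0 ≤ A) (hc : ∀ n, ‖c n‖ ≤ A * (1 / (n : ℝ) ^ 2)) :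
    Summable (fun n => ‖c n‖) ∧ ∑' n, ‖c n‖ ≤ 2 * A := by
  have hz := hasSum_zeta_two.mul_left A
  have hs : Summable (fun n => ‖c n‖) := Summable.of_nonneg_of_le (fun _ => norm_nonneg _) hc hz.summable
  refine ⟨hs, (hs.tsum_le_tsum hc hz.summable).trans ?_⟩
  rw [hz.tsum_eq]
  have : Real.pi ^ 2 / 6 ≤ 2 := by nlinarith [Real.pi_gt_three, Real.pi_lt_d2]
  nlinarith

lemma geo_sum {c : ℕ → ℂ} {A δ : ℝ} (hδ : 0 < δ) (h0 : c 0 = 0)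
    (hc : ∀ m : ℕ, 1 ≤ m → ‖c m‖ ≤ A * Real.exp (-(m * δ))) :
    Summable (fun n => ‖c n‖) ∧ ∑' n, ‖c n‖ ≤ A / (Real.exp δ - 1) := by
  have he : 0 < Real.exp δ - 1 := by have := Real.add_one_lt_exp hδ.ne'; linarith
  have hr0 : 0 ≤ Real.exp (-δ) := (Real.exp_pos _).le
  have hr1 : Real.exp (-δ) < 1 := by rw [Real.exp_lt_one_iff]; linarith
  have hg := (hasSum_geometric_of_lt_one hr0 hr1).mul_left (A * Real.exp (-δ))
  have hb : ∀ n : ℕ, ‖c (n + 1)‖ ≤ A * Real.exp (-δ) * Real.exp (-δ) ^ n := by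
    intro n
    refine (hc (n + 1) (by omega)).trans (le_of_eq ?_)
    rw [← Real.exp_nat_mul, mul_assoc, ← Real.exp_add]
    congr 2; push_cast; ring
  have hs1 : Summable (fun n => ‖c (n + 1)‖) :=
    Summable.of_nonneg_of_le (fun _ => norm_nonneg _) hb hg.summable
  have hs : Summable (fun n => ‖c n‖) := (summable_nat_add_iff (f := fun n => ‖c n‖) 1).1 hs1
  refine ⟨hs, ?_⟩
  rw [hs.tsum_eq_zero_add, h0, norm_zero, zero_add]
  refine (hs1.tsum_le_tsum hb hg.summable).trans (le_of_eq ?_)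
  rw [hg.tsum_eq, Real.exp_neg]
  have := (Real.exp_pos δ).ne'
  field_simp

structure Good (κ N : ℕ) (M : ℝ) (g : ℂ → ℂ) (b : ℕ → ℂ) : Prop where
  diff : DifferentiableOn ℂ g {w : ℂ | 0 < w.im}
  bound : ∀ w : ℂ, 0 < w.im → ‖g w‖ * w.im ^ κ ≤ M
  sum : ∀ w : ℂ, 0 < w.im → HasSum (fun m : ℕ => b m * cexp (2 * Real.pi * I * m * w / N)) (g w)
  coeff : ∀ (m : ℕ) (v : ℝ), 0 < v → ‖b m‖ * Real.exp (-(2 * Real.pi * m * v / N)) * v ^ κ ≤ M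
  zero : b 0 = 0

lemma norm_e (N m : ℕ) (w : ℂ) :
    ‖cexp (2 * Real.pi * I * m * w / N)‖ = Real.exp (-(2 * Real.pi * m * w.im / N)) := by
  rw [Complex.norm_exp]
  congr 1
  have : (2 * Real.pi * I * m * w / N) = ((2 * Real.pi * m / N : ℝ) : ℂ) * (I * w) := by
    push_cast; ring
  rw [this, Complex.re_ofReal_mul]
  simp
  ring

lemma exists_big_coeff {κ N : ℕ} (hκ : 1 ≤ κ) (hN : 1 ≤ N) {M : ℝ} (hM : 0 < M) {g : ℂ → ℂ} {b : ℕ → ℂ}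
    (hg : Good κ N M g b) (w0 : ℂ) (hw : 3 ≤ 4 * w0.im ^ 2) (hw' : 0 < w0.im)
    (hb : M / 2 ≤ ‖g w0‖ * w0.im ^ κ) :
    ∃ (m : ℕ) (v : ℝ), 1 ≤ m ∧ 1 / 2 ≤ v ∧
      M / (N * (2 * κ + 1)) ≤ ‖b m‖ * Real.exp (-(2 * Real.pi * m * v / N)) * v ^ κ ∧
      m * v / N ≤ κ + N := by
  have hpi := Real.pi_gt_three
  have hκ' : (1 : ℝ) ≤ κ := by exact_mod_cast hκ
  have hN' : (1 : ℝ) ≤ N := by exact_mod_cast hN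
  set t := w0.im with ht
  have ht1 : 0.86 ≤ t := by nlinarith
  set K : ℝ := 2 * κ + 1 with hK
  have hK1 : 3 ≤ K := by linarith
  set v := t * (2 * κ / K) with hv
  have hvt : t - v = t / K := by rw [hv, hK]; field_simp; ring
  have hv1 : 1 / 2 ≤ v := by
    have : 2 / 3 ≤ 2 * κ / K := by rw [div_le_div_iff₀ (by norm_num) (by linarith)]; linarith
    nlinarith
  have hv0 : 0 < v := by linarith
  have hA : ∃ m : ℕ, 1 ≤ m ∧
      M / (N * K) ≤ ‖b m‖ * Real.exp (-(2 * Real.pi * m * v / N)) * v ^ κ := by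
    by_contra! hcon
    set δ := 2 * Real.pi * t / (N * K) with hδ
    have hδ0 : 0 < δ := by positivity
    have := geo_sum (c := fun m : ℕ => b m * cexp (2 * Real.pi * I * m * w0 / N))
      (A := M / (N * K) / v ^ κ) hδ0 (by simp [hg.zero]) (by
        intro m hm
        rw [norm_mul, norm_e, ← ht]
        have h1 := (hcon m hm).le
        rw [← le_div_iff₀ (by positivity)] at h1
        have h2 : Real.exp (-(2 * Real.pi * m * t / N)) =
            Real.exp (-(2 * Real.pi * m * v / N)) * Real.exp (-(m * δ)) := by
          rw [← Real.exp_add]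
          congr 1
          have : t = v + t / K := by rw [← hvt]; ring
          rw [hδ]
          nth_rw 1 [this]
          field_simp
          ring
        rw [h2, ← mul_assoc]
        gcongr)
    have hn : ‖g w0‖ ≤ M / (N * K) / v ^ κ / (Real.exp δ - 1) := by
      rw [← (hg.sum w0 hw').tsum_eq]
      exact (norm_tsum_le_tsum_norm this.1).trans this.2
    have h3 : M / (N * K) / v ^ κ / (Real.exp δ - 1) ≤ M / (N * K) / v ^ κ / δ := by
      have := Real.add_one_le_exp δ
      gcongr
      linarith
    have h4 : M / (N * K) / v ^ κ / δ * t ^ κ = M * (t / v) ^ κ / (2 * Real.pi * t) := by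
      rw [hδ, div_pow]; field_simp
    have h5 : (t / v) ^ κ ≤ 2 := by
      have e1 : t / v = 1 + 1 / (2 * κ) := by rw [hv, hK]; field_simp
      have e2 : t / v ≤ Real.exp (1 / (2 * κ)) := by
        rw [e1]; have := Real.add_one_le_exp (1 / (2 * κ : ℝ)); linarith
      have e3 : (t / v) ^ κ ≤ Real.exp (1 / 2) := by
        calc (t / v) ^ κ ≤ Real.exp (1 / (2 * κ)) ^ κ := by gcongr
          _ = Real.exp (1 / 2) := by rw [← Real.exp_nat_mul]; congr 1; field_simp
      have e4 : Real.exp (1 / 2) * Real.exp (1 / 2) < 4 := by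
        rw [← Real.exp_add]; norm_num; linarith [Real.exp_one_lt_d9]
      nlinarith [Real.exp_pos (1 / 2 : ℝ)]
    have h6 : ‖g w0‖ * t ^ κ ≤ M * (t / v) ^ κ / (2 * Real.pi * t) := by
      rw [← h4]; gcongr; exact hn.trans h3
    have h7 : M * (t / v) ^ κ / (2 * Real.pi * t) < M / 2 := by
      rw [div_lt_div_iff₀ (by positivity) (by norm_num)]
      have : M * (t / v) ^ κ ≤ M * 2 := by gcongr
      have : 5.16 ≤ 2 * Real.pi * t := by nlinarith
      nlinarith
    linarith
  obtain ⟨m, hm, hmb⟩ := hA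
  refine ⟨m, v, hm, hv1, hmb, ?_⟩
  set Y := m * v / N with hY
  have h1 := hg.coeff m (v / 2) (by linarith)
  have h2 : Real.exp (Real.pi * Y) ≤ 2 ^ κ * (N * K) := by
    have e1 : Real.exp (-(2 * Real.pi * m * v / N)) = Real.exp (-(2 * Real.pi * m * (v / 2) / N)) *
        Real.exp (-(Real.pi * Y)) := by
      rw [← Real.exp_add]; congr 1; rw [hY]; field_simp; ring
    have e2 : ‖b m‖ * Real.exp (-(2 * Real.pi * m * v / N)) * v ^ κ ≤ M * 2 ^ κ * Real.exp (-(Real.pi * Y)) := by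
      rw [e1]
      have : v ^ κ = (v / 2) ^ κ * 2 ^ κ := by rw [← mul_pow]; congr 1; ring
      rw [this]
      calc _ = (‖b m‖ * Real.exp (-(2 * Real.pi * m * (v / 2) / N)) * (v / 2) ^ κ) * 2 ^ κ * Real.exp (-(Real.pi * Y)) := by ring
        _ ≤ _ := by gcongr
    have e3 := hmb.trans e2
    rw [Real.exp_neg, div_le_iff₀ (by positivity)] at e3
    have e4 : 1 ≤ 2 ^ κ * (Real.exp (Real.pi * Y))⁻¹ * (N * K) := by
      have : M * 1 ≤ M * (2 ^ κ * (Real.exp (Real.pi * Y))⁻¹ * (N * K)) := by linarith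
      exact le_of_mul_le_mul_left this hM
    have := Real.exp_pos (Real.pi * Y)
    calc Real.exp (Real.pi * Y) = Real.exp (Real.pi * Y) * 1 := by ring
      _ ≤ Real.exp (Real.pi * Y) * (2 ^ κ * (Real.exp (Real.pi * Y))⁻¹ * (N * K)) := by gcongr
      _ = _ := by field_simp
  have h3 : (2 : ℝ) ^ κ * (N * K) ≤ Real.exp (κ * 0.7 + (N + 2 * κ)) := by
    rw [Real.exp_add, Real.exp_add, Real.exp_nat_mul]
    have a1 : (2 : ℝ) ≤ Real.exp 0.7 := by
      rw [← Real.log_le_iff_le_exp (by norm_num)]; linarith [Real.log_two_lt_d9]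
    have a2 : (N : ℝ) ≤ Real.exp N := by have := Real.add_one_le_exp (N : ℝ); linarith
    have a3 : K ≤ Real.exp (2 * κ) := by have := Real.add_one_le_exp (2 * κ : ℝ); linarith
    gcongr
  have h4 := Real.exp_le_exp.1 (h2.trans h3)
  have : Real.pi * Y ≤ Real.pi * (κ + N) := by nlinarith
  exact le_of_mul_le_mul_left this (by linarith)

lemma pow_sub_one_bound (η : ℂ) (n : ℕ) : ‖(1 + η) ^ n - 1‖ ≤ Real.exp (n * ‖η‖) - 1 := by
  induction n with
  | zero => simp
  | succ n ih =>
    have h1 : (1 + η) ^ (n + 1) - 1 = (1 + η) * ((1 + η) ^ n - 1) + η := by ring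
    have h2 : ‖1 + η‖ ≤ 1 + ‖η‖ := (norm_add_le _ _).trans (by simp)
    have h3 : 1 + ‖η‖ ≤ Real.exp ‖η‖ := by have := Real.add_one_le_exp ‖η‖; linarith
    have h4 : Real.exp ((n + 1 : ℕ) * ‖η‖) = Real.exp ‖η‖ * Real.exp (n * ‖η‖) := by
      rw [← Real.exp_add]; congr 1; push_cast; ring
    rw [h1, h4]
    calc ‖(1 + η) * ((1 + η) ^ n - 1) + η‖ ≤ ‖1 + η‖ * ‖(1 + η) ^ n - 1‖ + ‖η‖ := by
          refine (norm_add_le _ _).trans ?_; rw [norm_mul]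
      _ ≤ (1 + ‖η‖) * (Real.exp (n * ‖η‖) - 1) + ‖η‖ := by gcongr
      _ = (1 + ‖η‖) * Real.exp (n * ‖η‖) - 1 := by ring
      _ ≤ _ := by gcongr

lemma ratio_pow (κ : ℕ) (hκ : 1 ≤ κ) : (1 + 1 / (2 * κ : ℝ)) ^ κ ≤ 2 := by
  have hκ' : (1 : ℝ) ≤ κ := by exact_mod_cast hκ
  have e2 : 1 + 1 / (2 * κ : ℝ) ≤ Real.exp (1 / (2 * κ)) := by
    have := Real.add_one_le_exp (1 / (2 * κ : ℝ)); linarith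
  have e3 : (1 + 1 / (2 * κ : ℝ)) ^ κ ≤ Real.exp (1 / 2) := by
    calc (1 + 1 / (2 * κ : ℝ)) ^ κ ≤ Real.exp (1 / (2 * κ)) ^ κ := by gcongr
      _ = Real.exp (1 / 2) := by rw [← Real.exp_nat_mul]; congr 1; field_simp
  have e4 : Real.exp (1 / 2) * Real.exp (1 / 2) < 4 := by
    rw [← Real.exp_add]; norm_num; linarith [Real.exp_one_lt_d9]
  nlinarith [Real.exp_pos (1 / 2 : ℝ)]

lemma linearize {κ N : ℕ} (hκ : 1 ≤ κ) {M : ℝ} (hM : 0 < M) {F g : ℂ → ℂ} {b : ℕ → ℂ}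
    (hF : ∀ w : ℂ, 0 < w.im → ‖F w‖ * w.im ^ κ ≤ M) (hg : Good κ N M g b)
    {α δ c T y v : ℝ} (hc : 0 < c) (hT : 0 < T) (hy : 0 < y) (hv : v = y / (c ^ 2 * T ^ 2))
    (hrel : ∀ ζ : ℂ, 0 < ζ.im → F (α + ζ) = ((c * ζ) ^ (2 * κ))⁻¹ * g (-δ - 1 / (c ^ 2 * ζ)))
    (s : ℝ) (η : ℂ) (hη : η = (s + y * I) / T) :
    ‖(y : ℂ) ^ κ * F (α + (T + s + y * I)) - (v : ℂ) ^ κ * g (-δ - 1 / (c ^ 2 * T) + η / (c ^ 2 * T))‖ ≤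
      M * (2 * κ + 1) * (8 * ‖η‖ + 10 * ‖η‖ ^ 2 * T / y) := by
  have hκ' : (1 : ℝ) ≤ κ := by exact_mod_cast hκ
  have hv0 : 0 < v := by rw [hv]; positivity
  set K : ℝ := 2 * κ + 1 with hK
  have hK3 : 3 ≤ K := by linarith
  set ζ : ℂ := T + s + y * I with hζ
  set wl : ℂ := -δ - 1 / (c ^ 2 * T) + η / (c ^ 2 * T) with hwl
  have hTc : (T : ℂ) ≠ 0 := by exact_mod_cast hT.ne'
  have hcc : (c : ℂ) ≠ 0 := by exact_mod_cast hc.ne'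
  have hζim : ζ.im = y := by simp [hζ]
  have hζ0 : ζ ≠ 0 := by intro h; rw [h] at hζim; simp at hζim; linarith
  have hζη : ζ = T * (1 + η) := by rw [hη, hζ]; field_simp; ring
  have hη0 : 1 + η ≠ 0 := by intro h; rw [h, mul_zero] at hζη; exact hζ0 hζη
  have hwlim : wl.im = v := by
    have : wl = ((-δ - 1 / (c ^ 2 * T) + s / (c ^ 2 * T ^ 2) : ℝ) : ℂ) + (v : ℝ) * I := by
      rw [hwl, hη, hv]; push_cast; field_simp; ring
    rw [this, Complex.add_im, Complex.ofReal_im, Complex.im_ofReal_mul, Complex.I_im]; ring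
  have hFn : ‖(y : ℂ) ^ κ * F (α + ζ)‖ ≤ M := by
    have := hF (α + ζ) (by simp [hζim, hy])
    rw [norm_mul, norm_pow, Complex.norm_real, Real.norm_of_nonneg hy.le]
    simp only [add_im, ofReal_im, zero_add, hζim] at this
    linarith
  have hgn : ‖(v : ℂ) ^ κ * g wl‖ ≤ M := by
    have := hg.bound wl (by rw [hwlim]; exact hv0)
    rw [norm_mul, norm_pow, Complex.norm_real, Real.norm_of_nonneg hv0.le]
    rw [hwlim] at this; linarith
  have htriv : ‖(y : ℂ) ^ κ * F (α + ζ) - (v : ℂ) ^ κ * g wl‖ ≤ 2 * M :=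
    (norm_sub_le _ _).trans (by linarith)
  have hp2 : 0 ≤ ‖η‖ ^ 2 * T / y := by positivity
  have hp1 := norm_nonneg η
  by_cases h1 : K * ‖η‖ < 1 / 4
  swap
  · push Not at h1
    refine htriv.trans ?_
    have : 0 ≤ M * K * (‖η‖ ^ 2 * T / y) := by positivity
    calc 2 * M ≤ 8 * M * (K * ‖η‖) := by nlinarith
      _ ≤ _ := by
        have e : M * K * (8 * ‖η‖ + 10 * ‖η‖ ^ 2 * T / y) = 8 * M * (K * ‖η‖) + 10 * (M * K * (‖η‖ ^ 2 * T / y)) := by ring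
        rw [e]; linarith
  by_cases h2 : 2 * K * ‖η‖ ^ 2 * T / y < 1
  swap
  · push Not at h2
    refine htriv.trans ?_
    have : 0 ≤ M * K * ‖η‖ := by positivity
    have e : M * K * (8 * ‖η‖ + 10 * ‖η‖ ^ 2 * T / y) = 8 * (M * K * ‖η‖) + 5 * M * (2 * K * ‖η‖ ^ 2 * T / y) := by ring
    rw [e]
    nlinarith
  have hη12 : ‖η‖ < 1 / 12 := by nlinarith
  set w : ℂ := -δ - 1 / (c ^ 2 * ζ) with hw
  have hgw : (v : ℂ) ^ κ * g w = (y : ℂ) ^ κ * F (α + ζ) * (1 + η) ^ (2 * κ) := by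
    rw [hrel ζ (by rw [hζim]; exact hy), ← hw, hv, hζη]
    push_cast
    rw [div_pow, mul_pow, mul_pow, mul_pow, ← pow_mul, ← pow_mul]
    field_simp
  have hdiff : w - wl = -(η ^ 2 / (c ^ 2 * T * (1 + η))) := by
    rw [hw, hwl, hζη]; field_simp; ring
  have hnη : 1 / 2 ≤ ‖1 + η‖ := by
    have := norm_sub_le (1 + η) η
    simp at this; linarith
  have hdist : dist w wl ≤ 2 * ‖η‖ ^ 2 / (c ^ 2 * T) := by
    rw [dist_eq_norm, hdiff, norm_neg, norm_div, norm_pow, norm_mul, norm_mul, norm_pow, Complex.norm_real,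
      Complex.norm_real, Real.norm_of_nonneg hc.le, Real.norm_of_nonneg hT.le]
    rw [div_le_div_iff₀ (by positivity) (by positivity)]
    have : 0 ≤ ‖η‖ ^ 2 * (c ^ 2 * T) := by positivity
    nlinarith
  have hρ : 0 < v / K := by positivity
  have hball : 2 * ‖η‖ ^ 2 / (c ^ 2 * T) = (2 * K * ‖η‖ ^ 2 * T / y) * (v / K) := by
    rw [hv]; field_simp
  have hwball : w ∈ Metric.ball wl (v / K) := by
    rw [Metric.mem_ball]
    refine hdist.trans_lt ?_
    rw [hball]; nlinarith
  have himb : ∀ w' ∈ Metric.ball wl (v / K), v * (2 * κ / K) ≤ w'.im := by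
    intro w' hw'
    rw [Metric.mem_ball, dist_eq_norm] at hw'
    have h3 := (Complex.abs_im_le_norm (w' - wl)).trans hw'.le
    rw [Complex.sub_im, hwlim] at h3
    have h4 := (abs_le.1 h3).1
    have : v * (2 * κ / K) = v - v / K := by rw [hK]; field_simp; ring
    rw [this]; linarith
  have hgb : ∀ w' ∈ Metric.ball wl (v / K), ‖g w'‖ ≤ 2 * M / v ^ κ := by
    intro w' hw'
    have i1 := himb w' hw'
    have i0 : 0 < v * (2 * κ / K) := by positivity
    have := hg.bound w' (i0.trans_le i1)
    rw [← le_div_iff₀ (pow_pos (i0.trans_le i1) _)] at this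
    refine this.trans ?_
    rw [div_le_div_iff₀ (pow_pos (i0.trans_le i1) _) (by positivity)]
    have i2 : v ^ κ ≤ 2 * w'.im ^ κ := by
      have e : v = (v * (2 * κ / K)) * (1 + 1 / (2 * κ)) := by rw [hK]; field_simp
      calc v ^ κ = (v * (2 * κ / K)) ^ κ * (1 + 1 / (2 * κ)) ^ κ := by rw [← mul_pow, ← e]
        _ ≤ w'.im ^ κ * 2 := by
          have := ratio_pow κ hκ
          have := pow_nonneg (i0.trans_le i1).le κ
          gcongr
        _ = _ := by ring
    nlinarith
  have hsch := Complex.dist_le_div_mul_dist_of_mapsTo_ball (f := g) (c := wl) (z := w)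
    (R₁ := v / K) (R₂ := 5 * M / v ^ κ)
    (hg.diff.mono (fun w' hw' => by
      have i0 : 0 < v * (2 * κ / K) := by positivity
      exact i0.trans_le (himb w' hw')))
    (fun w' hw' => by
      rw [Metric.mem_closedBall, dist_eq_norm]
      refine (norm_sub_le _ _).trans ?_
      have a1 := hgb w' hw'
      have a2 := hgb wl (Metric.mem_ball_self hρ)
      have a3 : 5 * M / v ^ κ = 2 * M / v ^ κ + 2 * M / v ^ κ + M / v ^ κ := by ring
      have a4 : 0 ≤ M / v ^ κ := by positivity
      linarith) hwball
  have hB : ‖(v : ℂ) ^ κ * g w - (v : ℂ) ^ κ * g wl‖ ≤ 5 * M * (2 * K * ‖η‖ ^ 2 * T / y) := by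
    rw [← mul_sub, norm_mul, norm_pow, Complex.norm_real, Real.norm_of_nonneg hv0.le, ← dist_eq_norm]
    calc v ^ κ * dist (g w) (g wl) ≤ v ^ κ * (5 * M / v ^ κ / (v / K) * (2 * ‖η‖ ^ 2 / (c ^ 2 * T))) := by
          gcongr
          refine hsch.trans ?_
          gcongr
      _ = _ := by rw [hball]; field_simp
  have hA : ‖(y : ℂ) ^ κ * F (α + ζ) - (v : ℂ) ^ κ * g w‖ ≤ M * (2 * (K * ‖η‖)) := by
    rw [hgw]
    have e : (y : ℂ) ^ κ * F (α + ζ) - (y : ℂ) ^ κ * F (α + ζ) * (1 + η) ^ (2 * κ)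
       = -((y : ℂ) ^ κ * F (α + ζ) * ((1 + η) ^ (2 * κ) - 1)) := by ring
    rw [e, norm_neg, norm_mul]
    have p1 := pow_sub_one_bound η (2 * κ)
    have p2 : ((2 * κ : ℕ) : ℝ) * ‖η‖ ≤ K * ‖η‖ := by
      gcongr; push_cast; linarith
    have p3 : |((2 * κ : ℕ) : ℝ) * ‖η‖| ≤ 1 := by
      rw [abs_of_nonneg (by positivity)]; linarith
    have p4 := Real.abs_exp_sub_one_le p3
    rw [abs_of_nonneg (a := ((2 * κ : ℕ) : ℝ) * ‖η‖) (by positivity)] at p4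
    have p5 := (le_abs_self _).trans p4
    have p6 : ‖(1 + η) ^ (2 * κ) - 1‖ ≤ 2 * (K * ‖η‖) := by linarith
    exact mul_le_mul hFn p6 (norm_nonneg _) hM.le
  have htot := norm_sub_le_norm_sub_add_norm_sub ((y : ℂ) ^ κ * F (α + ζ)) ((v : ℂ) ^ κ * g w) ((v : ℂ) ^ κ * g wl)
  have hMK : 0 ≤ M * K * ‖η‖ := by positivity
  calc _ ≤ _ := htot
    _ ≤ M * (2 * (K * ‖η‖)) + 5 * M * (2 * K * ‖η‖ ^ 2 * T / y) := add_le_add hA hB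
    _ = 2 * (M * K * ‖η‖) + 10 * M * K * ‖η‖ ^ 2 * T / y := by ring
    _ ≤ 8 * (M * K * ‖η‖) + 10 * M * K * ‖η‖ ^ 2 * T / y := by linarith
    _ = _ := by ring

lemma linearize_quad {κ N : ℕ} (hκ : 1 ≤ κ) {M : ℝ} (hM : 0 < M) {F g : ℂ → ℂ} {b : ℕ → ℂ}
    (hF : ∀ w : ℂ, 0 < w.im → ‖F w‖ * w.im ^ κ ≤ M) (hg : Good κ N M g b)
    {α δ c T y v H : ℝ} (hH : 0 < H) (hc : 0 < c) (hT : 0 < T) (hy : 0 < y) (hv : v = y / (c ^ 2 * T ^ 2))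
    (hrel : ∀ ζ : ℂ, 0 < ζ.im → F (α + ζ) = ((c * ζ) ^ (2 * κ))⁻¹ * g (-δ - 1 / (c ^ 2 * ζ)))
    (s : ℝ) :
    ‖(y : ℂ) ^ κ * F (α + (T + s + y * I)) - (v : ℂ) ^ κ *
        g (-δ - 1 / (c ^ 2 * T) + ((s + y * I) / T) / (c ^ 2 * T))‖ ≤
      M * ((2 * κ + 1) * (8 / (H * T) + 18 * y / T + 10 / (H ^ 2 * T * y))) * (1 + H ^ 2 * s ^ 2) := by
  refine (linearize hκ hM hF hg hc hT hy hv hrel s _ rfl).trans ?_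
  have hn1 : ‖((s : ℂ) + y * I) / T‖ ≤ (|s| + y) / T := by
    rw [norm_div, Complex.norm_real, Real.norm_of_nonneg hT.le]
    gcongr
    refine (norm_add_le _ _).trans ?_
    simp [abs_of_pos hy]
  have hn2 : ‖((s : ℂ) + y * I) / T‖ ^ 2 = (s ^ 2 + y ^ 2) / T ^ 2 := by
    rw [norm_div, div_pow, Complex.norm_real, Real.norm_of_nonneg hT.le, Complex.norm_add_mul_I,
      Real.sq_sqrt (by positivity)]
  rw [hn2]
  set P := 1 + H ^ 2 * s ^ 2 with hP
  have hP1 : 1 ≤ P := by have : 0 ≤ H ^ 2 * s ^ 2 := by positivity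
                         linarith
  have hs1 : |s| ≤ P / H := by
    rw [le_div_iff₀ hH, hP, ← sq_abs s]; nlinarith [sq_nonneg (H * |s| - 1), abs_nonneg s]
  have hs2 : s ^ 2 ≤ P / H ^ 2 := by rw [le_div_iff₀ (by positivity), hP]; linarith
  have key : 8 * ‖((s : ℂ) + y * I) / T‖ + 10 * ((s ^ 2 + y ^ 2) / T ^ 2) * T / y
      ≤ (8 / (H * T) + 18 * y / T + 10 / (H ^ 2 * T * y)) * P := by
    have k0 : y ≤ y * P := by nlinarith
    calc _ ≤ 8 * ((P / H + y * P) / T) + 10 * ((P / H ^ 2 + y ^ 2 * P) / T ^ 2) * T / y := by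
          gcongr
          · exact hn1.trans (by gcongr)
          · nlinarith
      _ = _ := by field_simp; ring
  calc _ ≤ M * (2 * κ + 1) * ((8 / (H * T) + 18 * y / T + 10 / (H ^ 2 * T * y)) * P) := by gcongr
    _ = _ := by ring

lemma near_zero {κ N : ℕ} (hκ : 1 ≤ κ) (hN : 1 ≤ N) {M : ℝ} (hM : 0 < M) {F g : ℂ → ℂ} {b : ℕ → ℂ}
    (hF : ∀ w : ℂ, 0 < w.im → ‖F w‖ * w.im ^ κ ≤ M) (hg : Good κ N M g b)
    (hrel : ∀ ζ : ℂ, 0 < ζ.im → F ζ = (ζ ^ (2 * κ))⁻¹ * g (-1 / ζ))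
    {y H : ℝ} (hy : 0 < y) (hH : 0 < H) (t : ℝ) :
    ‖(y : ℂ) ^ κ * F (t + y * I)‖ ≤
      M * ((2 * κ + 2) * N * (1 / (H ^ 2 * y) + y)) * (1 + H ^ 2 * t ^ 2) := by
  have hpi := Real.pi_gt_three
  have hκ' : (1 : ℝ) ≤ κ := by exact_mod_cast hκ
  have hN' : (1 : ℝ) ≤ N := by exact_mod_cast hN
  set ζ : ℂ := t + y * I with hζ
  have hζim : ζ.im = y := by simp [hζ]
  have hζ0 : ζ ≠ 0 := by intro h; rw [h] at hζim; simp at hζim; linarith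
  have hns : ‖ζ‖ ^ 2 = t ^ 2 + y ^ 2 := by
    rw [hζ, Complex.norm_add_mul_I, Real.sq_sqrt (by positivity)]
  set v := y / (t ^ 2 + y ^ 2) with hv
  have hv0 : 0 < v := by positivity
  have hwim : (-1 / ζ).im = v := by
    rw [neg_div, one_div, Complex.neg_im, Complex.inv_im, hζim, Complex.normSq_eq_norm_sq, hns, hv]; ring
  have hFn : ‖(y : ℂ) ^ κ * F ζ‖ ≤ M := by
    have := hF ζ (by rw [hζim]; exact hy)
    rw [norm_mul, norm_pow, Complex.norm_real, Real.norm_of_nonneg hy.le]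
    rw [hζim] at this; linarith
  have hEq : ‖(y : ℂ) ^ κ * F ζ‖ = v ^ κ * ‖g (-1 / ζ)‖ := by
    rw [hrel ζ (by rw [hζim]; exact hy), norm_mul, norm_mul, norm_inv, norm_pow, norm_pow, pow_mul, hns,
      Complex.norm_real, Real.norm_of_nonneg hy.le, hv, div_pow]
    field_simp
  set u := Real.pi * v / N with hu
  have hu0 : 0 < u := by positivity
  have hmain : ‖(y : ℂ) ^ κ * F ζ‖ ≤ M * (2 * κ + 2) / u := by
    by_cases hc : 2 * κ ≤ u
    swap
    · push Not at hc
      refine hFn.trans ?_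
      rw [le_div_iff₀ hu0]; nlinarith
    have hw0 : 0 < (-1 / ζ).im := by rw [hwim]; exact hv0
    have := geo_sum (c := fun m : ℕ => b m * cexp (2 * Real.pi * I * m * (-1 / ζ) / N))
      (A := M / (v / 2) ^ κ) hu0 (by simp [hg.zero]) (by
        intro m hm
        rw [norm_mul, norm_e, hwim]
        have h1 := hg.coeff m (v / 2) (by linarith)
        rw [← le_div_iff₀ (by positivity)] at h1
        have h2 : Real.exp (-(2 * Real.pi * m * v / N)) =
            Real.exp (-(2 * Real.pi * m * (v / 2) / N)) * Real.exp (-(m * u)) := by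
          rw [← Real.exp_add]
          congr 1
          rw [hu]
          field_simp
          ring
        rw [h2, ← mul_assoc]
        gcongr)
    have hn : ‖g (-1 / ζ)‖ ≤ M / (v / 2) ^ κ / (Real.exp u - 1) := by
      rw [← (hg.sum _ hw0).tsum_eq]
      exact (norm_tsum_le_tsum_norm this.1).trans this.2
    rw [hEq]
    have he : Real.exp (u / 2) * (u / 2) ≤ Real.exp u - 1 := by
      have e1 : Real.exp u = Real.exp (u / 2) * Real.exp (u / 2) := by rw [← Real.exp_add]; congr 1; ring
      have e2 := Real.add_one_le_exp (u / 2)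
      rw [e1]; nlinarith
    have h2κ : (2 : ℝ) ^ κ ≤ Real.exp (u / 2) := by
      have a1 : (2 : ℝ) ≤ Real.exp 1 := by have := Real.add_one_le_exp (1 : ℝ); linarith
      calc (2 : ℝ) ^ κ ≤ Real.exp 1 ^ κ := by gcongr
        _ = Real.exp κ := by rw [← Real.exp_nat_mul]; simp
        _ ≤ _ := by rw [Real.exp_le_exp]; linarith
    have hep := Real.exp_pos (u / 2)
    have hpos : 0 < Real.exp u - 1 := lt_of_lt_of_le (by positivity) he
    calc v ^ κ * ‖g (-1 / ζ)‖ ≤ v ^ κ * (M / (v / 2) ^ κ / (Real.exp u - 1)) := by gcongr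
      _ = M * 2 ^ κ / (Real.exp u - 1) := by rw [div_pow v 2]; clear_value v; field_simp
      _ ≤ M * Real.exp (u / 2) / (Real.exp (u / 2) * (u / 2)) := by gcongr
      _ = M * 2 / u := by field_simp
      _ ≤ _ := by gcongr; linarith
  refine hmain.trans ?_
  have e1 : M * (2 * κ + 2) / u = M * (2 * κ + 2) * N * ((t ^ 2 + y ^ 2) / y) * (1 / Real.pi) := by
    rw [hu, hv]; field_simp
  rw [e1]
  have e2 : 1 / Real.pi ≤ 1 := by rw [div_le_one (by linarith)]; linarith
  have e3 : (t ^ 2 + y ^ 2) / y ≤ (1 / (H ^ 2 * y) + y) * (1 + H ^ 2 * t ^ 2) := by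
    have : (1 / (H ^ 2 * y) + y) * (1 + H ^ 2 * t ^ 2) = (t ^ 2 + y ^ 2) / y + (1 / (H ^ 2 * y) + y * H ^ 2 * t ^ 2) := by
      field_simp; ring
    rw [this]
    have : 0 ≤ (1 / (H ^ 2 * y) + y * H ^ 2 * t ^ 2) := by positivity
    linarith
  have e4 : 0 ≤ M * (2 * κ + 2) * N * ((t ^ 2 + y ^ 2) / y) := by positivity
  calc _ ≤ M * (2 * κ + 2) * N * ((t ^ 2 + y ^ 2) / y) * 1 := by gcongr
    _ ≤ M * (2 * κ + 2) * N * ((1 / (H ^ 2 * y) + y) * (1 + H ^ 2 * t ^ 2)) * 1 := by gcongr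
    _ = _ := by ring

lemma norm_e_real (x s : ℝ) : ‖cexp (2 * Real.pi * I * ((x : ℂ) * s))‖ = 1 := by
  have : (2 * Real.pi * I * ((x : ℂ) * s)) = ((2 * Real.pi * (x * s) : ℝ) : ℂ) * I := by
    push_cast; ring
  rw [this, Complex.norm_exp_ofReal_mul_I]

lemma gauss_integrable {H : ℝ} (hH : 0 < H) (μ lam : ℝ) (a : ℕ → ℂ) (ha : Summable fun n => ‖a n‖) :
    MeasureTheory.Integrable (fun s : ℝ =>
      (∑' n : ℕ, a n * cexp (2 * Real.pi * I * (((n * lam : ℝ) : ℂ) * s))) * gk H μ s) := by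
  have hn : ∀ (n : ℕ) (s : ℝ), ‖a n * cexp (2 * Real.pi * I * (((n * lam : ℝ) : ℂ) * s))‖ = ‖a n‖ := by
    intro n s
    rw [norm_mul, norm_e_real, mul_one]
  have hk : MeasureTheory.Integrable (fun s : ℝ => gk H μ s) := by
    have := gk_term_integrable hH μ 0
    simpa using this
  refine hk.bdd_mul (c := ∑' n, ‖a n‖) ?_ (Filter.Eventually.of_forall fun s => ?_)
  · refine (continuous_tsum (fun n => by fun_prop) ha (fun n s => (hn n s).le)).aestronglyMeasurable
  · refine (norm_tsum_le_tsum_norm ?_).trans (le_of_eq ?_)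
    · simp_rw [hn]; exact ha
    · simp_rw [hn]

lemma Good.summ {κ N : ℕ} (hN : 1 ≤ N) {M : ℝ} {g : ℂ → ℂ} {b : ℕ → ℂ}
    (hg : Good κ N M g b) (w : ℂ) (hw : 0 < w.im) :
    Summable (fun m : ℕ => ‖b m * cexp (2 * Real.pi * I * m * w / N)‖) := by
  have hN' : (1 : ℝ) ≤ N := by exact_mod_cast hN
  refine (geo_sum (A := M / (w.im / 2) ^ κ) (δ := Real.pi * w.im / N) (by positivity) (by simp [hg.zero]) ?_).1
  intro m hm
  rw [norm_mul, norm_e]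
  have h1 := hg.coeff m (w.im / 2) (by linarith)
  rw [← le_div_iff₀ (by positivity)] at h1
  have h2 : Real.exp (-(2 * Real.pi * m * w.im / N)) =
      Real.exp (-(2 * Real.pi * m * (w.im / 2) / N)) * Real.exp (-(m * (Real.pi * w.im / N))) := by
    rw [← Real.exp_add]
    congr 1
    field_simp
    ring
  rw [h2, ← mul_assoc]
  gcongr

/-- The expansion along a horizontal line, integrated against the kernel. -/
lemma Good.line {κ N : ℕ} (hN : 1 ≤ N) {M : ℝ} {g : ℂ → ℂ} {b : ℕ → ℂ}
    (hg : Good κ N M g b) (w : ℂ) (hw : 0 < w.im) (r : ℝ) {H : ℝ} (hH : 0 < H) (μ : ℝ) (q : ℂ) :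
    MeasureTheory.Integrable (fun s : ℝ => (q * g (w + r * s)) * gk H μ s) ∧
    ∫ s : ℝ, (q * g (w + r * s)) * gk H μ s =
      ∑' n : ℕ, (q * (b n * cexp (2 * Real.pi * I * n * w / N))) *
        (Real.exp (-Real.pi * (n * (r / N) - μ) ^ 2 / H ^ 2) : ℂ) := by
  have hNc : (N : ℂ) ≠ 0 := by exact_mod_cast (by omega : N ≠ 0)
  have hs : Summable (fun n : ℕ => ‖q * (b n * cexp (2 * Real.pi * I * n * w / N))‖) := by
    simp_rw [norm_mul q]
    exact (hg.summ hN w hw).mul_left _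
  have e : ∀ s : ℝ, q * g (w + r * s) = ∑' n : ℕ, (q * (b n * cexp (2 * Real.pi * I * n * w / N))) *
      cexp (2 * Real.pi * I * (((n * (r / N) : ℝ) : ℂ) * s)) := by
    intro s
    rw [← (hg.sum (w + r * s) (by simpa using hw)).tsum_eq, ← tsum_mul_left]
    refine tsum_congr fun n => ?_
    rw [mul_assoc q, mul_assoc (b n), ← Complex.exp_add]
    congr 3
    push_cast
    field_simp
  simp_rw [e]
  exact ⟨gauss_integrable hH μ (r / N) _ hs, gauss_sum hH μ (r / N) _ hs⟩

lemma combine {κ N : ℕ} (hκ : 1 ≤ κ) (hN : 1 ≤ N) {M : ℝ} (hM : 0 < M) {F g gS : ℂ → ℂ} {b bS : ℕ → ℂ}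
    {β : ℕ → ℝ} (hF : Good κ 1 M F (fun n => (β n : ℂ))) (hS : Good κ N M gS bS) (hg : Good κ N M g b)
    (hrelS : ∀ ζ : ℂ, 0 < ζ.im → F ζ = (ζ ^ (2 * κ))⁻¹ * gS (-1 / ζ))
    {α δ c T y v H μ lam D : ℝ} (hH : 0 < H) (hc : 0 < c) (hT : 0 < T) (hy : 0 < y) (hv : v = y / (c ^ 2 * T ^ 2))
    (hrel : ∀ ζ : ℂ, 0 < ζ.im → F (α + ζ) = ((c * ζ) ^ (2 * κ))⁻¹ * g (-δ - 1 / (c ^ 2 * ζ)))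
    {m : ℕ} (hlam : 1 ≤ lam) (hlam' : 1 / (c ^ 2 * T ^ 2) / N = lam) (hmu : m * lam = μ)
    (hbig : M / (N * (2 * κ + 1)) ≤ ‖b m‖ * Real.exp (-(2 * Real.pi * m * v / N)) * v ^ κ)
    (hD : 0 ≤ D) (hpos : ∀ n : ℕ, |n - μ| < D → 0 ≤ β n) :
    1 / (N * (2 * κ + 1)) ≤
      2 * ((2 * κ + 1) * (8 / (H * T) + 18 * y / T + 10 / (H ^ 2 * T * y)))
      + 2 * ((2 * κ + 2) * N * (1 / (H ^ 2 * y) + y))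
      + 2 * (Real.exp (-Real.pi * lam ^ 2 / (2 * H ^ 2)) * (4 * μ ^ 2 + 3 * H ^ 2))
      + 4 * (Real.exp (-Real.pi * D ^ 2 / (2 * H ^ 2)) * (4 * μ ^ 2 + 3 * H ^ 2)) := by
  set κD := (2 * κ + 1) * (8 / (H * T) + 18 * y / T + 10 / (H ^ 2 * T * y)) with hκD
  set κ0 := (2 * κ + 2) * N * (1 / (H ^ 2 * y) + y) with hκ0
  set B2 := Real.exp (-Real.pi * lam ^ 2 / (2 * H ^ 2)) * (4 * μ ^ 2 + 3 * H ^ 2) with hB2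
  set B1 := Real.exp (-Real.pi * D ^ 2 / (2 * H ^ 2)) * (4 * μ ^ 2 + 3 * H ^ 2) with hB1
  have hB1p : 0 ≤ B1 := by positivity
  have hB2p : 0 ≤ B2 := by positivity
  have hv0 : 0 < v := by rw [hv]; positivity
  have hTc : (T : ℂ) ≠ 0 := by exact_mod_cast hT.ne'
  have hcc : (c : ℂ) ≠ 0 := by exact_mod_cast hc.ne'
  have hNc : (N : ℂ) ≠ 0 := by exact_mod_cast (by omega : N ≠ 0)
  -- weights and coefficients
  set wt : ℕ → ℝ := fun n => Real.exp (-Real.pi * (n * 1 - μ) ^ 2 / H ^ 2) with hwt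
  have hwt0 : ∀ n, 0 ≤ wt n := fun n => (Real.exp_pos _).le
  have hwt1 : ∀ n, wt n ≤ 1 := fun n => by
    rw [hwt]; dsimp only; rw [Real.exp_le_one_iff]
    apply div_nonpos_of_nonpos_of_nonneg _ (by positivity)
    nlinarith [Real.pi_pos, sq_nonneg ((n : ℝ) * 1 - μ)]
  set a : ℕ → ℝ := fun n => y ^ κ * (β n * Real.exp (-(2 * Real.pi * n * y))) with ha
  have hnorm : ∀ (θ : ℝ) (n : ℕ), ‖(y : ℂ) ^ κ * ((β n : ℂ) * cexp (2 * Real.pi * I * n * (θ + y * I) / (1 : ℕ)))‖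
      = |a n| := by
    intro θ n
    rw [norm_mul, norm_mul, norm_e, norm_pow, Complex.norm_real, Complex.norm_real, Real.norm_of_nonneg hy.le,
      ha, abs_mul, abs_mul, abs_of_pos (Real.exp_pos _), abs_of_pos (pow_pos hy _)]
    simp
  have haM : ∀ n, |a n| ≤ M := by
    intro n
    have := hF.coeff n y hy
    rw [← hnorm 0 n, norm_mul, norm_mul, norm_e, norm_pow, Complex.norm_real, Real.norm_of_nonneg hy.le]
    simp at this ⊢
    linarith
  have hasum : Summable (fun n => |a n|) := by
    have := (hF.summ le_rfl (y * I) (by simpa using hy)).mul_left (y ^ κ)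
    refine this.congr fun n => ?_
    rw [← hnorm 0 n, norm_mul ((y : ℂ) ^ κ), norm_pow, Complex.norm_real, Real.norm_of_nonneg hy.le]
    simp
  have hawsum : Summable (fun n => |a n| * wt n) :=
    Summable.of_nonneg_of_le (fun n => mul_nonneg (abs_nonneg _) (hwt0 n))
      (fun n => mul_le_of_le_one_right (abs_nonneg _) (hwt1 n)) hasum
  have hawsum' : Summable (fun n => a n * wt n) := by
    refine Summable.of_norm ?_
    refine hawsum.congr fun n => ?_
    rw [Real.norm_eq_abs, abs_mul (a n) (wt n), abs_of_nonneg (hwt0 n)]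
  -- the sums G(θ)
  have hline : ∀ θ : ℝ, _ := fun θ : ℝ =>
    hF.line le_rfl (θ + y * I) (by simpa using hy) 1 hH μ ((y : ℂ) ^ κ)
  -- upper bound
  have hG0 : ∑' n, a n * wt n ≤ 2 * (M * κ0) := by
    have h1 := (hline 0).2
    have h2 := gauss_bound hH μ (fun s : ℝ => (y : ℂ) ^ κ * F ((0 : ℝ) + y * I + (1 : ℝ) * s)) (M * κ0) (by
      intro s
      have := near_zero hκ hN hM hF.bound hS hrelS hy hH s
      have e : (((0 : ℝ) : ℂ) + y * I + ((1 : ℝ) : ℂ) * s) = s + y * I := by push_cast; ring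
      rw [e]
      exact this)
    rw [h1] at h2
    have e : ∑' n : ℕ, ((y : ℂ) ^ κ * ((β n : ℂ) * cexp (2 * Real.pi * I * n * ((0 : ℝ) + y * I) / (1 : ℕ)))) *
        (Real.exp (-Real.pi * (n * (1 / (1 : ℕ)) - μ) ^ 2 / H ^ 2) : ℂ) = ((∑' n, a n * wt n : ℝ) : ℂ) := by
      rw [Complex.ofReal_tsum]
      refine tsum_congr fun n => ?_
      rw [ha, hwt]
      push_cast
      congr 3
      · congr 1
        congr 1
        have : (2 * Real.pi * I * n * (0 + y * I) / 1 : ℂ) = 2 * Real.pi * n * y * (I * I) := by ring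
        rw [this, Complex.I_mul_I]; ring
      · ring
    rw [e, Complex.norm_real] at h2
    exact (le_abs_self _).trans h2
  have hsum : ∑' n, |a n| * wt n ≤ 2 * (M * κ0) + 2 * (2 * M * B1) := by
    have h1 : ∀ n : ℕ, ‖(((|a n| - a n) * wt n : ℝ) : ℂ)‖ ≤ (2 * M * B1) * (1 / (n : ℝ) ^ 2) := by
      intro n
      have hz : 0 ≤ |a n| - a n := by linarith [le_abs_self (a n)]
      rw [Complex.norm_real, Real.norm_of_nonneg (mul_nonneg hz (hwt0 n))]
      have hr : 0 ≤ (2 * M * B1) * (1 / (n : ℝ) ^ 2) := by positivity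
      rcases Nat.eq_zero_or_pos n with h0 | h0
      · have : a n = 0 := by
          have hzz := hF.zero
          simp only [Complex.ofReal_eq_zero] at hzz
          rw [ha, h0]; simp [hzz]
        rw [this]; simpa using hr
      · by_cases hd : |n - μ| < D
        · have : 0 ≤ a n := by rw [ha]; have := hpos n hd; positivity
          rw [abs_of_nonneg this]; simpa using hr
        · push Not at hd
          have ht := gauss_tail (H := H) (μ := μ) (lam := 1) (D := D) hH le_rfl hD n h0 (by simpa using hd)
          have h2 : |a n| - a n ≤ 2 * M := by
            have := neg_abs_le (a n); linarith [haM n]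
          calc (|a n| - a n) * wt n ≤ (2 * M) * (B1 * (1 / (n : ℝ) ^ 2)) := by
                apply mul_le_mul h2 ht (hwt0 n) (by linarith)
            _ = _ := by ring
    have h2 := tail_sum (by positivity) h1
    have h3 : (fun n => |a n| * wt n) = fun n => a n * wt n + (|a n| - a n) * wt n := by
      funext n; ring
    have h4 : ∀ n, ‖(((|a n| - a n) * wt n : ℝ) : ℂ)‖ = (|a n| - a n) * wt n := by
      intro n
      rw [Complex.norm_real, Real.norm_of_nonneg]
      exact mul_nonneg (by linarith [le_abs_self (a n)]) (hwt0 n)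
    simp_rw [h4] at h2
    rw [h3, hawsum'.tsum_add h2.1]
    exact add_le_add hG0 h2.2
  have hGθ : ∀ θ : ℝ, ‖∫ s : ℝ, ((y : ℂ) ^ κ * F (θ + y * I + (1 : ℝ) * s)) * gk H μ s‖ ≤
      2 * (M * κ0) + 2 * (2 * M * B1) := by
    intro θ
    rw [(hline θ).2]
    have e : ∀ n : ℕ, ‖((y : ℂ) ^ κ * ((β n : ℂ) * cexp (2 * Real.pi * I * n * (θ + y * I) / (1 : ℕ)))) *
        (Real.exp (-Real.pi * (n * (1 / (1 : ℕ)) - μ) ^ 2 / H ^ 2) : ℂ)‖ = |a n| * wt n := by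
      intro n
      rw [norm_mul, hnorm, Complex.norm_real, Real.norm_of_nonneg (Real.exp_pos _).le, hwt]
      simp
    refine (norm_tsum_le_tsum_norm ?_).trans ?_
    · simp_rw [e]; exact hawsum
    · simp_rw [e]; exact hsum
  -- lower bound
  set wl : ℂ := -δ - 1 / (c ^ 2 * T) + (y * I / T) / (c ^ 2 * T) with hwl
  have hwlim : wl.im = v := by
    have : wl = ((-δ - 1 / (c ^ 2 * T) : ℝ) : ℂ) + (v : ℝ) * I := by
      rw [hwl, hv]; push_cast; field_simp
    rw [this, Complex.add_im, Complex.ofReal_im, Complex.im_ofReal_mul, Complex.I_im]; ring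
  have hJ := hg.line hN wl (by rw [hwlim]; exact hv0) (1 / (c ^ 2 * T ^ 2)) hH μ ((v : ℂ) ^ κ)
  rw [hlam'] at hJ
  set A : ℕ → ℂ := fun n => ((v : ℂ) ^ κ * (b n * cexp (2 * Real.pi * I * n * wl / N))) with hA
  have hAn : ∀ n, ‖A n‖ = ‖b n‖ * Real.exp (-(2 * Real.pi * n * v / N)) * v ^ κ := by
    intro n
    rw [hA]; dsimp only
    rw [norm_mul, norm_mul, norm_e, hwlim, norm_pow, Complex.norm_real, Real.norm_of_nonneg hv0.le]; ring
  have hJlow : M / (N * (2 * κ + 1)) ≤ ‖∑' n : ℕ, A n * (Real.exp (-Real.pi * (n * lam - μ) ^ 2 / H ^ 2) : ℂ)‖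
      + 2 * (M * B2) := by
    set C : ℕ → ℂ := fun n => A n * (Real.exp (-Real.pi * (n * lam - μ) ^ 2 / H ^ 2) : ℂ) with hC
    have h1 : ∀ n : ℕ, ‖(if n = m then 0 else C n)‖ ≤ (M * B2) * (1 / (n : ℝ) ^ 2) := by
      intro n
      have hr : 0 ≤ (M * B2) * (1 / (n : ℝ) ^ 2) := by positivity
      split_ifs with hnm
      · simpa using hr
      · rcases Nat.eq_zero_or_pos n with h0 | h0
        · have : C n = 0 := by rw [hC, hA, h0]; simp [hg.zero]
          rw [this]; simpa using hr
        · have ht := gauss_tail (H := H) (μ := μ) (lam := lam) (D := lam) hH hlam (by linarith) n h0 (by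
            rw [← hmu, ← sub_mul, abs_mul, abs_of_nonneg (by linarith : (0 : ℝ) ≤ lam)]
            have : (1 : ℝ) ≤ |(n : ℝ) - m| := by
              have h5 : (n : ℤ) - m ≠ 0 := by omega
              have h6 := Int.one_le_abs h5
              exact_mod_cast h6
            nlinarith)
          rw [hC]; dsimp only
          rw [norm_mul, Complex.norm_real, Real.norm_of_nonneg (Real.exp_pos _).le, hAn, mul_assoc M]
          exact mul_le_mul (hg.coeff n v hv0) ht (Real.exp_pos _).le hM.le
    have h2 := tail_sum (by positivity) h1
    have hs2 : Summable (fun n => (if n = m then 0 else C n)) := h2.1.of_norm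
    have hCm : ‖C m‖ = ‖b m‖ * Real.exp (-(2 * Real.pi * m * v / N)) * v ^ κ := by
      rw [hC]; dsimp only
      rw [hmu, sub_self]; simp [hAn]
    have hsC : Summable C := by
      have : C = fun n => (if n = m then C m else 0) + (if n = m then 0 else C n) := by
        funext n; by_cases h : n = m <;> simp [h]
      rw [this]
      exact (hasSum_ite_eq m (C m)).summable.add hs2
    rw [hsC.tsum_eq_add_tsum_ite m]
    have h3 := norm_sub_le (C m + ∑' n, (if n = m then 0 else C n)) (∑' n, (if n = m then 0 else C n))
    rw [add_sub_cancel_right, hCm] at h3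
    have h4 := (norm_tsum_le_tsum_norm h2.1).trans h2.2
    linarith
  -- difference
  have hdiff := gauss_bound hH μ (fun s : ℝ => (y : ℂ) ^ κ * F (((α + T : ℝ) : ℂ) + y * I + (1 : ℝ) * s) -
      (v : ℂ) ^ κ * g (wl + (1 / (c ^ 2 * T ^ 2) : ℝ) * s)) (M * κD) (by
    intro s
    have := linearize_quad hκ hM hF.bound hg hH hc hT hy hv hrel s
    have e1 : (((α + T : ℝ) : ℂ) + y * I + (1 : ℝ) * s) = (α + (T + s + y * I)) := by push_cast; ring
    have e2 : wl + (1 / (c ^ 2 * T ^ 2) : ℝ) * s = (-δ - 1 / (c ^ 2 * T) + ((s + y * I) / T) / (c ^ 2 * T)) := by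
      rw [hwl]; push_cast; field_simp; ring
    rw [e1, e2]
    exact this)
  simp_rw [sub_mul] at hdiff
  rw [MeasureTheory.integral_sub (hline (α + T)).1 hJ.1, hJ.2] at hdiff
  have hfin := norm_sub_norm_le (∑' n : ℕ, A n * (Real.exp (-Real.pi * (n * lam - μ) ^ 2 / H ^ 2) : ℂ))
    (∫ s : ℝ, ((y : ℂ) ^ κ * F (((α + T : ℝ) : ℂ) + y * I + (1 : ℝ) * s)) * gk H μ s)
  rw [norm_sub_rev] at hfin
  have hup := hGθ (α + T)
  have htot : M / (N * (2 * κ + 1)) ≤ M * (2 * κD + 2 * κ0 + 2 * B2 + 4 * B1) := by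
    linarith
  have : M * (1 / (N * (2 * κ + 1))) ≤ M * (2 * κD + 2 * κ0 + 2 * B2 + 4 * B1) := by
    rw [mul_one_div]; exact htot
  exact le_of_mul_le_mul_left this hM

lemma pow_exp_tendsto {s : ℝ} (hs : 0 < s) :
    Filter.Tendsto (fun r : ℝ => r ^ (85 : ℕ) * Real.exp (-(Real.pi / 8) * r ^ s)) Filter.atTop (nhds 0) := by
  have h1 := tendsto_rpow_mul_exp_neg_mul_atTop_nhds_zero (85 / s) (Real.pi / 8) (by positivity)
  have h2 := h1.comp (tendsto_rpow_atTop hs)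
  refine h2.congr' ?_
  filter_upwards [Filter.eventually_gt_atTop 0] with r hr
  simp only [Function.comp]
  rw [← Real.rpow_mul hr.le, mul_div_cancel₀ _ hs.ne', ← Real.rpow_natCast]
  norm_num

lemma numeric {ε : ℝ} (hε : 0 < ε) : ∃ R0 : ℝ, 1 ≤ R0 ∧ ∀ r : ℝ, R0 ≤ r →
    528 / r ^ 12 + 20 / r ^ 34 + 38 * (Real.exp (-(Real.pi / 8) * r ^ (4 : ℝ)) * r ^ 84)
      + 76 * (Real.exp (-(Real.pi / 8) * r ^ (84 * ε)) * r ^ 84) < 1 / (2 * r) := by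
  have h1 : Filter.Tendsto (fun r : ℝ => 528 * (r ^ 11)⁻¹ + 20 * (r ^ 33)⁻¹
      + 38 * (r ^ (85 : ℕ) * Real.exp (-(Real.pi / 8) * r ^ (4 : ℝ)))
      + 76 * (r ^ (85 : ℕ) * Real.exp (-(Real.pi / 8) * r ^ (84 * ε)))) Filter.atTop
      (nhds (528 * 0 + 20 * 0 + 38 * 0 + 76 * 0)) := by
    have t1 : Filter.Tendsto (fun r : ℝ => (r ^ 11)⁻¹) Filter.atTop (nhds 0) :=
      (Filter.tendsto_pow_atTop (by norm_num)).inv_tendsto_atTop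
    have t2 : Filter.Tendsto (fun r : ℝ => (r ^ 33)⁻¹) Filter.atTop (nhds 0) :=
      (Filter.tendsto_pow_atTop (by norm_num)).inv_tendsto_atTop
    exact (((t1.const_mul _).add (t2.const_mul _)).add ((pow_exp_tendsto (by norm_num)).const_mul _)).add
      ((pow_exp_tendsto (by positivity)).const_mul _)
  have h2 := h1.eventually_lt_const (u := (1 / 2 : ℝ)) (by norm_num)
  obtain ⟨R, hR⟩ := Filter.eventually_atTop.1 h2
  refine ⟨max R 1, le_max_right _ _, fun r hr => ?_⟩
  have hr1 : 1 ≤ r := (le_max_right _ _).trans hr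
  have h3 := hR r ((le_max_left _ _).trans hr)
  have h4 : 1 / (2 * r) = (1 / 2) * (1 / r) := by field_simp
  rw [h4]
  have h5 := mul_lt_mul_of_pos_right h3 (by positivity : 0 < 1 / r)
  refine lt_of_le_of_lt (le_of_eq ?_) h5
  field_simp

set_option maxHeartbeats 1000000 in
lemma no_sign {κ N : ℕ} (hκ : 1 ≤ κ) (hN : 1 ≤ N) {M : ℝ} (hM : 0 < M) {F g gS : ℂ → ℂ} {b bS : ℕ → ℂ}
    {β : ℕ → ℝ} (hF : Good κ 1 M F (fun n => (β n : ℂ))) (hS : Good κ N M gS bS) (hg : Good κ N M g b)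
    (hrelS : ∀ ζ : ℂ, 0 < ζ.im → F ζ = (ζ ^ (2 * κ))⁻¹ * gS (-1 / ζ))
    {α δ : ℝ} {c : ℕ} (hc : 1 ≤ c) (hcN : c ≤ N)
    (hrel : ∀ ζ : ℂ, 0 < ζ.im → F (α + ζ) =
      (((c : ℝ) * ζ) ^ (2 * κ))⁻¹ * g (-δ - 1 / ((c : ℝ) ^ 2 * ζ)))
    (w0 : ℂ) (hw : 3 ≤ 4 * w0.im ^ 2) (hw' : 0 < w0.im) (hb : M / 2 ≤ ‖g w0‖ * w0.im ^ κ)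
    {ε r x : ℝ} (hε : 0 < ε) (hε' : ε ≤ 1 / 14) (hr : 1 ≤ r) (hx : x = r ^ 42)
    (hQ : 2 * (κ : ℝ) * (N : ℝ) ^ 2 ≤ r)
    (hnum : 528 / r ^ 12 + 20 / r ^ 34 + 38 * (Real.exp (-(Real.pi / 8) * r ^ (4 : ℝ)) * r ^ 84)
      + 76 * (Real.exp (-(Real.pi / 8) * r ^ (84 * ε)) * r ^ 84) < 1 / (2 * r))
    (hpos : ∀ n : ℕ, x < n → (n : ℝ) ≤ x + x ^ (13 / 14 + ε : ℝ) → 0 ≤ β n) : False := by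
  have hκ' : (1 : ℝ) ≤ κ := by exact_mod_cast hκ
  have hN' : (1 : ℝ) ≤ N := by exact_mod_cast hN
  have hc' : (1 : ℝ) ≤ c := by exact_mod_cast hc
  have hcN' : (c : ℝ) ≤ N := by exact_mod_cast hcN
  have hr0 : 0 < r := by linarith
  obtain ⟨m, v, hm, hv, hbig, hY⟩ := exists_big_coeff hκ hN hM hg w0 hw hw' hb
  have hm' : (1 : ℝ) ≤ m := by exact_mod_cast hm
  have hv0 : 0 < v := by linarith
  set z := r ^ (42 * ε) with hz
  have hz1 : 1 ≤ z := Real.one_le_rpow hr (by positivity)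
  have hz3 : z ≤ r ^ 3 := by
    rw [hz, ← Real.rpow_natCast]
    apply Real.rpow_le_rpow_of_exponent_le hr; push_cast; linarith
  have hh : x ^ (13 / 14 + ε : ℝ) = r ^ 39 * z := by
    rw [hx, ← Real.rpow_natCast, ← Real.rpow_mul hr0.le, hz, ← Real.rpow_natCast, ← Real.rpow_add hr0]
    congr 1; push_cast; ring
  set H := r ^ 39 with hH
  have hH0 : 0 < H := by positivity
  have hx0 : 0 < x := by rw [hx]; positivity
  have hHz : H * z ≤ x := by
    rw [hx, hH, show r ^ 42 = r ^ 39 * r ^ 3 by ring]; gcongr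
  have hHz0 : 0 < H * z := by positivity
  set μ := x + H * z / 2 with hμ
  have hμ1 : x ≤ μ := by linarith
  have hμ2 : μ ≤ 2 * x := by linarith
  have hμ0 : 0 < μ := by linarith
  set T := √(m / (N * μ)) / c with hT
  have hT0 : 0 < T := by positivity
  have hcT : (c : ℝ) ^ 2 * T ^ 2 = m / (N * μ) := by
    rw [hT, div_pow, Real.sq_sqrt (by positivity)]; field_simp
  set y := v * (c ^ 2 * T ^ 2) with hy
  have hy0 : 0 < y := by positivity
  have hyv : v = y / (c ^ 2 * T ^ 2) := by rw [hy]; field_simp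
  have hyY : y = m * v / N / μ := by rw [hy, hcT]; field_simp
  set lam := μ / m with hlam
  have hlam' : 1 / ((c : ℝ) ^ 2 * T ^ 2) / N = lam := by rw [hcT, hlam]; field_simp
  have hmu : m * lam = μ := by rw [hlam]; field_simp
  have hNN : (N : ℝ) ≤ N ^ 2 := by
    have := mul_le_mul_of_nonneg_left hN' (by linarith : (0 : ℝ) ≤ N)
    linarith
  have hκN0 : (κ : ℝ) + N ≤ κ * N + 1 := by
    have := mul_nonneg (sub_nonneg.2 hκ') (sub_nonneg.2 hN')
    linarith
  have hκN1 : (1 : ℝ) ≤ κ * N := one_le_mul_of_one_le_of_one_le hκ' hN'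
  have hκκ : (κ : ℝ) ≤ κ * N := le_mul_of_one_le_right (by linarith) hN'
  have hNκ : (N : ℝ) ≤ κ * N := le_mul_of_one_le_left (by linarith) hκ'
  have hκN : (κ : ℝ) + N ≤ 2 * κ * N := by linarith
  have hκN2 : 2 * (κ : ℝ) * N ≤ 2 * κ * N ^ 2 := by gcongr
  have hκNr : 2 * (κ * N : ℝ) ≤ r := by linarith
  have hN2r : 2 * (N : ℝ) ^ 2 ≤ r := by
    have := le_mul_of_one_le_left (by positivity : 0 ≤ (N : ℝ) ^ 2) hκ'
    linarith
  have hmr : (m : ℝ) ≤ 2 * r := by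
    have h1 : (m : ℝ) * v ≤ (κ + N) * N := by rwa [div_le_iff₀ (by linarith)] at hY
    have h2 : ((κ : ℝ) + N) * N ≤ (2 * κ * N) * N := by gcongr
    have h3 : (m : ℝ) * (1 / 2) ≤ m * v := by gcongr
    have h4 : (2 * κ * N : ℝ) * N = 2 * κ * N ^ 2 := by ring
    linarith
  have hlamr : r ^ 41 / 2 ≤ lam := by
    rw [hlam, div_le_div_iff₀ (by norm_num) (by linarith)]
    calc r ^ 41 * m ≤ r ^ 41 * (2 * r) := by gcongr
      _ = x * 2 := by rw [hx]; ring
      _ ≤ μ * 2 := by gcongr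
  have hr_pow : ∀ n : ℕ, 1 ≤ r ^ n := fun n => one_le_pow₀ hr
  have hr2 : 2 ≤ r := by linarith
  have hlam1 : 1 ≤ lam := by
    have : (2 : ℝ) ≤ r ^ 41 := by
      calc (2 : ℝ) ≤ r := hr2
        _ = r ^ 1 := by ring
        _ ≤ r ^ 41 := pow_le_pow_right₀ hr (by norm_num)
    linarith
  have main := combine (D := H * z / 2) (lam := lam) (μ := μ) (α := α) (δ := δ) hκ hN hM hF hS hg hrelS hH0 (by linarith : (0 : ℝ) < c) hT0 hy0 hyv hrel
    hlam1 hlam' hmu hbig (by positivity) (by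
      intro n hn
      have := abs_lt.1 hn
      refine hpos n (by linarith [this.1]) ?_
      rw [hh]; linarith [this.2])
  -- numeric estimates
  have hTi : 1 / T ≤ 2 * r ^ 22 := by
    refine (sq_le_sq₀ (by positivity) (by positivity)).1 ?_
    have e : (1 / T) ^ 2 = c ^ 2 * (N * μ) / m := by
      have : T ^ 2 = m / (N * μ) / c ^ 2 := by rw [← hcT]; field_simp
      rw [div_pow, this]; field_simp
    rw [e]
    have hN2 : (N : ℝ) ^ 2 ≤ r := by linarith [sq_nonneg (N : ℝ)]
    have hN4 : (N : ℝ) ^ 3 ≤ r ^ 2 := by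
      calc (N : ℝ) ^ 3 ≤ (N : ℝ) ^ 4 := pow_le_pow_right₀ hN' (by norm_num)
        _ = ((N : ℝ) ^ 2) ^ 2 := by ring
        _ ≤ r ^ 2 := by gcongr
    calc (c : ℝ) ^ 2 * (N * μ) / m ≤ c ^ 2 * (N * μ) / 1 := by gcongr
      _ ≤ N ^ 2 * (N * (2 * x)) / 1 := by gcongr
      _ = N ^ 3 * (2 * r ^ 42) := by rw [hx]; ring
      _ ≤ r ^ 2 * (2 * r ^ 42) := by gcongr
      _ = 2 * r ^ 44 := by ring
      _ ≤ 4 * r ^ 44 := by linarith [hr_pow 44]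
      _ = (2 * r ^ 22) ^ 2 := by ring
  have hyu : y ≤ 1 / r ^ 41 := by
    rw [hyY]
    calc m * v / N / μ ≤ (κ + N) / x := by gcongr
      _ ≤ r / x := by gcongr; linarith
      _ = 1 / r ^ 41 := by rw [hx]; field_simp
  have hyi : 1 / y ≤ 4 * r ^ 43 := by
    have hNr : (N : ℝ) ≤ r := by linarith
    rw [hyY, one_div_div, div_div_eq_mul_div, div_le_iff₀ (by positivity)]
    have : (1 : ℝ) / 2 ≤ m * v := by
      have : (1 : ℝ) * (1 / 2) ≤ m * v := by gcongr
      linarith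
    calc μ * N ≤ (2 * x) * r := by gcongr
      _ = 4 * r ^ 43 * (1 / 2) := by rw [hx]; ring
      _ ≤ _ := by gcongr
  have hK : 2 * (κ : ℝ) + 1 ≤ 2 * r := by linarith
  have hK2 : (2 * (κ : ℝ) + 2) * N ≤ 2 * r := by linarith
  have hNK : (N : ℝ) * (2 * κ + 1) ≤ 2 * r := by linarith
  have s0 : 1 / (2 * r) ≤ 1 / ((N : ℝ) * (2 * κ + 1)) := by gcongr
  have s1 : 2 * ((2 * (κ : ℝ) + 1) * (8 / (H * T) + 18 * y / T + 10 / (H ^ 2 * T * y))) ≤ 528 / r ^ 12 := by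
    have a1 : 8 / (H * T) ≤ 16 / r ^ 17 := by
      calc 8 / (H * T) = 8 / H * (1 / T) := by field_simp
        _ ≤ 8 / H * (2 * r ^ 22) := by gcongr
        _ = 16 / r ^ 17 := by rw [hH]; field_simp; norm_num
    have a2 : 18 * y / T ≤ 36 / r ^ 19 := by
      calc 18 * y / T = 18 * y * (1 / T) := by field_simp
        _ ≤ 18 * (1 / r ^ 41) * (2 * r ^ 22) := by gcongr
        _ = 36 / r ^ 19 := by field_simp; norm_num
    have a3 : 10 / (H ^ 2 * T * y) ≤ 80 / r ^ 13 := by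
      calc 10 / (H ^ 2 * T * y) = 10 / H ^ 2 * (1 / T) * (1 / y) := by field_simp
        _ ≤ 10 / H ^ 2 * (2 * r ^ 22) * (4 * r ^ 43) := by gcongr
        _ = 80 / r ^ 13 := by rw [hH]; field_simp; norm_num
    have a4 : 16 / r ^ 17 ≤ 16 / r ^ 13 := by gcongr <;> first | exact hr | norm_num
    have a5 : 36 / r ^ 19 ≤ 36 / r ^ 13 := by gcongr <;> first | exact hr | norm_num
    calc _ ≤ 2 * ((2 * r) * (16 / r ^ 13 + 36 / r ^ 13 + 80 / r ^ 13)) := by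
          have : 8 / (H * T) + 18 * y / T + 10 / (H ^ 2 * T * y) ≤ 16 / r ^ 13 + 36 / r ^ 13 + 80 / r ^ 13 := by
            linarith
          gcongr
      _ = 528 / r ^ 12 := by field_simp; norm_num
  have s2 : 2 * ((2 * (κ : ℝ) + 2) * N * (1 / (H ^ 2 * y) + y)) ≤ 20 / r ^ 34 := by
    have a1 : 1 / (H ^ 2 * y) ≤ 4 / r ^ 35 := by
      calc 1 / (H ^ 2 * y) = 1 / H ^ 2 * (1 / y) := by field_simp
        _ ≤ 1 / H ^ 2 * (4 * r ^ 43) := by gcongr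
        _ = 4 / r ^ 35 := by rw [hH]; field_simp
    have a2 : y ≤ 1 / r ^ 35 := hyu.trans (by gcongr <;> first | exact hr | norm_num)
    calc _ ≤ 2 * ((2 * r) * (4 / r ^ 35 + 1 / r ^ 35)) := by gcongr
      _ = 20 / r ^ 34 := by field_simp; norm_num
  have hpoly : 4 * μ ^ 2 + 3 * H ^ 2 ≤ 19 * r ^ 84 := by
    have a1 : μ ^ 2 ≤ 4 * r ^ 84 := by
      calc μ ^ 2 ≤ (2 * x) ^ 2 := by gcongr
        _ = _ := by rw [hx]; ring
    have a2 : H ^ 2 ≤ r ^ 84 := by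
      rw [hH, ← pow_mul]; exact pow_le_pow_right₀ hr (by norm_num)
    linarith
  have s3 : 2 * (Real.exp (-Real.pi * lam ^ 2 / (2 * H ^ 2)) * (4 * μ ^ 2 + 3 * H ^ 2)) ≤
      38 * (Real.exp (-(Real.pi / 8) * r ^ (4 : ℝ)) * r ^ 84) := by
    have a1 : -Real.pi * lam ^ 2 / (2 * H ^ 2) ≤ -(Real.pi / 8) * r ^ (4 : ℝ) := by
      rw [div_le_iff₀ (by positivity)]
      have e4 : r ^ (4 : ℝ) = r ^ (4 : ℕ) := by rw [← Real.rpow_natCast]; norm_num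
      rw [e4]
      have : (r ^ 41 / 2) ^ 2 ≤ lam ^ 2 := by gcongr
      have e5 : -(Real.pi / 8) * r ^ 4 * (2 * H ^ 2) = -Real.pi * (r ^ 41 / 2) ^ 2 := by rw [hH]; ring
      rw [e5]
      have := mul_le_mul_of_nonneg_left this Real.pi_pos.le
      linarith
    calc _ ≤ 2 * (Real.exp (-(Real.pi / 8) * r ^ (4 : ℝ)) * (19 * r ^ 84)) := by gcongr
      _ = _ := by ring
  have s4 : 4 * (Real.exp (-Real.pi * (H * z / 2) ^ 2 / (2 * H ^ 2)) * (4 * μ ^ 2 + 3 * H ^ 2)) ≤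
      76 * (Real.exp (-(Real.pi / 8) * r ^ (84 * ε)) * r ^ 84) := by
    have a1 : -Real.pi * (H * z / 2) ^ 2 / (2 * H ^ 2) = -(Real.pi / 8) * r ^ (84 * ε) := by
      have : r ^ (84 * ε) = z ^ 2 := by
        rw [hz, ← Real.rpow_natCast, ← Real.rpow_mul hr0.le]; congr 1; push_cast; ring
      rw [this]; field_simp; ring
    rw [a1]
    calc _ ≤ 4 * (Real.exp (-(Real.pi / 8) * r ^ (84 * ε)) * (19 * r ^ 84)) := by gcongr
      _ = _ := by ring
  linarith

open UpperHalfPlane in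
lemma isBdd_of {κ : ℕ} {M : ℝ} {G : ℍ → ℂ} (hb : ∀ τ : ℍ, ‖G τ‖ * τ.im ^ κ ≤ M) :
    IsBoundedAtImInfty G := by
  rw [isBoundedAtImInfty_iff]
  refine ⟨M, 1, fun z hz => le_trans ?_ (hb z)⟩
  exact le_mul_of_one_le_right (norm_nonneg _) (one_le_pow₀ hz)

open UpperHalfPlane Manifold in
lemma coeff_bd {κ h : ℕ} (hh : 1 ≤ h) {M : ℝ} {G : ℍ → ℂ}
    (hd : MDiff G) (hp : Function.Periodic (G ∘ ofComplex) (h : ℝ))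
    (hb : ∀ τ : ℍ, ‖G τ‖ * τ.im ^ κ ≤ M) (m : ℕ) (v : ℝ) (hv : 0 < v) :
    ‖(qExpansion h G).coeff m‖ * Real.exp (-(2 * Real.pi * m * v / h)) * v ^ κ ≤ M := by
  have hh0 : (0 : ℝ) < h := by exact_mod_cast hh
  rw [qExpansion_coeff_eq_intervalIntegral hh0 hp hd (isBdd_of hb) m hv]
  have key : ∀ u ∈ Set.uIoc (0 : ℝ) h,
      ‖1 / Function.Periodic.qParam h (u + v * Complex.I) ^ m * G ⟨u + v * Complex.I, by simpa using hv⟩‖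
        ≤ Real.exp (2 * Real.pi * m * v / h) * (M / v ^ κ) := by
    intro u _
    rw [norm_mul, norm_div, norm_one, norm_pow, Function.Periodic.norm_qParam, ← Real.exp_nat_mul,
      one_div, ← Real.exp_neg]
    have h1 := hb ⟨u + v * Complex.I, by simpa using hv⟩
    have h2 : (⟨u + v * Complex.I, by simpa using hv⟩ : ℍ).im = v := by
      simp [← UpperHalfPlane.coe_im]
    rw [h2] at h1
    refine mul_le_mul (le_of_eq ?_) ?_ (norm_nonneg _) (Real.exp_pos _).le
    · congr 1
      simp
      ring
    · rw [le_div_iff₀ (by positivity)]; exact h1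
  have h3 := intervalIntegral.norm_integral_le_of_norm_le_const key
  rw [sub_zero, abs_of_pos hh0] at h3
  rw [norm_mul, norm_div, norm_one]
  have h4 : ‖((h : ℝ) : ℂ)‖ = h := by simp
  rw [h4]
  calc _ ≤ 1 / (h : ℝ) * (Real.exp (2 * Real.pi * m * v / h) * (M / v ^ κ) * h) *
        Real.exp (-(2 * Real.pi * m * v / h)) * v ^ κ := by gcongr; exact h3
    _ = (Real.exp (2 * Real.pi * m * v / h) * Real.exp (-(2 * Real.pi * m * v / h))) * M := by
        field_simp
    _ = M := by rw [← Real.exp_add]; simp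

open UpperHalfPlane Manifold in
lemma good_of {κ h : ℕ} (hκ : 1 ≤ κ) (hh : 1 ≤ h) {M : ℝ} {G : ℍ → ℂ}
    (hd : MDiff G) (hp : Function.Periodic (G ∘ ofComplex) (h : ℝ))
    (hb : ∀ τ : ℍ, ‖G τ‖ * τ.im ^ κ ≤ M) :
    Good κ h M (G ∘ ofComplex) (fun m => (qExpansion h G).coeff m) where
  diff := UpperHalfPlane.mdifferentiable_iff.mp hd
  bound := fun w hw => by
    have := hb ⟨w, hw⟩
    simpa [ofComplex_apply_of_im_pos hw] using! this
  sum := fun w hw => by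
    have hh0 : (0 : ℝ) < h := by exact_mod_cast hh
    have := hasSum_qExpansion hh0 hp hd (isBdd_of hb) ⟨w, hw⟩
    simp only [Function.comp, ofComplex_apply_of_im_pos hw]
    convert this using 2 with m
    rw [smul_eq_mul, Function.Periodic.qParam, ← Complex.exp_nat_mul]
    congr 2
    simp
    ring
  coeff := coeff_bd hh hd hp hb
  zero := by
    by_contra hne
    have h0 : 0 < ‖(qExpansion h G).coeff 0‖ := norm_pos_iff.mpr hne
    set A := ‖(qExpansion h G).coeff 0‖
    have hM : 0 ≤ M := le_trans (by have := UpperHalfPlane.im_pos .I; positivity) (hb .I)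
    have h1 := coeff_bd hh hd hp hb 0 (M / A + 1) (by positivity)
    have h2 : (M / A + 1) ≤ (M / A + 1) ^ κ := le_self_pow₀ (by simp; positivity) (by omega)
    have h3 : A * (M / A + 1) = M + A := by field_simp
    rw [show -(2 * Real.pi * ((0 : ℕ) : ℝ) * (M / A + 1) / h) = 0 by simp, Real.exp_zero, mul_one] at h1
    have : A * (M / A + 1) ≤ A * (M / A + 1) ^ κ := by gcongr
    change A * (M / A + 1) ^ κ ≤ M at h1
    linarith
section ModPart
open UpperHalfPlane ModularForm MatrixGroups Manifold
lemma slash_bd {κ : ℕ} (f : ℍ → ℂ) (γ : SL(2, ℤ)) (τ : ℍ) :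
    ‖(f ∣[((2 * κ : ℕ) : ℤ)] γ) τ‖ * τ.im ^ κ = ‖f (γ • τ)‖ * (γ • τ).im ^ κ := by
  rw [ModularForm.SL_slash_apply, ModularGroup.im_smul_eq_div_normSq, norm_mul, div_pow,
    Complex.normSq_eq_norm_sq, zpow_neg, norm_inv, zpow_natCast, norm_pow, ← pow_mul]
  ring

lemma slash_inv {N : ℕ} {k : ℤ} (f : CuspForm (CongruenceSubgroup.Gamma0 N) k) {A : SL(2, ℤ)}
    (hA : A ∈ CongruenceSubgroup.Gamma0 N) (γ : SL(2, ℤ)) :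
    (f : ℍ → ℂ) ∣[k] (A * γ) = (f : ℍ → ℂ) ∣[k] γ := by
  rw [SlashAction.slash_mul]
  congr 1
  exact SlashInvariantFormClass.slash_action_eq f _ (Subgroup.mem_map_of_mem _ hA)

lemma slash_md {N : ℕ} {k : ℤ} (f : CuspForm (CongruenceSubgroup.Gamma0 N) k) (γ : SL(2, ℤ)) :
    MDiff ((f : ℍ → ℂ) ∣[k] γ) := 
  (ModularFormClass.holo f).slash k _

lemma slash_per {N : ℕ} {k : ℤ} (f : CuspForm (CongruenceSubgroup.Gamma0 N) k) (γ : SL(2, ℤ))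
    (h : ℕ) (hh : γ * ModularGroup.T ^ (h : ℤ) * γ⁻¹ ∈ CongruenceSubgroup.Gamma0 N) :
    Function.Periodic (((f : ℍ → ℂ) ∣[k] γ) ∘ ofComplex) (h : ℝ) := by
  have key : ((f : ℍ → ℂ) ∣[k] γ) ∣[k] (ModularGroup.T ^ (h : ℤ)) = (f : ℍ → ℂ) ∣[k] γ := by
    rw [← SlashAction.slash_mul, ← slash_inv f hh γ]
    simp
  intro w
  by_cases hw : 0 < w.im
  · have hw' : 0 < (w + (h : ℝ)).im := by simpa using hw
    simp only [Function.comp, ofComplex_apply_of_im_pos hw, ofComplex_apply_of_im_pos hw']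
    have h1 := congrFun key ⟨w, hw⟩
    rw [ModularForm.SL_slash_apply] at h1
    rw [← h1]
    have h2 : denom (ModularGroup.T ^ (h : ℤ) : SL(2, ℤ)) (⟨w, hw⟩ : ℍ) = 1 := by
      rw [ModularGroup.denom_apply, ModularGroup.coe_T_zpow]
      simp
    rw [h2]
    simp only [one_zpow, mul_one]
    have h3 : (⟨w + (h : ℝ), hw'⟩ : ℍ) = ModularGroup.T ^ (h : ℤ) • (⟨w, hw⟩ : ℍ) := by
      ext
      rw [ModularGroup.coe_T_zpow_smul_eq]
      simp
    rw [h3]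
  · have hw' : (w + (h : ℝ)).im ≤ 0 := by simpa using hw
    simp only [Function.comp, ofComplex_apply_of_im_nonpos (not_lt.mp hw), ofComplex_apply_of_im_nonpos hw']

lemma per_N (N : ℕ) (γ : SL(2, ℤ)) :
    γ * ModularGroup.T ^ (N : ℤ) * γ⁻¹ ∈ CongruenceSubgroup.Gamma0 N := by
  rw [CongruenceSubgroup.Gamma0_mem, Matrix.SpecialLinearGroup.coe_mul, Matrix.SpecialLinearGroup.coe_mul, ModularGroup.coe_T_zpow, Matrix.SpecialLinearGroup.coe_inv]
  rw [Matrix.adjugate_fin_two]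
  simp [Matrix.mul_apply, Fin.sum_univ_two]
  ring

lemma per_1 (N : ℕ) :
    1 * ModularGroup.T ^ ((1 : ℕ) : ℤ) * 1⁻¹ ∈ CongruenceSubgroup.Gamma0 N := by
  rw [CongruenceSubgroup.Gamma0_mem]
  rw [one_mul, inv_one, mul_one, ModularGroup.coe_T_zpow]
  simp

lemma slash_rel {κ : ℕ} (f : ℍ → ℂ) (γ : SL(2, ℤ)) (c : ℕ) (hc : 1 ≤ c) (hγ : γ 1 0 = c) (ζ : ℂ)
    (hζ : 0 < ζ.im) :
    (f ∘ ofComplex) ((((γ 0 0 : ℤ) : ℝ) / c : ℝ) + ζ) =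
      ((((c : ℝ) : ℂ) * ζ) ^ (2 * κ))⁻¹ * ((f ∣[((2 * κ : ℕ) : ℤ)] γ) ∘ ofComplex)
        (-((((γ 1 1 : ℤ) : ℝ) / c : ℝ) : ℂ) - 1 / (((c : ℝ) : ℂ) ^ 2 * ζ)) := by
  have hc0 : (c : ℂ) ≠ 0 := by exact_mod_cast (by omega : c ≠ 0)
  have hζ0 : ζ ≠ 0 := by rintro rfl; simp at hζ
  have hw : 0 < (-((((γ 1 1 : ℤ) : ℝ) / c : ℝ) : ℂ) - 1 / (((c : ℝ) : ℂ) ^ 2 * ζ)).im := by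
    have h1 : (-((((γ 1 1 : ℤ) : ℝ) / c : ℝ) : ℂ) - 1 / (((c : ℝ) : ℂ) ^ 2 * ζ))
      = ((-(((γ 1 1 : ℤ) : ℝ) / c) : ℝ) : ℂ) - (((1 / (c : ℝ) ^ 2 : ℝ)) : ℂ) * ζ⁻¹ := by
      push_cast
      field_simp
    rw [h1, Complex.sub_im, Complex.ofReal_im, Complex.im_ofReal_mul, Complex.inv_im]
    have : 0 < Complex.normSq ζ := Complex.normSq_pos.mpr hζ0
    have hc' : (0 : ℝ) < c := by exact_mod_cast hc
    have : 0 < 1 / (c : ℝ) ^ 2 * (ζ.im / Complex.normSq ζ) := by positivity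
    rw [neg_div]
    linarith
  have hz : 0 < ((((((γ 0 0 : ℤ) : ℝ) / c : ℝ)) : ℂ) + ζ).im := by
    rw [Complex.add_im, Complex.ofReal_im]; linarith
  simp only [Function.comp]
  rw [ofComplex_apply_of_im_pos hw, ofComplex_apply_of_im_pos hz, ModularForm.SL_slash_apply]
  have hdet := γ.det_coe
  rw [Matrix.det_fin_two, hγ] at hdet
  have hdet' : ((γ 0 0 : ℤ) : ℂ) * ((γ 1 1 : ℤ) : ℂ) - ((γ 0 1 : ℤ) : ℂ) * (c : ℂ) = 1 := by
    exact_mod_cast hdet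
  set w : ℂ := (-((((γ 1 1 : ℤ) : ℝ) / c : ℝ) : ℂ) - 1 / (((c : ℝ) : ℂ) ^ 2 * ζ)) with hwd
  have hden : denom γ (⟨w, hw⟩ : ℍ) = - 1 / ((c : ℂ) * ζ) := by
    rw [ModularGroup.denom_apply, hγ]
    simp only [hwd]
    push_cast
    field_simp
    ring
  have hden2 : (c : ℂ) * w + ((γ 1 1 : ℤ) : ℂ) = - 1 / ((c : ℂ) * ζ) := by
    rw [← hden, ModularGroup.denom_apply, hγ]
    simp
  have hsm : γ • (⟨w, hw⟩ : ℍ) = ⟨((((γ 0 0 : ℤ) : ℝ) / c : ℝ) : ℂ) + ζ, hz⟩ := by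
    ext
    rw [UpperHalfPlane.coe_specialLinearGroup_apply]
    simp only [hγ]
    have h5 : (((algebraMap ℤ ℝ) ((c : ℕ) : ℤ) : ℝ) : ℂ) * w + ((algebraMap ℤ ℝ (γ 1 1) : ℝ) : ℂ) =  - 1 / ((c : ℂ) * ζ) := by
      rw [← hden2]; simp
    simp only [h5]
    simp only [hwd]
    push_cast
    simp only [algebraMap_int_eq, eq_intCast]
    push_cast
    field_simp
    linear_combination ((c : ℂ) * ζ) * hdet'
  rw [hsm, hden, zpow_neg, zpow_natCast, neg_div, Even.neg_pow (even_two_mul κ), div_pow, one_pow]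
  have : ((c : ℂ) * ζ) ^ (2 * κ) ≠ 0 := pow_ne_zero _ (mul_ne_zero hc0 hζ0)
  push_cast
  field_simp

lemma exists_row {N : ℕ} (hN : 1 ≤ N) (hs : Squarefree N) (c d : ℤ) (hcd : IsCoprime c d) :
    ∃ (c' : ℕ) (d' : ℤ), 1 ≤ c' ∧ c' ≤ N ∧ IsCoprime (c' : ℤ) d' ∧ (N : ℤ) ∣ c' * d - c * d' := by
  have hg0 : 0 < Int.gcd c N := Int.gcd_pos_of_ne_zero_right _ (by omega)
  obtain ⟨N1, hN1⟩ : Int.gcd c N ∣ N := by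
    have := Int.gcd_dvd_right c N
    exact_mod_cast this
  obtain ⟨c1, hc1⟩ : ((Int.gcd c N : ℕ) : ℤ) ∣ c := Int.gcd_dvd_left c N
  set g := Int.gcd c N with hg
  have hN10 : 0 < N1 := by
    rcases Nat.eq_zero_or_pos N1 with h | h
    · subst h; omega
    · exact h
  have hcop : Nat.Coprime g N1 := by
    rw [hN1] at hs
    exact Nat.coprime_of_squarefree_mul hs
  have hgN : IsCoprime (g : ℤ) (N1 : ℤ) := Nat.isCoprime_iff_coprime.mpr hcop
  have hc1N : IsCoprime c1 (N1 : ℤ) := by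
    rw [Int.isCoprime_iff_gcd_eq_one]
    have h1 : g = g * Int.gcd c1 N1 := by
      conv_lhs => rw [hg, hc1, hN1]
      push_cast
      rw [Int.gcd_mul_left]
      simp
    have : g * 1 = g * Int.gcd c1 N1 := by omega
    exact (Nat.eq_of_mul_eq_mul_left hg0 this).symm
  obtain ⟨u, v, huv⟩ := hc1N
  obtain ⟨p, q, hpq⟩ := hgN
  -- d' = 1 mod g, d' = d u mod N1
  refine ⟨g, q * N1 + d * u * (p * g), hg0, Nat.le_of_dvd hN ⟨N1, hN1⟩, ?_, ?_⟩
  · refine ⟨p - d * u * p, 1, ?_⟩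
    linear_combination hpq
  · have : (N : ℤ) = g * N1 := by exact_mod_cast hN1
    rw [this, hc1]
    refine ⟨d * v - c1 * q + c1 * d * u * q, ?_⟩
    linear_combination (g * d) * (- huv) - g * c1 * d * u * hpq

lemma exists_rep {N : ℕ} (hN : 1 ≤ N) (hs : Squarefree N) (γ : SL(2, ℤ)) :
    ∃ (c : ℕ) (γ' A : SL(2, ℤ)), 1 ≤ c ∧ c ≤ N ∧ γ' 1 0 = c ∧
      A ∈ CongruenceSubgroup.Gamma0 N ∧ γ' = A * γ := by
  have hcd : IsCoprime (γ 1 0) (γ 1 1) := ModularGroup.bottom_row_coprime γ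
  obtain ⟨c, d, h1, h2, h3, h4⟩ := exists_row hN hs _ _ hcd
  obtain ⟨γ', h5, h6⟩ := h3.exists_SL2_row 1
  refine ⟨c, γ', γ' * γ⁻¹, h1, h2, h5, ?_, by simp⟩
  rw [CongruenceSubgroup.Gamma0_mem, Matrix.SpecialLinearGroup.coe_mul,
    Matrix.SpecialLinearGroup.coe_inv, Matrix.adjugate_fin_two]
  rw [← ZMod.intCast_zmod_eq_zero_iff_dvd] at h4 
  rw [← h4]
  simp [Matrix.mul_apply, Fin.sum_univ_two, h5, h6]
  ring

end ModPart

lemma pow_unique {e : ℕ → ℂ} {ρ : ℝ} (hρ : 0 < ρ)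
    (h : ∀ q : ℂ, ‖q‖ < ρ → HasSum (fun n => e n * q ^ n) 0) (n : ℕ) : e n = 0 := by
  have H : HasFPowerSeriesOnBall (0 : ℂ → ℂ) (FormalMultilinearSeries.ofScalars ℂ e) 0
      (ENNReal.ofReal ρ) := by
    constructor
    · refine le_of_forall_lt_imp_le_of_dense fun r hr ↦ ?_
      lift r to NNReal using hr.ne_top
      apply FormalMultilinearSeries.le_radius_of_summable
      have hr' : (r : ℝ) < ρ := by
        rw [← ENNReal.ofReal_coe_nnreal] at hr
        exact (ENNReal.ofReal_lt_ofReal_iff hρ).mp hr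
      simpa [smul_eq_mul, norm_mul, mul_comm, mul_left_comm, mul_assoc] using
        (h (r : ℂ) (by simpa using hr')).summable.norm
    · simpa using hρ
    · intro y hy
      have hy' : ‖y‖ < ρ := by
        rw [Metric.eball_ofReal, mem_ball_zero_iff] at hy
        exact hy
      simpa [mul_comm] using h y hy'
  have h1 := H.hasFPowerSeriesAt.eq_zero
  have h2 : (FormalMultilinearSeries.ofScalars ℂ e : FormalMultilinearSeries ℂ ℂ ℂ).coeff n = 0 := by
    rw [h1]; rfl
  simpa [FormalMultilinearSeries.coeff_ofScalars] using h2

open UpperHalfPlane Manifold in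
lemma beta_eq {κ : ℕ} {M : ℝ} {G : ℍ → ℂ} {b : ℕ → ℂ} (hG : Good κ 1 M (G ∘ ofComplex) b)
    (hne : ∃ z, G z ≠ 0) {β : ℕ → ℝ}
    (hβ : ∀ z : ℍ, G z = ∑' n : ℕ, (β (n + 1) : ℂ) *
      Complex.exp (2 * Real.pi * Complex.I * ((n : ℂ) + 1) * (z : ℂ))) :
    b = fun n => (((if n = 0 then 0 else β n : ℝ)) : ℂ) := by
  obtain ⟨z1, hz1⟩ := hne
  have hs : Summable (fun n : ℕ => (β (n + 1) : ℂ) *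
      Complex.exp (2 * Real.pi * Complex.I * ((n : ℂ) + 1) * (z1 : ℂ))) := by
    by_contra h
    exact hz1 (by rw [hβ, tsum_eq_zero_of_not_summable h])
  have hexp : ∀ (n : ℕ) (w : ℂ), Complex.exp (2 * Real.pi * Complex.I * ((n : ℂ) + 1) * w) =
      Function.Periodic.qParam 1 w ^ (n + 1) := by
    intro n w
    rw [Function.Periodic.qParam, ← Complex.exp_nat_mul]
    congr 1
    push_cast
    ring
  have hexp' : ∀ (n : ℕ) (w : ℂ), Complex.exp (2 * Real.pi * Complex.I * (n : ℂ) * w / ((1 : ℕ) : ℂ)) =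
      Function.Periodic.qParam 1 w ^ n := by
    intro n w
    rw [Function.Periodic.qParam, ← Complex.exp_nat_mul]
    congr 1
    push_cast
    ring
  set q1 := Function.Periodic.qParam 1 (z1 : ℂ) with hq1
  have hq1n : ‖q1‖ < 1 := Function.Periodic.norm_qParam_lt_one one_pos z1.im_pos
  have hq10 : 0 < ‖q1‖ := norm_pos_iff.mpr (Complex.exp_ne_zero _)
  funext n
  have key := pow_unique (e := fun n => b n - (((if n = 0 then 0 else β n : ℝ)) : ℂ)) hq10 ?_ n
  · exact sub_eq_zero.mp key
  intro q hq
  rcases eq_or_ne q 0 with rfl | hq0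
  · have : (fun n => (b n - (((if n = 0 then 0 else β n : ℝ)) : ℂ)) * 0 ^ n) = fun n : ℕ => (0 : ℂ) := by
      funext n
      rcases Nat.eq_zero_or_pos n with rfl | hn
      · simp [hG.zero]
      · simp [hn.ne']
    rw [this]; exact hasSum_zero
  have him := Function.Periodic.im_invQParam_pos_of_norm_lt_one one_pos (hq.trans hq1n) hq0
  set τ : ℍ := ⟨Function.Periodic.invQParam 1 q, him⟩ with hτ
  have hqτ : Function.Periodic.qParam 1 (τ : ℂ) = q := Function.Periodic.qParam_right_inv one_ne_zero hq0
  have hS1 := hG.sum (τ : ℂ) τ.im_pos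
  simp only [Function.comp, ofComplex_apply, hexp', hqτ] at hS1
  have hs2 : Summable (fun n : ℕ => (β (n + 1) : ℂ) * q ^ (n + 1)) := by
    refine Summable.of_norm_bounded hs.norm fun n => ?_
    rw [hexp, norm_mul, norm_mul, norm_pow, norm_pow]
    gcongr
  have hS2 := hs2.hasSum
  have hval : G τ = ∑' n : ℕ, (β (n + 1) : ℂ) * q ^ (n + 1) := by
    rw [hβ]
    simp only [hexp, hqτ]
  rw [← hval] at hS2
  have hS3 : HasSum (fun n : ℕ => (((if n = 0 then 0 else β n : ℝ)) : ℂ) * q ^ n) (G τ) := by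
    rw [← hasSum_nat_add_iff' 1]
    simpa using hS2
  have := hS1.sub hS3
  rw [sub_self] at this
  have he : (fun n : ℕ => (b n - (((if n = 0 then 0 else β n : ℝ)) : ℂ)) * q ^ n) =
      fun n => b n * q ^ n - (((if n = 0 then 0 else β n : ℝ)) : ℂ) * q ^ n := by
    funext m
    ring
  rw [he]
  exact this

section Core
open UpperHalfPlane ModularForm MatrixGroups Manifold

lemma core {κ N : ℕ} (hκ : 1 ≤ κ) (hN : 1 ≤ N) (hs : Squarefree N)
    (f : CuspForm (CongruenceSubgroup.Gamma0 N) ((2 * κ : ℕ) : ℤ)) {β : ℕ → ℝ} (hf : f ≠ 0)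
    (hβ : ∀ z : ℍ, f z = ∑' n : ℕ, (β (n + 1) : ℂ) *
      Complex.exp (2 * Real.pi * Complex.I * ((n : ℂ) + 1) * (z : ℂ)))
    {ε r x : ℝ} (hε : 0 < ε) (hε' : ε ≤ 1 / 14) (hr : 1 ≤ r) (hx : x = r ^ 42)
    (hQ : 2 * (κ : ℝ) * (N : ℝ) ^ 2 ≤ r)
    (hnum : 528 / r ^ 12 + 20 / r ^ 34 + 38 * (Real.exp (-(Real.pi / 8) * r ^ (4 : ℝ)) * r ^ 84)
      + 76 * (Real.exp (-(Real.pi / 8) * r ^ (84 * ε)) * r ^ 84) < 1 / (2 * r))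
    (hpos : ∀ n : ℕ, x < n → (n : ℝ) ≤ x + x ^ (13 / 14 + ε : ℝ) → 0 ≤ β n) : False := by
  have : NeZero N := ⟨by omega⟩
  have hne : ∃ z, (f : ℍ → ℂ) z ≠ 0 := by
    by_contra! h
    exact hf (by ext z; simpa using h z)
  obtain ⟨C, hC⟩ := CuspFormClass.exists_bound f
  let φ : ℍ → ℝ := fun τ => ‖f τ‖ * τ.im ^ κ
  have hbdd : BddAbove (Set.range φ) := by
    refine ⟨C, ?_⟩
    rintro _ ⟨τ, rfl⟩
    have h1 := hC τ
    have h2 : τ.im ^ ((((2 * κ : ℕ) : ℤ) : ℝ) / 2) = τ.im ^ κ := by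
      rw [← Real.rpow_natCast]
      congr 1
      push_cast
      ring
    rw [h2, le_div_iff₀ (pow_pos τ.im_pos _)] at h1
    exact h1
  set M := ⨆ τ, φ τ with hMdef
  have hle : ∀ τ, φ τ ≤ M := fun τ => le_ciSup hbdd τ
  have hM : 0 < M := by
    obtain ⟨z, hz⟩ := hne
    exact lt_of_lt_of_le (mul_pos (norm_pos_iff.mpr hz) (pow_pos z.im_pos _)) (hle z)
  obtain ⟨z0, hz0⟩ : ∃ z0, M / 2 < φ z0 := exists_lt_of_lt_ciSup (by linarith)
  have hgood : ∀ γ : SL(2, ℤ), ∀ τ : ℍ, ‖((f : ℍ → ℂ) ∣[((2 * κ : ℕ) : ℤ)] γ) τ‖ * τ.im ^ κ ≤ M := by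
    intro γ τ
    rw [slash_bd]
    exact hle _
  have hF0 := good_of hκ le_rfl (slash_md f 1) (slash_per f 1 1 (per_1 N)) (hgood 1)
  rw [SlashAction.slash_one] at hF0
  have hb := beta_eq hF0 hne hβ
  rw [hb] at hF0
  have hS := good_of hκ hN (slash_md f ModularGroup.S) (slash_per f ModularGroup.S N (per_N N _))
    (hgood ModularGroup.S)
  obtain ⟨γ0, hγ0⟩ := ModularGroup.exists_smul_mem_fd z0
  obtain ⟨c, γ, A, hc1, hcN, hγc, hA, hγA⟩ := exists_rep hN hs γ0⁻¹
  have hg := good_of hκ hN (slash_md f γ) (slash_per f γ N (per_N N _)) (hgood γ)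
  refine no_sign hκ hN hM hF0 hS hg ?_ hc1 hcN (α := ((γ 0 0 : ℤ) : ℝ) / c)
    (δ := ((γ 1 1 : ℤ) : ℝ) / c) (fun ζ hζ => slash_rel f γ c hc1 hγc ζ hζ)
    (((γ0 • z0 : ℍ)) : ℂ) ?_ (γ0 • z0).im_pos ?_ hε hε' hr hx hQ hnum ?_
  · intro ζ hζ
    have := slash_rel (κ := κ) f ModularGroup.S 1 le_rfl (by simp [ModularGroup.S]) ζ hζ
    rw [show -1 / ζ = -ζ⁻¹ by rw [neg_div, one_div]]
    simpa [ModularGroup.S] using! this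
  · exact ModularGroup.three_le_four_mul_im_sq_of_mem_fd hγ0
  · have h1 : (((f : ℍ → ℂ) ∣[((2 * κ : ℕ) : ℤ)] γ) ∘ ofComplex) (((γ0 • z0 : ℍ)) : ℂ) =
        ((f : ℍ → ℂ) ∣[((2 * κ : ℕ) : ℤ)] γ0⁻¹) (γ0 • z0) := by
      rw [hγA, slash_inv f hA]
      simp
    rw [h1]
    have h2 := slash_bd (κ := κ) f γ0⁻¹ (γ0 • z0)
    rw [inv_smul_smul] at h2
    rw [UpperHalfPlane.coe_im, h2]
    exact hz0.le
  · intro n hn hn'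
    have hx0 : 0 < x := by rw [hx]; positivity
    have : n ≠ 0 := by
      rintro rfl
      simp at hn
      linarith
    simp only [this, if_false]
    exact hpos n hn hn'

end Core

end Helpers

open Complex UpperHalfPlane

/-- **Sign changes in short intervals for elliptic cusp forms.**
For every `ε > 0` there are constants `C > 0` (depending only on `ε`) and an absolute
`c₇ > 0` such that for every nonzero cusp form `f` of even weight `k` on `Γ₀(N)`,
`N` squarefree, with real Fourier coefficients `β(n)`, and every
`x ≥ C k^42 N^84 (log k)^80 exp(c₇ log(N+1)/log log(N+2))`, there are
`n₁, n₂ ∈ (x, x + x^{13/14+ε}]` with `β(n₁) > 0` and `β(n₂) < 0`. -/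
theorem sign_changes_short_intervals_cusp_forms :
    ∀ ε : ℝ, 0 < ε →
      ∃ C : ℝ, 0 < C ∧ ∃ c₇ : ℝ, 0 < c₇ ∧
        ∀ (k N : ℕ), 0 < k → Even k → 0 < N → Squarefree N →
          ∀ (f : CuspForm (CongruenceSubgroup.Gamma0 N) (k : ℤ)) (β : ℕ → ℝ),
            f ≠ 0 →
            (∀ z : UpperHalfPlane,
              f z = ∑' n : ℕ,
                (β (n + 1) : ℂ) *
                  Complex.exp (2 * Real.pi * Complex.I * ((n : ℂ) + 1) * (z : ℂ))) →
            ∀ x : ℝ,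
              C * (k : ℝ) ^ (42 : ℕ) * (N : ℝ) ^ (84 : ℕ) *
                  Real.log k ^ (80 : ℕ) *
                  Real.exp (c₇ * Real.log (N + 1) / Real.log (Real.log (N + 2))) ≤ x →
              ∃ n₁ n₂ : ℕ,
                (x < n₁ ∧ (n₁ : ℝ) ≤ x + x ^ (13 / 14 + ε : ℝ)) ∧
                (x < n₂ ∧ (n₂ : ℝ) ≤ x + x ^ (13 / 14 + ε : ℝ)) ∧
                0 < β n₁ ∧ β n₂ < 0 := by
  intro ε hε
  set ε' := min ε (1 / 14) with hε'
  have hε'0 : 0 < ε' := by positivity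
  obtain ⟨R0, hR0, hnum⟩ := numeric hε'0
  have hlog2 : 0 < Real.log 2 := Real.log_pos (by norm_num)
  refine ⟨R0 ^ 42 / Real.log 2 ^ 80, by positivity, 1, one_pos, ?_⟩
  intro k N hk hke hN hs f β hf hβ x hx
  obtain ⟨κ, rfl⟩ := hke.exists_two_nsmul
  rw [smul_eq_mul] at hk
  have hκ : 1 ≤ κ := by omega
  change CuspForm (CongruenceSubgroup.Gamma0 N) ((2 * κ : ℕ) : ℤ) at f
  have hκ' : (1 : ℝ) ≤ κ := by exact_mod_cast hκ
  have hN' : (1 : ℝ) ≤ N := by exact_mod_cast hN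
  rw [smul_eq_mul] at hx
  have hcast : ((2 * κ : ℕ) : ℝ) = 2 * (κ : ℝ) := by push_cast; ring
  rw [hcast] at hx
  have hexp : 1 ≤ Real.exp (1 * Real.log (N + 1) / Real.log (Real.log (N + 2))) := by
    apply Real.one_le_exp
    have h1 : 0 ≤ Real.log ((N : ℝ) + 1) := Real.log_nonneg (by linarith)
    have h2 : 1 ≤ Real.log ((N : ℝ) + 2) := by
      rw [Real.le_log_iff_exp_le (by linarith)]
      have := Real.exp_one_lt_d9
      linarith
    have h3 : 0 ≤ Real.log (Real.log ((N : ℝ) + 2)) := Real.log_nonneg h2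
    positivity
  have hlogk : Real.log 2 ^ 80 ≤ Real.log (2 * (κ : ℝ)) ^ 80 := by
    gcongr
    linarith
  have hxge : (R0 * (2 * (κ : ℝ) * (N : ℝ) ^ 2)) ^ 42 ≤ x := by
    refine le_trans ?_ hx
    calc (R0 * (2 * (κ : ℝ) * (N : ℝ) ^ 2)) ^ 42
        = R0 ^ 42 / Real.log 2 ^ 80 * (2 * (κ : ℝ)) ^ 42 * (N : ℝ) ^ 84 * Real.log 2 ^ 80 * 1 := by
          field_simp
      _ ≤ _ := by gcongr
  have hP : 1 ≤ 2 * (κ : ℝ) * (N : ℝ) ^ 2 := by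
    have : (1 : ℝ) ≤ (N : ℝ) ^ 2 := one_le_pow₀ hN'
    nlinarith
  have hB : 1 ≤ R0 * (2 * (κ : ℝ) * (N : ℝ) ^ 2) := by nlinarith
  have hx1 : 1 ≤ x := le_trans (one_le_pow₀ hB) hxge
  set r := x ^ ((42 : ℕ) : ℝ)⁻¹ with hrdef
  have hr42 : x = r ^ 42 := (Real.rpow_inv_natCast_pow (by linarith) (by norm_num)).symm
  have hrB : R0 * (2 * (κ : ℝ) * (N : ℝ) ^ 2) ≤ r := by
    have hr0 : 0 ≤ r := Real.rpow_nonneg (by linarith) _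
    rw [hr42] at hxge
    exact le_of_pow_le_pow_left₀ (by norm_num) hr0 hxge
  have hrR : R0 ≤ r := le_trans (by nlinarith) hrB
  have hrQ : 2 * (κ : ℝ) * (N : ℝ) ^ 2 ≤ r := le_trans (by nlinarith) hrB
  have hlen : x + x ^ (13 / 14 + ε' : ℝ) ≤ x + x ^ (13 / 14 + ε : ℝ) := by
    gcongr
    exact min_le_left _ _
  have hA : ∃ n₁ : ℕ, (x < n₁ ∧ (n₁ : ℝ) ≤ x + x ^ (13 / 14 + ε : ℝ)) ∧ 0 < β n₁ := by
    by_contra! hcon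
    refine core (β := fun n => - β n) hκ hN hs (-f) (neg_ne_zero.mpr hf) ?_ hε'0 (min_le_right _ _)
      (hR0.trans hrR) hr42 hrQ (hnum r hrR) ?_
    · intro z
      rw [CuspForm.neg_apply, hβ z, ← tsum_neg]
      congr 1
      funext n
      push_cast
      ring
    · intro n h1 h2
      have := hcon n ⟨h1, h2.trans hlen⟩
      linarith
  have hB : ∃ n₂ : ℕ, (x < n₂ ∧ (n₂ : ℝ) ≤ x + x ^ (13 / 14 + ε : ℝ)) ∧ β n₂ < 0 := by
    by_contra! hcon
    exact core hκ hN hs f hf hβ hε'0 (min_le_right _ _)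
      (hR0.trans hrR) hr42 hrQ (hnum r hrR) (fun n h1 h2 => hcon n ⟨h1, h2.trans hlen⟩)
  obtain ⟨n₁, h1, h1'⟩ := hA
  obtain ⟨n₂, h2, h2'⟩ := hB
  exact ⟨n₁, n₂, h1, h2, h1', h2'⟩
end

section
/- (Rademacher's strong convexity principle.) Let a < b be real numbers and let g : ℂ → ℂ be continuous on the closed strip {s : a ≤ Re(s) ≤ b}, holomorphic on the open strip {s : a < Re(s) < b}, and of finite order on that strip (i.e. there exist C₀ > 0 and ρ > 0 with |g(s)| ≤ C₀ exp(|s|^ρ) for all s in the strip). Suppose E, F > 0 and P, α, β ∈ ℝ satisfy P + a > 0 and α ≥ β, and that |g(a + it)| ≤ E|P + a + it|^α and |g(b + it)| ≤ F|P + b + it|^β for all t ∈ ℝ. Then for all σ with a < σ < b and all t ∈ ℝ, |g(σ + it)| ≤ (E|P + σ + it|^α)^{(b−σ)/(b−a)} · (F|P + σ + it|^β)^{(σ−a)/(b−a)}. -/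
lemma rad_phi_deriv (x : ℝ) : HasDerivAt (fun x : ℝ => x * Real.arctan x)
    (Real.arctan x + x / (1 + x ^ 2)) x := by
  have h := (hasDerivAt_id x).mul (Real.hasDerivAt_arctan x)
  refine h.congr_deriv ?_
  simp
  ring

lemma rad_phi_deriv2 (x : ℝ) : HasDerivAt (fun x : ℝ => Real.arctan x + x / (1 + x ^ 2))
    (2 / (1 + x ^ 2) ^ 2) x := by
  have hx : (1 + x ^ 2) ≠ 0 := by positivity
  have h1 : HasDerivAt (fun x : ℝ => 1 + x ^ 2) (2 * x) x := by
    simpa using (hasDerivAt_pow 2 x).const_add 1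
  have h := (Real.hasDerivAt_arctan x).add ((hasDerivAt_id x).div h1 hx)
  refine h.congr_deriv ?_
  simp
  field_simp
  ring

lemma rad_phi_convex : ConvexOn ℝ Set.univ (fun x : ℝ => x * Real.arctan x) := by
  have hd : deriv (fun x : ℝ => x * Real.arctan x) = fun x => Real.arctan x + x / (1 + x ^ 2) :=
    funext fun x => (rad_phi_deriv x).deriv
  refine Monotone.convexOn_univ_of_deriv (fun x => (rad_phi_deriv x).differentiableAt) ?_
  rw [hd]
  refine monotone_of_deriv_nonneg (fun x => (rad_phi_deriv2 x).differentiableAt) fun x => ?_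
  rw [(rad_phi_deriv2 x).deriv]
  positivity

lemma rad_tangent (x y : ℝ) :
    x * Real.arctan x + (Real.arctan x + x / (1 + x ^ 2)) * (y - x) ≤ y * Real.arctan y := by
  rcases lt_trichotomy x y with h | h | h
  · have := rad_phi_convex.le_slope_of_hasDerivAt (Set.mem_univ x) (Set.mem_univ y) h
      (rad_phi_deriv x)
    rw [slope_def_field, le_div_iff₀ (by linarith)] at this
    linarith
  · subst h; simp
  · have := rad_phi_convex.slope_le_of_hasDerivAt (Set.mem_univ y) (Set.mem_univ x) h
      (rad_phi_deriv x)
    rw [slope_def_field, div_le_iff₀ (by linarith)] at this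
    linarith

lemma rad_arg {w : ℂ} (hw : 0 < w.re) : w.arg = Real.arctan (w.im / w.re) := by
  have h := abs_lt.1 (Complex.abs_arg_lt_pi_div_two_iff.2 (Or.inl hw))
  rw [← Complex.tan_arg, Real.arctan_tan h.1 h.2]

/-- supporting harmonic function -/
lemma rad_support (w₀ : ℂ) (h₀ : 0 < w₀.re) : ∃ A B : ℝ,
    w₀.im * w₀.arg = A * w₀.re + B * w₀.im ∧
    ∀ w : ℂ, 0 < w.re → A * w.re + B * w.im ≤ w.im * w.arg := by
  set x := w₀.im / w₀.re with hx
  set D := Real.arctan x + x / (1 + x ^ 2) with hD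
  have hi : w₀.im = x * w₀.re := by rw [hx]; field_simp
  refine ⟨x * Real.arctan x - D * x, D, ?_, fun w hw => ?_⟩
  · rw [rad_arg h₀, ← hx, hi]; ring
  · have := rad_tangent x (w.im / w.re)
    rw [← hD, ← rad_arg hw] at this
    have h2 := mul_le_mul_of_nonneg_right this hw.le
    have e : w.im / w.re * w.re = w.im := by field_simp
    have e1 : w.im / w.re * w.arg * w.re = w.im * w.arg := by field_simp
    rw [e1] at h2
    calc _ = (x * Real.arctan x + D * (w.im / w.re - x)) * w.re := by
            linear_combination (-D) * e
      _ ≤ _ := h2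

lemma rad_PL
    (a b : ℝ) (hab : a < b) (g : ℂ → ℂ)
    (hcont : ContinuousOn g {s : ℂ | a ≤ s.re ∧ s.re ≤ b})
    (hdiff : DifferentiableOn ℂ g {s : ℂ | a < s.re ∧ s.re < b})
    (hord : ∃ C₀ : ℝ, 0 < C₀ ∧ ∃ ρ : ℝ, 0 < ρ ∧
      ∀ s : ℂ, a < s.re → s.re < b → ‖g s‖ ≤ C₀ * Real.exp (‖s‖ ^ ρ))
    (P : ℝ) (hPa : 0 < P + a) (A0 A1 B0 B1 : ℂ) (Q : ℂ → ℂ)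
    (hQ : ∀ s, Q s = (A0 + A1 * s) * Complex.log (P + s) + (B0 + B1 * s))
    (ha : ∀ s : ℂ, s.re = a → ‖g s‖ ≤ Real.exp (Q s).re)
    (hb : ∀ s : ℂ, s.re = b → ‖g s‖ ≤ Real.exp (Q s).re)
    (s : ℂ) (hsa : a ≤ s.re) (hsb : s.re ≤ b) : ‖g s‖ ≤ Real.exp (Q s).re := by
  have key : ∀ s, ‖g s * Complex.exp (-Q s)‖ ≤ 1 ↔ ‖g s‖ ≤ Real.exp (Q s).re := by
    intro s
    rw [norm_mul, Complex.norm_exp, Complex.neg_re, Real.exp_neg, ← div_eq_mul_inv,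
      div_le_one (Real.exp_pos _)]
  have hQd : ∀ s : ℂ, a ≤ s.re → DifferentiableAt ℂ Q s := by
    intro s hs
    have : Q = fun s => (A0 + A1 * s) * Complex.log (P + s) + (B0 + B1 * s) := funext hQ
    rw [this]
    have hm : (P : ℂ) + s ∈ Complex.slitPlane := by
      left; simp; linarith
    have : DifferentiableAt ℂ (fun s : ℂ => Complex.log (P + s)) s :=
      DifferentiableAt.clog (by fun_prop) hm
    fun_prop
  rw [← key]
  refine PhragmenLindelof.vertical_strip (a := a) (b := b) (C := 1)
    (f := fun s => g s * Complex.exp (-Q s)) ⟨?_, ?_⟩ ?_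
    (fun z hz => (key z).2 (ha z hz)) (fun z hz => (key z).2 (hb z hz)) hsa hsb
  · intro z hz
    exact (hdiff z hz).mul (hQd z hz.1.le).neg.cexp.differentiableWithinAt
  · rw [Complex.closure_preimage_re, closure_Ioo hab.ne]
    intro z hz
    exact (hcont z hz).mul (hQd z hz.1).neg.cexp.continuousAt.continuousWithinAt
  · obtain ⟨C₀, hC, ρ, hρ, hg⟩ := hord
    have hba : 0 < b - a := by linarith
    set c : ℝ := 1 / (b - a) with hc
    have hc0 : 0 < c := by positivity
    set M : ℝ := 1 + |a| + |b| + |P| with hM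
    set K : ℝ := (‖A0‖ + ‖A1‖) * (1 + |Real.log (P + a)| + Real.pi) + ‖B0‖ + ‖B1‖ with hK
    have hK0 : 0 ≤ K := by have := Real.pi_pos; positivity
    refine ⟨c, ?_, (1 + K) * Real.exp (c * M), ?_⟩
    · rw [hc]; gcongr; linarith [Real.pi_gt_three]
    set r := max ρ 2 with hr
    have hev : ∀ᶠ x : ℝ in Filter.atTop, x ^ r ≤ Real.exp (c * x) := by
      have := (isLittleO_rpow_exp_pos_mul_atTop r hc0).bound (c := 1) one_pos
      filter_upwards [this] with x hx
      simpa using (le_abs_self _).trans hx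
    have hev2 : ∀ᶠ z : ℂ in Filter.comap (_root_.abs ∘ Complex.im) Filter.atTop,
        (M + |z.im|) ^ r ≤ Real.exp (c * (M + |z.im|)) := by
      have ht : Filter.Tendsto (fun x : ℝ => M + x) Filter.atTop Filter.atTop :=
        Filter.tendsto_atTop_add_const_left _ _ Filter.tendsto_id
      exact (ht.comp Filter.tendsto_comap).eventually hev
    refine Asymptotics.IsBigO.of_bound C₀ ?_
    rw [Filter.eventually_inf_principal]
    filter_upwards [hev2] with z hz hzs
    obtain ⟨hz1, hz2⟩ : a < z.re ∧ z.re < b := hzs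
    set R := M + |z.im| with hR
    have hre : |z.re| ≤ |a| + |b| := by
      rw [abs_le]
      constructor
      · linarith [neg_abs_le a, abs_nonneg b]
      · linarith [le_abs_self b, abs_nonneg a]
    have hR1 : 1 ≤ R := by
      rw [hR, hM]; linarith [abs_nonneg a, abs_nonneg b, abs_nonneg P, abs_nonneg z.im]
    have hzR : ‖z‖ ≤ R := by
      have := Complex.norm_le_abs_re_add_abs_im z
      rw [hR, hM]; linarith [abs_nonneg P]
    have hwR : ‖(P : ℂ) + z‖ ≤ R := by
      have := Complex.norm_le_abs_re_add_abs_im z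
      have h2 := norm_add_le (P : ℂ) z
      rw [Complex.norm_real, Real.norm_eq_abs] at h2
      rw [hR, hM]; linarith
    have hwlow : P + a ≤ ‖(P : ℂ) + z‖ := by
      have := Complex.re_le_norm ((P : ℂ) + z)
      simp at this
      linarith
    have hlog : ‖Complex.log (P + z)‖ ≤ (1 + |Real.log (P + a)| + Real.pi) * R := by
      have h1 := Complex.norm_le_abs_re_add_abs_im (Complex.log (P + z))
      rw [Complex.log_re, Complex.log_im] at h1
      have h2 := Complex.abs_arg_le_pi ((P : ℂ) + z)
      have h3 : |Real.log ‖(P : ℂ) + z‖| ≤ R + |Real.log (P + a)| := by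
        rw [abs_le]
        constructor
        · have := Real.log_le_log hPa hwlow
          linarith [neg_abs_le (Real.log (P + a))]
        · have := Real.log_le_self (norm_nonneg ((P : ℂ) + z))
          linarith [abs_nonneg (Real.log (P + a))]
      have h4 : |Real.log (P + a)| + Real.pi ≤ (|Real.log (P + a)| + Real.pi) * R :=
        le_mul_of_one_le_right (by have := Real.pi_pos; positivity) hR1
      linarith
    have hA : ‖A0 + A1 * z‖ ≤ (‖A0‖ + ‖A1‖) * R := by
      refine (norm_add_le _ _).trans ?_
      rw [norm_mul, add_mul]
      gcongr
      exact le_mul_of_one_le_right (norm_nonneg _) hR1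
    have hB : ‖B0 + B1 * z‖ ≤ (‖B0‖ + ‖B1‖) * R := by
      refine (norm_add_le _ _).trans ?_
      rw [norm_mul, add_mul]
      gcongr
      exact le_mul_of_one_le_right (norm_nonneg _) hR1
    have hQn : ‖Q z‖ ≤ K * R ^ 2 := by
      rw [hQ]
      refine (norm_add_le _ _).trans ?_
      rw [norm_mul]
      have h1 : ‖A0 + A1 * z‖ * ‖Complex.log (P + z)‖ ≤
        ((‖A0‖ + ‖A1‖) * R) * ((1 + |Real.log (P + a)| + Real.pi) * R) := by gcongr
      have h2 : (‖B0‖ + ‖B1‖) * R ≤ (‖B0‖ + ‖B1‖) * R ^ 2 := by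
        gcongr; nlinarith
      rw [hK]
      linarith
    have hR2 : R ^ 2 ≤ R ^ r := by
      rw [← Real.rpow_two]
      exact Real.rpow_le_rpow_of_exponent_le hR1 (le_max_right _ _)
    have hzr : ‖z‖ ^ ρ ≤ R ^ r :=
      (Real.rpow_le_rpow (norm_nonneg _) hzR hρ.le).trans
        (Real.rpow_le_rpow_of_exponent_le hR1 (le_max_left _ _))
    have hfin : ‖z‖ ^ ρ + (-(Q z)).re ≤ (1 + K) * Real.exp (c * M) * Real.exp (c * |z.im|) := by
      have h1 : (-(Q z)).re ≤ K * R ^ r :=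
        (Complex.re_le_norm _).trans (by rw [norm_neg]; exact hQn.trans (by gcongr))
      have h2 : Real.exp (c * M) * Real.exp (c * |z.im|) = Real.exp (c * R) := by
        rw [← Real.exp_add, hR]; ring_nf
      rw [mul_assoc, h2]
      have h3 : (1 + K) * R ^ r ≤ (1 + K) * Real.exp (c * R) := by gcongr
      linarith
    rw [norm_mul, Complex.norm_exp, Real.norm_eq_abs, Real.abs_exp]
    calc _ ≤ (C₀ * Real.exp (‖z‖ ^ ρ)) * Real.exp (-(Q z)).re := by
            gcongr; exact hg z hz1 hz2
      _ = C₀ * Real.exp (‖z‖ ^ ρ + (-(Q z)).re) := by rw [Real.exp_add]; ring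
      _ ≤ _ := by gcongr

/-- **Rademacher's strong convexity principle.** -/
theorem rademacher_convexity
    (a b : ℝ) (hab : a < b) (g : ℂ → ℂ)
    (hcont : ContinuousOn g {s : ℂ | a ≤ s.re ∧ s.re ≤ b})
    (hdiff : DifferentiableOn ℂ g {s : ℂ | a < s.re ∧ s.re < b})
    (hord : ∃ C₀ : ℝ, 0 < C₀ ∧ ∃ ρ : ℝ, 0 < ρ ∧
      ∀ s : ℂ, a < s.re → s.re < b → ‖g s‖ ≤ C₀ * Real.exp (‖s‖ ^ ρ))
    (E F P α β : ℝ) (hE : 0 < E) (hF : 0 < F) (hPa : 0 < P + a) (hαβ : β ≤ α)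
    (hga : ∀ t : ℝ,
      ‖g ((a : ℂ) + t * Complex.I)‖ ≤ E * ‖(P : ℂ) + a + t * Complex.I‖ ^ α)
    (hgb : ∀ t : ℝ,
      ‖g ((b : ℂ) + t * Complex.I)‖ ≤ F * ‖(P : ℂ) + b + t * Complex.I‖ ^ β) :
    ∀ σ t : ℝ, a < σ → σ < b →
      ‖g ((σ : ℂ) + t * Complex.I)‖ ≤
        (E * ‖(P : ℂ) + σ + t * Complex.I‖ ^ α) ^ ((b - σ) / (b - a)) *
        (F * ‖(P : ℂ) + σ + t * Complex.I‖ ^ β) ^ ((σ - a) / (b - a)) := by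
  intro σ t hσa hσb
  have hba : 0 < b - a := by linarith
  have hba' : b - a ≠ 0 := hba.ne'
  have hbaC : (b : ℂ) - a ≠ 0 := by exact_mod_cast hba'
  set s₀ : ℂ := (σ : ℂ) + t * Complex.I with hs₀
  have hs₀re : s₀.re = σ := by simp [hs₀]
  obtain ⟨A, B, hAB0, hAB⟩ := rad_support ((P : ℂ) + s₀) (by simp [hs₀re]; linarith)
  set κ : ℝ := (α - β) / (b - a) with hκ
  have hκ0 : 0 ≤ κ := div_nonneg (by linarith) hba.le
  set c : ℝ := (α * (P + b) - β * (P + a)) / (b - a) with hc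
  set e1 : ℝ := (Real.log F - Real.log E) / (b - a) with he1
  set e0 : ℝ := (b * Real.log E - a * Real.log F) / (b - a) with he0
  set Q : ℂ → ℂ := fun s => ((c - κ * P : ℝ) + ((-κ : ℝ) : ℂ) * s) * Complex.log (P + s) +
    ((-κ * (A - B * Complex.I) * P + e0) + (-κ * (A - B * Complex.I) + e1) * s) with hQ
  have hQre : ∀ s : ℂ, (Q s).re = (c - κ * (P + s.re)) * Real.log ‖(P : ℂ) + s‖ + (e0 + e1 * s.re)
      + κ * (((P : ℂ) + s).im * ((P : ℂ) + s).arg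
        - (A * ((P : ℂ) + s).re + B * ((P : ℂ) + s).im)) := by
    intro s
    simp only [hQ]
    simp [Complex.log_re, Complex.log_im]
    ring
  have hform : ∀ x u : ℝ, (c - κ * (P + x)) * u + (e0 + e1 * x) =
      (b - x) / (b - a) * (Real.log E + α * u) + (x - a) / (b - a) * (Real.log F + β * u) := by
    intro x u
    rw [hc, hκ, he0, he1]
    field_simp
    ring
  have hpow : ∀ (G r γ : ℝ), 0 < G → 0 < r → G * r ^ γ = Real.exp (Real.log G + γ * Real.log r) := by
    intro G r γ hG hr
    rw [Real.exp_add, Real.exp_log hG, Real.rpow_def_of_pos hr, mul_comm γ]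
  have hwpos : ∀ s : ℂ, a ≤ s.re → 0 < ((P : ℂ) + s).re := by
    intro s hs; simp; linarith
  have hnpos : ∀ s : ℂ, a ≤ s.re → 0 < ‖(P : ℂ) + s‖ := by
    intro s hs
    exact (hwpos s hs).trans_le (Complex.re_le_norm _)
  have hlow : ∀ s : ℂ, a ≤ s.re →
      (c - κ * (P + s.re)) * Real.log ‖(P : ℂ) + s‖ + (e0 + e1 * s.re) ≤ (Q s).re := by
    intro s hs
    rw [hQre]
    have := mul_nonneg hκ0 (sub_nonneg.2 (hAB _ (hwpos s hs)))
    linarith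
  have main := rad_PL a b hab g hcont hdiff hord P hPa _ _ _ _ Q (fun s => rfl) ?_ ?_ s₀
    (by rw [hs₀re]; exact hσa.le) (by rw [hs₀re]; exact hσb.le)
  · have hn : 0 < ‖(P : ℂ) + s₀‖ := hnpos s₀ (by rw [hs₀re]; exact hσa.le)
    rw [hQre, hAB0, sub_self, mul_zero, add_zero, hs₀re, hform] at main
    have e : (P : ℂ) + σ + t * Complex.I = P + s₀ := by rw [hs₀]; ring
    rw [e, hpow E _ α hE hn, hpow F _ β hF hn, ← Real.exp_mul, ← Real.exp_mul, ← Real.exp_add]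
    refine main.trans (le_of_eq ?_)
    congr 1
    ring
  · intro s hs
    refine le_trans ?_ (Real.exp_le_exp.2 (hlow s hs.ge))
    have e : (a : ℂ) + s.im * Complex.I = s := by rw [← hs]; exact Complex.re_add_im s
    have := hga s.im
    rw [add_assoc, e, hpow E _ α hE (hnpos s hs.ge)] at this
    refine this.trans (le_of_eq ?_)
    rw [hform, hs, sub_self, div_self hba']
    congr 1
    ring
  · intro s hs
    have hs' : a ≤ s.re := by rw [hs]; exact hab.le
    refine le_trans ?_ (Real.exp_le_exp.2 (hlow s hs'))
    have e : (b : ℂ) + s.im * Complex.I = s := by rw [← hs]; exact Complex.re_add_im s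
    have := hgb s.im
    rw [add_assoc, e, hpow F _ β hF (hnpos s hs')] at this
    refine this.trans (le_of_eq ?_)
    rw [hform, hs, sub_self, div_self hba']
    congr 1
    ring
end

section
/- Let Δ = 1/100 and let Q ≥ 1 and M ≥ 1 be real numbers. Let Z : ℂ → ℂ be continuous on the closed strip {s : −Δ ≤ Re(s) ≤ 1+Δ}, holomorphic on the open strip {s : −Δ < Re(s) < 1+Δ}, and of finite order on that strip. Suppose there are constants E₁, E₂ > 0 such that for all t ∈ ℝ: |Z(1 + Δ + it)| ≤ E₁ and |Z(−Δ + it)| ≤ E₂ · M · Q^{1+2Δ} · |1 + it|^{2+4Δ}. Then there is an absolute constant C > 0 such that for all σ with −Δ < σ < 1+Δ and all t ∈ ℝ: |Z(σ + it)| ≤ C · max(E₁, E₂) · Q^{1+Δ−σ} · M^{(1+Δ−σ)/(1+2Δ)} · (3 + |t|)^{2(1+Δ−σ)}. -/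
/-- Convexity bound in the strip `-1/100 ≤ Re s ≤ 1 + 1/100` for a function with the
analytic properties of the completed Rankin–Selberg zeta function of two distinct
newforms. -/
theorem convexity_bound_rankin_selberg :
    ∃ C : ℝ, 0 < C ∧
      ∀ (Q M : ℝ), 1 ≤ Q → 1 ≤ M →
        ∀ (Z : ℂ → ℂ),
          ContinuousOn Z {s : ℂ | -(1 / 100 : ℝ) ≤ s.re ∧ s.re ≤ 1 + 1 / 100} →
          DifferentiableOn ℂ Z {s : ℂ | -(1 / 100 : ℝ) < s.re ∧ s.re < 1 + 1 / 100} →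
          (∃ C₀ : ℝ, 0 < C₀ ∧ ∃ ρ : ℝ, 0 < ρ ∧
            ∀ s : ℂ, -(1 / 100 : ℝ) < s.re → s.re < 1 + 1 / 100 →
              ‖Z s‖ ≤ C₀ * Real.exp (‖s‖ ^ ρ)) →
          ∀ E₁ E₂ : ℝ, 0 < E₁ → 0 < E₂ →
            (∀ t : ℝ, ‖Z (((1 + 1 / 100 : ℝ) : ℂ) + t * Complex.I)‖ ≤ E₁) →
            (∀ t : ℝ, ‖Z (((-(1 / 100) : ℝ) : ℂ) + t * Complex.I)‖ ≤
              E₂ * M * Q ^ (1 + 2 * (1 / 100) : ℝ) *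
                ‖(1 : ℂ) + t * Complex.I‖ ^ (2 + 4 * (1 / 100) : ℝ)) →
            ∀ σ t : ℝ, -(1 / 100 : ℝ) < σ → σ < 1 + 1 / 100 →
              ‖Z ((σ : ℂ) + t * Complex.I)‖ ≤
                C * max E₁ E₂ * Q ^ (1 + 1 / 100 - σ : ℝ) *
                  M ^ ((1 + 1 / 100 - σ) / (1 + 2 * (1 / 100)) : ℝ) *
                  (3 + |t|) ^ (2 * (1 + 1 / 100 - σ) : ℝ) := by
  refine ⟨Real.exp 2, Real.exp_pos 2, ?_⟩
  intro Q M hQ hM Z hZc hZd hZo E₁ E₂ hE₁ hE₂ hR hL σ t hσ₁ hσ₂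
  obtain ⟨C₀, hC₀, ρ, hρ, hZb⟩ := hZo
  have hQ0 : 0 < Q := by linarith
  have hM0 : 0 < M := by linarith
  have hT0 : 0 < 3 + |t| := by positivity
  set A : ℝ := M * Q ^ (1 + 2 * (1 / 100) : ℝ) * (3 + |t|) ^ (2 + 4 * (1 / 100) : ℝ) with hA
  have hA0 : 0 < A := by positivity
  have hA1 : 1 ≤ A := by
    have h1 : 1 ≤ Q ^ (1 + 2 * (1 / 100) : ℝ) := Real.one_le_rpow hQ (by norm_num)
    have h2 : 1 ≤ (3 + |t|) ^ (2 + 4 * (1 / 100) : ℝ) :=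
      Real.one_le_rpow (by linarith [abs_nonneg t]) (by norm_num)
    exact one_le_mul_of_one_le_of_one_le (one_le_mul_of_one_le_of_one_le hM h1) h2
  set L : ℝ := Real.log A / (102 / 100) with hLdef
  have hL0 : 0 ≤ L := div_nonneg (Real.log_nonneg hA1) (by norm_num)
  have hLA : L * (102 / 100) = Real.log A := by rw [hLdef]; field_simp
  set G : ℂ → ℂ := fun s =>
    Complex.exp ((L : ℂ) * (s - ((101 / 100 : ℝ) : ℂ)) + (s - t * Complex.I) ^ 2) with hG
  have hGn : ∀ s : ℂ, ‖G s‖ =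
      Real.exp (L * (s.re - 101 / 100) + (s.re ^ 2 - (s.im - t) ^ 2)) := by
    intro s
    rw [hG]
    simp only [Complex.norm_exp]
    congr 1
    simp [pow_two]
  have hset : Complex.re ⁻¹' Set.Ioo (-(1 / 100) : ℝ) (1 + 1 / 100) =
      {s : ℂ | -(1 / 100 : ℝ) < s.re ∧ s.re < 1 + 1 / 100} := rfl
  have hcl : closure (Complex.re ⁻¹' Set.Ioo (-(1 / 100) : ℝ) (1 + 1 / 100)) =
      {s : ℂ | -(1 / 100 : ℝ) ≤ s.re ∧ s.re ≤ 1 + 1 / 100} := by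
    rw [Complex.closure_preimage_re, closure_Ioo (by norm_num)]
    rfl
  have hZdc : DiffContOnCl ℂ Z (Complex.re ⁻¹' Set.Ioo (-(1 / 100) : ℝ) (1 + 1 / 100)) :=
    ⟨hZd, by rw [hcl]; exact hZc⟩
  have hGd : Differentiable ℂ G := by rw [hG]; fun_prop
  have hF : DiffContOnCl ℂ (fun s => G s • Z s)
      (Complex.re ⁻¹' Set.Ioo (-(1 / 100) : ℝ) (1 + 1 / 100)) :=
    hGd.diffContOnCl.smul hZdc
  have key : ‖G ((σ : ℂ) + t * Complex.I) • Z ((σ : ℂ) + t * Complex.I)‖ ≤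
      Real.exp 2 * max E₁ E₂ := by
    refine PhragmenLindelof.vertical_strip (f := fun s => G s • Z s)
      (z := (σ : ℂ) + t * Complex.I) hF ?_ ?_ ?_ (by simpa using hσ₁.le)
      (by simpa using hσ₂.le)
    · obtain ⟨n, hn⟩ := exists_nat_ge ρ
      refine ⟨1, ?_, (n.factorial : ℝ) * Real.exp 2, ?_⟩
      · rw [lt_div_iff₀ (by norm_num)]
        linarith [Real.pi_gt_three]
      · refine Asymptotics.IsBigO.of_bound (Real.exp 2 * C₀) ?_
        refine Filter.mem_inf_of_right ?_
        intro s hs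
        obtain ⟨hs1, hs2⟩ : -(1 / 100 : ℝ) < s.re ∧ s.re < 1 + 1 / 100 := hs
        have h1 : ‖G s‖ ≤ Real.exp 2 := by
          rw [hGn]
          apply Real.exp_le_exp.2
          nlinarith [sq_nonneg (s.im - t), mul_nonneg hL0 (by linarith : 0 ≤ 101 / 100 - s.re)]
        have h2 := hZb s hs1 hs2
        have hsn : ‖s‖ ≤ 2 + |s.im| := by
          refine (Complex.norm_le_abs_re_add_abs_im s).trans ?_
          have : |s.re| ≤ 2 := abs_le.2 ⟨by linarith, by linarith⟩
          linarith
        have h3 : ‖s‖ ^ ρ ≤ (n.factorial : ℝ) * Real.exp 2 * Real.exp (1 * |s.im|) := by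
          calc ‖s‖ ^ ρ ≤ (2 + |s.im|) ^ ρ := Real.rpow_le_rpow (norm_nonneg _) hsn hρ.le
            _ ≤ (2 + |s.im|) ^ (n : ℝ) :=
              Real.rpow_le_rpow_of_exponent_le (by linarith [abs_nonneg s.im]) hn
            _ = (2 + |s.im|) ^ n := Real.rpow_natCast _ _
            _ ≤ (n.factorial : ℝ) * Real.exp (2 + |s.im|) := by
              have := Real.pow_div_factorial_le_exp (2 + |s.im|) (by positivity) n
              rw [div_le_iff₀ (by positivity)] at this
              linarith
            _ = _ := by rw [Real.exp_add, one_mul]; ring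
        show ‖G s • Z s‖ ≤ _
        rw [norm_smul, Real.norm_eq_abs, Real.abs_exp, mul_assoc]
        refine mul_le_mul h1 (h2.trans ?_) (norm_nonneg _) (Real.exp_pos 2).le
        exact mul_le_mul_of_nonneg_left (Real.exp_le_exp.2 h3) hC₀.le
    · intro s hs
      have hs' : s = (((-(1 / 100) : ℝ) : ℂ) + s.im * Complex.I) := by
        rw [← hs]; exact (Complex.re_add_im s).symm
      have h1 := hL s.im
      rw [← hs'] at h1
      have h2 : ‖(1 : ℂ) + s.im * Complex.I‖ ≤ (3 + |t|) * Real.exp |s.im - t| := by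
        have h3 : ‖(1 : ℂ) + s.im * Complex.I‖ ≤ 1 + |s.im| := by
          refine (norm_add_le _ _).trans ?_
          simp
        have h4 : |s.im| ≤ |s.im - t| + |t| := by
          simpa using abs_add_le (s.im - t) t
        have h5 := Real.add_one_le_exp |s.im - t|
        nlinarith [abs_nonneg t, abs_nonneg (s.im - t)]
      have h3 : ‖(1 : ℂ) + s.im * Complex.I‖ ^ (2 + 4 * (1 / 100) : ℝ) ≤
          (3 + |t|) ^ (2 + 4 * (1 / 100) : ℝ) *
            Real.exp (|s.im - t| * (2 + 4 * (1 / 100))) := by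
        refine (Real.rpow_le_rpow (norm_nonneg _) h2 (by norm_num)).trans ?_
        rw [Real.mul_rpow hT0.le (Real.exp_pos _).le, Real.exp_mul]
      have h4 : ‖Z s‖ ≤ E₂ * A * Real.exp (|s.im - t| * (2 + 4 * (1 / 100))) := by
        refine h1.trans ?_
        refine (mul_le_mul_of_nonneg_left h3 (by positivity)).trans (le_of_eq ?_)
        rw [hA]; ring
      rw [norm_smul, hGn, hs]
      have h5 : Real.exp (L * (-(1 / 100) - 101 / 100) +
          ((-(1 / 100)) ^ 2 - (s.im - t) ^ 2)) * A *
          Real.exp (|s.im - t| * (2 + 4 * (1 / 100))) ≤ Real.exp 2 := by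
        have hAe : A = Real.exp (L * (102 / 100)) := by rw [hLA, Real.exp_log hA0]
        nth_rewrite 1 [hAe]
        rw [← Real.exp_add, ← Real.exp_add]
        apply Real.exp_le_exp.2
        nlinarith [sq_abs (s.im - t), sq_nonneg (|s.im - t| - 102 / 100)]
      calc _ ≤ Real.exp (L * (-(1 / 100) - 101 / 100) +
          ((-(1 / 100)) ^ 2 - (s.im - t) ^ 2)) *
            (E₂ * A * Real.exp (|s.im - t| * (2 + 4 * (1 / 100)))) :=
            mul_le_mul_of_nonneg_left h4 (Real.exp_pos _).le
        _ = (Real.exp (L * (-(1 / 100) - 101 / 100) +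
          ((-(1 / 100)) ^ 2 - (s.im - t) ^ 2)) * A *
          Real.exp (|s.im - t| * (2 + 4 * (1 / 100)))) * E₂ := by ring
        _ ≤ Real.exp 2 * max E₁ E₂ :=
            mul_le_mul h5 (le_max_right _ _) hE₂.le (Real.exp_pos 2).le
    · intro s hs
      have hs' : s = (((1 + 1 / 100 : ℝ) : ℂ) + s.im * Complex.I) := by
        rw [← hs]; exact (Complex.re_add_im s).symm
      have h1 := hR s.im
      rw [← hs'] at h1
      rw [norm_smul, hGn, hs]
      refine mul_le_mul (Real.exp_le_exp.2 ?_) (h1.trans (le_max_left _ _)) (norm_nonneg _)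
        (Real.exp_pos 2).le
      nlinarith [sq_nonneg (s.im - t)]
  rw [norm_smul, hGn] at key
  simp only [Complex.add_re, Complex.ofReal_re, Complex.mul_re, Complex.I_re, mul_zero,
    Complex.ofReal_im, Complex.I_im, mul_one, sub_self, add_zero, Complex.add_im,
    Complex.mul_im, zero_add] at key
  have hfin : Q ^ (1 + 1 / 100 - σ : ℝ) * M ^ ((1 + 1 / 100 - σ) / (1 + 2 * (1 / 100)) : ℝ) *
      (3 + |t|) ^ (2 * (1 + 1 / 100 - σ) : ℝ) = Real.exp (L * (101 / 100 - σ)) := by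
    have hlog : Real.log A = Real.log M + (1 + 2 * (1 / 100)) * Real.log Q +
        (2 + 4 * (1 / 100)) * Real.log (3 + |t|) := by
      rw [hA, Real.log_mul (by positivity) (by positivity),
        Real.log_mul (by positivity) (by positivity), Real.log_rpow hQ0, Real.log_rpow hT0]
    rw [Real.rpow_def_of_pos hQ0, Real.rpow_def_of_pos hM0, Real.rpow_def_of_pos hT0,
      ← Real.exp_add, ← Real.exp_add, hLdef, hlog]
    congr 1
    ring
  have h0 : Real.exp (L * (σ - 101 / 100)) * ‖Z ((σ : ℂ) + t * Complex.I)‖ ≤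
      Real.exp 2 * max E₁ E₂ := by
    refine le_trans (mul_le_mul_of_nonneg_right (Real.exp_le_exp.2 ?_) (norm_nonneg _)) key
    nlinarith [sq_nonneg σ]
  calc ‖Z ((σ : ℂ) + t * Complex.I)‖
      = Real.exp (L * (101 / 100 - σ)) *
        (Real.exp (L * (σ - 101 / 100)) * ‖Z ((σ : ℂ) + t * Complex.I)‖) := by
        rw [← mul_assoc, ← Real.exp_add, show L * (101 / 100 - σ) + L * (σ - 101 / 100) = 0 by ring,
          Real.exp_zero, one_mul]
    _ ≤ Real.exp (L * (101 / 100 - σ)) * (Real.exp 2 * max E₁ E₂) :=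
        mul_le_mul_of_nonneg_left h0 (Real.exp_pos _).le
    _ = _ := by rw [← hfin]; ring
end

section
/- Let Δ = 1/100. There is an absolute constant C > 0 with the following property. Let k ≥ 2 and N ≥ 1 be integers, let D be a positive divisor of N, let u(p) ∈ {1, −1} for each prime p dividing D, and let λ, μ : ℕ → ℝ satisfy |λ(n)| ≤ τ(n) and |μ(n)| ≤ τ(n) for all n ≥ 1. Define ζ_N(s) := ζ(s) · ∏_{p prime, p | N} (1 − p^{−s}). Let R : ℂ → ℂ be a function such that R(s) = ∑_{n≥1} λ(n)μ(n) n^{−s} for all s with Re(s) > 1, and such that for all s ∈ ℂ with Re(s) = 1 + Δ the functional equation ζ_N(2 − 2s) R(1 − s) = (2π)^{2−4s} · N^{2s−1} · (Γ(s)/Γ(1−s)) · (Γ(k−1+s)/Γ(k−s)) · ∏_{p prime, p | D} (1 − u(p) p^{s−1})/(1 − u(p) p^{−s}) · ζ_N(2s) R(s) holds. Then for all t ∈ ℝ: |ζ_N(−2Δ + 2it) · R(−Δ + it)| ≤ C · τ(N) · (kN)^{1+2Δ} · N^{Δ} · |1 + it|^{2+4Δ}. -/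
open Finset

/-- The Riemann zeta function with Euler factors at primes dividing `N` removed. -/
noncomputable def zetaN (N : ℕ) (s : ℂ) : ℂ :=
  riemannZeta s * ∏ p ∈ N.primeFactors, (1 - (p : ℂ) ^ (-s))



lemma aux_step (z : ℂ) (hz : 1 / 2 ≤ z.re) :
    ‖z + 1‖ ^ (1 / 50 : ℝ) * ‖z‖ ≤
      ‖z + ((1 / 50 : ℝ) : ℂ)‖ * ‖z‖ ^ (1 / 50 : ℝ) * Real.exp (1 / z.re ^ 2) := by
  have h0 : ∀ a : ℝ, 0 ≤ a → 0 < ‖z + (a : ℂ)‖ := by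
    intro a ha
    refine norm_pos_iff.mpr fun h => ?_
    have := congrArg Complex.re h
    simp at this
    linarith
  have hz0 : 0 < ‖z‖ := by simpa using h0 0 le_rfl
  have hz1 : 0 < ‖z + 1‖ := by simpa using h0 1 zero_le_one
  have hzt := h0 (1 / 50) (by norm_num)
  have hsq : ∀ a : ℝ, ‖z + (a : ℂ)‖ ^ 2 = (z.re ^ 2 + z.im ^ 2) + 2 * a * z.re + a ^ 2 := by
    intro a
    rw [Complex.sq_norm, Complex.normSq_apply]
    simp
    ring
  have hlog : ∀ a : ℝ, 0 ≤ a → Real.log ‖z + (a : ℂ)‖ =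
      1 / 2 * Real.log ((z.re ^ 2 + z.im ^ 2) + 2 * a * z.re + a ^ 2) := by
    intro a ha
    rw [← hsq, Real.log_pow]
    push_cast
    ring
  set x := z.re with hx
  set r := x ^ 2 + z.im ^ 2 with hr
  have hxr : x ^ 2 ≤ r := by nlinarith [sq_nonneg z.im]
  have hr4 : 1 / 4 ≤ r := by nlinarith
  have hr0 : 0 < r := by linarith
  have l0 : Real.log ‖z‖ = 1 / 2 * Real.log r := by
    have := hlog 0 le_rfl
    simpa using this
  have l1 : Real.log ‖z + 1‖ = 1 / 2 * Real.log (r + 2 * x + 1) := by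
    have := hlog 1 zero_le_one
    simpa using this
  have lt := hlog (1 / 50) (by norm_num)
  have e1 : Real.log (r + 2 * x + 1) ≤ Real.log r + (2 * x + 1) / r := by
    have h : r + 2 * x + 1 = r * (1 + (2 * x + 1) / r) := by field_simp; ring
    have hp : 0 < 1 + (2 * x + 1) / r := by positivity
    rw [h, Real.log_mul hr0.ne' hp.ne']
    have := Real.log_le_sub_one_of_pos hp
    linarith
  set v := (2 * (1 / 50) * x + (1 / 50) ^ 2) / r with hv
  have hv0 : 0 ≤ v := by positivity
  have e2 : Real.log r + (v - v ^ 2) ≤ Real.log (r + 2 * (1 / 50) * x + (1 / 50) ^ 2) := by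
    have h : r + 2 * (1 / 50) * x + (1 / 50) ^ 2 = r * (1 + v) := by
      rw [hv]; field_simp; ring
    have hp : 0 < 1 + v := by positivity
    rw [h, Real.log_mul hr0.ne' hp.ne']
    have h1 := Real.one_sub_inv_le_log_of_pos hp
    have h2 : v - v ^ 2 ≤ 1 - (1 + v)⁻¹ := by
      have : 1 - (1 + v)⁻¹ = v / (1 + v) := by field_simp; ring
      rw [this, le_div_iff₀ hp]
      nlinarith [pow_nonneg hv0 3]
    linarith
  have e3 : v ^ 2 ≤ 1 / r := by
    rw [hv, div_pow, div_le_div_iff₀ (by positivity) hr0]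
    have : (2 * (1 / 50) * x + (1 / 50) ^ 2) ^ 2 ≤ r := by nlinarith
    nlinarith
  have e4 : 1 / r ≤ 1 / x ^ 2 := one_div_le_one_div_of_le (by positivity) hxr
  have e5 : (1 / 50 : ℝ) * ((2 * x + 1) / r) ≤ v + 1 / 50 * (1 / r) := by
    have : v = 1 / 50 * (2 * x / r) + (1 / 50) ^ 2 * (1 / r) := by rw [hv]; field_simp
    rw [this, add_div]
    have : 0 < 1 / r := by positivity
    nlinarith
  rw [← Real.log_le_log_iff (by positivity) (by positivity),
    Real.log_mul (by positivity) (by positivity), Real.log_mul (by positivity) (by positivity),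
    Real.log_mul (by positivity) (by positivity), Real.log_rpow hz1, Real.log_rpow hz0,
    Real.log_exp, l0, l1, lt]
  have : 0 < 1 / r := by positivity
  nlinarith

lemma aux_prod (w : ℂ) (hw : 1 / 2 ≤ w.re) (m : ℕ) :
    (∏ j ∈ range m, ‖w + j‖) * ‖w + m‖ ^ (1 / 50 : ℝ) ≤
      Real.exp (∑ j ∈ range m, 4 / ((j : ℝ) + 1) ^ 2) * ‖w‖ ^ (1 / 50 : ℝ) *
        ∏ j ∈ range m, ‖w + ((1 / 50 : ℝ) : ℂ) + j‖ := by
  induction m with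
  | zero => simp
  | succ m ih =>
    rw [prod_range_succ, prod_range_succ, sum_range_succ, Real.exp_add]
    have h1 := aux_step (w + m) (by simp; have : (0 : ℝ) ≤ m := by positivity
                                    linarith)
    have h2 : Real.exp (1 / (w + m).re ^ 2) ≤ Real.exp (4 / ((m : ℝ) + 1) ^ 2) := by
      apply Real.exp_le_exp.mpr
      have : (0 : ℝ) ≤ m := by positivity
      have h3 : ((m : ℝ) + 1) / 2 ≤ (w + m).re := by simp; linarith
      have h4 : 0 < (w + m).re := by linarith
      rw [div_le_div_iff₀ (by positivity) (by positivity)]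
      nlinarith
    have e1 : w + ((1 / 50 : ℝ) : ℂ) + m = w + m + ((1 / 50 : ℝ) : ℂ) := by ring
    have e2 : w + ((m + 1 : ℕ) : ℂ) = w + m + 1 := by push_cast; ring
    rw [e1, e2]
    set P := ∏ j ∈ range m, ‖w + j‖
    set Q := ∏ j ∈ range m, ‖w + ((1 / 50 : ℝ) : ℂ) + j‖
    set a := ‖w + m‖
    set b := ‖w + m + ((1 / 50 : ℝ) : ℂ)‖
    have hP : 0 ≤ P := prod_nonneg fun _ _ => norm_nonneg _
    calc P * a * ‖w + m + 1‖ ^ (1 / 50 : ℝ) = P * (‖w + m + 1‖ ^ (1 / 50 : ℝ) * a) := by ring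
      _ ≤ P * (b * a ^ (1 / 50 : ℝ) * Real.exp (4 / ((m : ℝ) + 1) ^ 2)) := by
          exact mul_le_mul_of_nonneg_left (h1.trans (by gcongr)) hP
      _ = (P * a ^ (1 / 50 : ℝ)) * (b * Real.exp (4 / ((m : ℝ) + 1) ^ 2)) := by ring
      _ ≤ (Real.exp (∑ j ∈ range m, 4 / ((j : ℝ) + 1) ^ 2) * ‖w‖ ^ (1 / 50 : ℝ) * Q) *
            (b * Real.exp (4 / ((m : ℝ) + 1) ^ 2)) := by gcongr
      _ = _ := by ring

lemma aux_gamma : ∃ C : ℝ, 0 < C ∧ ∀ w : ℂ, 1 / 2 ≤ w.re →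
    ‖Complex.Gamma (w + ((1 / 50 : ℝ) : ℂ))‖ ≤ C * ‖w‖ ^ (1 / 50 : ℝ) * ‖Complex.Gamma w‖ := by
  have hs : Summable fun j : ℕ => 4 / ((j : ℝ) + 1) ^ 2 := by
    have h := (summable_nat_add_iff 1).mpr (Real.summable_one_div_nat_pow.mpr one_lt_two)
    have := h.mul_left 4
    refine this.congr fun j => ?_
    push_cast
    ring
  refine ⟨Real.exp (∑' j : ℕ, 4 / ((j : ℝ) + 1) ^ 2), Real.exp_pos _, fun w hw => ?_⟩
  have t1 := (Complex.GammaSeq_tendsto_Gamma (w + ((1 / 50 : ℝ) : ℂ))).norm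
  have t2 := ((Complex.GammaSeq_tendsto_Gamma w).norm).const_mul
    (Real.exp (∑' j : ℕ, 4 / ((j : ℝ) + 1) ^ 2) * ‖w‖ ^ (1 / 50 : ℝ))
  refine le_of_tendsto_of_tendsto t1 t2 ?_
  filter_upwards [Filter.eventually_ge_atTop 1] with n hn
  have hn0 : (0 : ℝ) < n := by exact_mod_cast hn
  have h := aux_prod w hw (n + 1)
  have hpos : ∀ a : ℝ, 0 ≤ a → ∀ j : ℕ, 0 < ‖w + (a : ℂ) + j‖ := by
    intro a ha j
    refine norm_pos_iff.mpr fun h => ?_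
    have := congrArg Complex.re h
    have hj : (0 : ℝ) ≤ j := by positivity
    simp at this
    linarith
  have hP : 0 < ∏ j ∈ range (n + 1), ‖w + j‖ :=
    prod_pos fun j _ => by simpa using hpos 0 le_rfl j
  have hQ : 0 < ∏ j ∈ range (n + 1), ‖w + ((1 / 50 : ℝ) : ℂ) + j‖ :=
    prod_pos fun j _ => hpos _ (by norm_num) j
  have hsum : Real.exp (∑ j ∈ range (n + 1), 4 / ((j : ℝ) + 1) ^ 2) ≤
      Real.exp (∑' j : ℕ, 4 / ((j : ℝ) + 1) ^ 2) :=
    Real.exp_le_exp.mpr (hs.sum_le_tsum _ fun _ _ => by positivity)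
  have hnn : (n : ℝ) ^ (1 / 50 : ℝ) ≤ ‖w + ((n + 1 : ℕ) : ℂ)‖ ^ (1 / 50 : ℝ) := by
    gcongr
    refine le_trans ?_ (Complex.re_le_norm _)
    simp
    linarith
  unfold Complex.GammaSeq
  rw [norm_div, norm_div, norm_mul, norm_mul, norm_prod, norm_prod,
    Complex.norm_natCast_cpow_of_pos (by omega), Complex.norm_natCast_cpow_of_pos (by omega)]
  have hre : (w + ((1 / 50 : ℝ) : ℂ)).re = w.re + 1 / 50 := by simp
  rw [hre, Real.rpow_add hn0, ← mul_div_assoc, div_le_div_iff₀ hQ hP]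
  set P := ∏ j ∈ range (n + 1), ‖w + j‖
  set Q := ∏ j ∈ range (n + 1), ‖w + ((1 / 50 : ℝ) : ℂ) + j‖
  calc (n : ℝ) ^ w.re * (n : ℝ) ^ (1 / 50 : ℝ) * ‖(n.factorial : ℂ)‖ * P
      = ((n : ℝ) ^ w.re * ‖(n.factorial : ℂ)‖) * (P * (n : ℝ) ^ (1 / 50 : ℝ)) := by ring
    _ ≤ ((n : ℝ) ^ w.re * ‖(n.factorial : ℂ)‖) *
        (Real.exp (∑' j : ℕ, 4 / ((j : ℝ) + 1) ^ 2) * ‖w‖ ^ (1 / 50 : ℝ) * Q) := by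
        refine mul_le_mul_of_nonneg_left ?_ (by positivity)
        exact (mul_le_mul_of_nonneg_left hnn hP.le).trans (h.trans (by gcongr))
    _ = _ := by ring

/-- Gamma quotient. -/
lemma aux_gamma_quot : ∃ C : ℝ, 0 < C ∧ ∀ (k : ℕ) (t : ℝ), 1 ≤ k → ∀ s : ℂ,
    s = ((1 + 1 / 100 : ℝ) : ℂ) - t * Complex.I →
    ‖Complex.Gamma ((k : ℂ) - 1 + s) / Complex.Gamma ((k : ℂ) - s)‖ ≤
      C * (k * ‖(1 : ℂ) + t * Complex.I‖) ^ (1 + 2 * (1 / 100) : ℝ) := by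
  obtain ⟨C, hC, h⟩ := aux_gamma
  refine ⟨C, hC, fun k t hk s hs => ?_⟩
  have hk1 : (1 : ℝ) ≤ k := by exact_mod_cast hk
  set y : ℂ := (starRingEnd ℂ) ((k : ℂ) - s) with hy
  have hyre : y.re = k - 1 - 1 / 100 := by simp [hy, hs]; ring
  have hyim : y.im = -t := by simp [hy, hs]
  have hn : ‖Complex.Gamma ((k : ℂ) - s)‖ = ‖Complex.Gamma y‖ := by
    rw [hy, Complex.Gamma_conj, Complex.norm_conj]
  have hy0 : y ≠ 0 := by
    intro h0
    rw [h0] at hyre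
    simp at hyre
    have h2 : (100 : ℝ) * k = 101 := by linarith
    have : 100 * k = 101 := by exact_mod_cast h2
    omega
  have e : (k : ℂ) - 1 + s = y + 1 + ((1 / 50 : ℝ) : ℂ) := by
    apply Complex.ext
    · simp [hyre, hs]; ring
    · simp [hyim, hs]
  have hw := h (y + 1) (by simp [hyre]; linarith)
  have hre2 : 1 / 2 ≤ (y + 1).re := by simp [hyre]; linarith
  have hG : Complex.Gamma (y + 1) ≠ 0 := Complex.Gamma_ne_zero_of_re_pos (by linarith)
  have hG2 := hG
  rw [Complex.Gamma_add_one _ hy0] at hw hG2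
  have hGy : 0 < ‖Complex.Gamma y‖ := norm_pos_iff.mpr (right_ne_zero_of_mul hG2)
  have hB : ∀ v : ℂ, |v.re| ≤ k → v.im = -t → ‖v‖ ≤ k * ‖(1 : ℂ) + t * Complex.I‖ := by
    intro v h1 h2
    have : (k : ℝ) * ‖(1 : ℂ) + t * Complex.I‖ = ‖(k : ℂ) * ((1 : ℂ) + t * Complex.I)‖ := by
      simp
    rw [this]
    apply abs_le_of_sq_le_sq' _ (norm_nonneg _) |>.2
    rw [Complex.sq_norm, Complex.sq_norm, Complex.normSq_apply, Complex.normSq_apply]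
    simp [h2]
    have := sq_le_sq' (abs_le.mp h1).1 (abs_le.mp h1).2
    nlinarith [mul_self_nonneg t, mul_nonneg (sub_nonneg.mpr hk1) (mul_self_nonneg t)]
  have b1 := hB y (by rw [hyre, abs_le]; constructor <;> linarith) hyim
  have b2 := hB (y + 1) (by simp only [Complex.add_re, hyre, Complex.one_re, abs_le]; constructor <;> linarith) (by simp [hyim])
  rw [norm_div, hn, e, div_le_iff₀ hGy]
  set B := (k : ℝ) * ‖(1 : ℂ) + t * Complex.I‖
  have hB0 : 0 < B := lt_of_lt_of_le (norm_pos_iff.mpr hy0) b1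
  have hexp : B ^ (1 + 2 * (1 / 100) : ℝ) = B * B ^ (1 / 50 : ℝ) := by
    rw [Real.rpow_add hB0, Real.rpow_one]; norm_num
  rw [hexp]
  calc _ ≤ _ := hw
    _ = C * (‖y‖ * ‖y + 1‖ ^ (1 / 50 : ℝ)) * ‖Complex.Gamma y‖ := by rw [norm_mul]; ring
    _ ≤ _ := by gcongr
open scoped LSeries.notation in
lemma aux_tau_summable : Summable fun n : ℕ =>
    (((n + 1).divisors.card : ℝ)) ^ 2 * ((n + 1 : ℕ) : ℝ) ^ (-(1 + 1 / 100) : ℝ) := by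
  have h1 : LSeriesSummable 1 ((1 + 1 / 100 : ℝ) : ℂ) := by
    rw [LSeriesSummable_one_iff]; simp only [Complex.ofReal_re]; norm_num
  have h2 := h1.convolution h1
  have h3 := (h2.convolution h2).norm
  have h4 := (summable_nat_add_iff 1).mpr h3
  have hc : ∀ n : ℕ, ((1 : ℕ → ℂ) ⍟ (1 : ℕ → ℂ)) n = (n.divisors.card : ℂ) := by
    intro n
    rw [LSeries.convolution_def]
    simp [← Nat.map_div_right_divisors]
  refine h4.of_nonneg_of_le (fun n => by positivity) fun n => ?_
  rw [LSeries.norm_term_eq, if_neg (Nat.succ_ne_zero n), Complex.ofReal_re, Real.rpow_neg (by positivity),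
    ← div_eq_mul_inv]
  gcongr
  rw [LSeries.convolution_def]
  simp only [hc]
  have : (∑ p ∈ (n + 1).divisorsAntidiagonal, (p.1.divisors.card : ℂ) * (p.2.divisors.card : ℂ))
    = ((∑ p ∈ (n + 1).divisorsAntidiagonal, p.1.divisors.card * p.2.divisors.card : ℕ) : ℂ) := by
    push_cast; rfl
  rw [this, Complex.norm_natCast]
  norm_cast
  have hcard : (n + 1).divisorsAntidiagonal.card = (n + 1).divisors.card := by
    simp [← Nat.map_div_right_divisors]
  calc (n + 1).divisors.card ^ 2 = ∑ p ∈ (n + 1).divisorsAntidiagonal, (n + 1).divisors.card := by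
        rw [sum_const, hcard, smul_eq_mul, sq]
    _ ≤ _ := by
        refine sum_le_sum fun p hp => ?_
        rw [← (Nat.mem_divisorsAntidiagonal.mp hp).1, Nat.divisors_mul]
        exact card_mul_le

lemma aux_R : ∃ C : ℝ, 0 < C ∧ ∀ (lam mu : ℕ → ℝ),
    (∀ n : ℕ, 1 ≤ n → |lam n| ≤ (n.divisors.card : ℝ)) →
    (∀ n : ℕ, 1 ≤ n → |mu n| ≤ (n.divisors.card : ℝ)) →
    ∀ s : ℂ, s.re = 1 + 1 / 100 →
    ‖∑' n : ℕ, ((lam (n + 1) * mu (n + 1) : ℝ) : ℂ) * (((n : ℕ) + 1 : ℂ) ^ (-s))‖ ≤ C := by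
  have hs := aux_tau_summable
  refine ⟨(∑' n : ℕ, (((n + 1).divisors.card : ℝ)) ^ 2 *
    ((n + 1 : ℕ) : ℝ) ^ (-(1 + 1 / 100) : ℝ)) + 1, ?_, ?_⟩
  · have : 0 ≤ ∑' n : ℕ, (((n + 1).divisors.card : ℝ)) ^ 2 *
      ((n + 1 : ℕ) : ℝ) ^ (-(1 + 1 / 100) : ℝ) := tsum_nonneg fun n => by positivity
    linarith
  intro lam mu hl hm s hre
  refine (tsum_of_norm_bounded hs.hasSum fun n => ?_).trans (by linarith)
  have e : ((n : ℂ) + 1) = ((n + 1 : ℕ) : ℂ) := by push_cast; rfl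
  rw [norm_mul, e, Complex.norm_natCast_cpow_of_pos (Nat.succ_pos n), Complex.neg_re, hre,
    Complex.norm_real, norm_mul, Real.norm_eq_abs, Real.norm_eq_abs, sq]
  gcongr
  · exact hl _ (by omega)
  · exact hm _ (by omega)

lemma aux_pow_summable : Summable fun n : ℕ => (n : ℝ) ^ (-(1 + 1 / 100) : ℝ) :=
  Real.summable_nat_rpow.mpr (by norm_num)

lemma aux_zetaN : ∃ C : ℝ, 0 < C ∧ ∀ (N : ℕ) (s : ℂ), s.re = 1 + 1 / 100 →
    ‖zetaN N (2 * s)‖ ≤ C := by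
  set Z := ∑' n : ℕ, (n : ℝ) ^ (-(1 + 1 / 100) : ℝ) with hZ
  have hZ0 : 0 ≤ Z := tsum_nonneg fun n => by positivity
  refine ⟨(Z + 1) * Real.exp Z, by positivity, fun N s hs => ?_⟩
  have hre : (2 * s).re = 2 * (1 + 1 / 100) := by simp [hs]
  have hle : ∀ n : ℕ, 0 < n → (n : ℝ) ^ (-(2 * (1 + 1 / 100)) : ℝ) ≤ (n : ℝ) ^ (-(1 + 1 / 100) : ℝ) :=
    fun n hn => Real.rpow_le_rpow_of_exponent_le (by exact_mod_cast hn) (by norm_num)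
  unfold zetaN
  rw [norm_mul, norm_prod]
  gcongr
  · rw [zeta_eq_tsum_one_div_nat_cpow (by rw [hre]; norm_num)]
    refine (tsum_of_norm_bounded aux_pow_summable.hasSum fun n => ?_).trans (by linarith)
    rcases Nat.eq_zero_or_pos n with rfl | hn
    · have : (2 * s) ≠ 0 := fun h => by rw [h] at hre; norm_num at hre
      rw [Nat.cast_zero, Complex.zero_cpow this]
      simp
      positivity
    · rw [norm_div, norm_one, Complex.norm_natCast_cpow_of_pos hn, hre, one_div,
        ← Real.rpow_neg (by positivity)]
      exact hle n hn
  · calc ∏ p ∈ N.primeFactors, ‖1 - (p : ℂ) ^ (-(2 * s))‖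
        ≤ ∏ p ∈ N.primeFactors, Real.exp ((p : ℝ) ^ (-(1 + 1 / 100) : ℝ)) := by
          refine prod_le_prod (fun _ _ => norm_nonneg _) fun p hp => ?_
          have hp0 := (Nat.prime_of_mem_primeFactors hp).pos
          refine (norm_sub_le _ _).trans ?_
          rw [norm_one, Complex.norm_natCast_cpow_of_pos hp0, Complex.neg_re, hre]
          have := Real.add_one_le_exp ((p : ℝ) ^ (-(1 + 1 / 100) : ℝ))
          linarith [hle p hp0]
      _ = Real.exp (∑ p ∈ N.primeFactors, (p : ℝ) ^ (-(1 + 1 / 100) : ℝ)) := (Real.exp_sum _ _).symm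
      _ ≤ _ := Real.exp_le_exp.mpr (aux_pow_summable.sum_le_tsum _ fun _ _ => by positivity)

lemma aux_two_pow (D N : ℕ) (hN : 1 ≤ N) (h : D ∣ N) :
    (2 : ℝ) ^ D.primeFactors.card ≤ N.divisors.card := by
  have h1 : D.primeFactors.card ≤ N.primeFactors.card :=
    card_le_card (Nat.primeFactors_mono h (by omega))
  have h2 : 2 ^ N.primeFactors.card ≤ N.divisors.card := by
    rw [Nat.card_divisors (by omega), ← prod_const]
    refine prod_le_prod' fun p hp => ?_
    have := (Nat.prime_of_mem_primeFactors hp).factorization_pos_of_dvd (by omega)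
      (Nat.dvd_of_mem_primeFactors hp)
    omega
  calc (2 : ℝ) ^ D.primeFactors.card ≤ 2 ^ N.primeFactors.card :=
        pow_le_pow_right₀ one_le_two h1
    _ ≤ _ := by exact_mod_cast h2

lemma aux_euler : ∃ C : ℝ, 0 < C ∧ ∀ (D N : ℕ), 1 ≤ N → D ∣ N → ∀ u : ℕ → ℂ,
    (∀ p ∈ D.primeFactors, u p = 1 ∨ u p = -1) → ∀ s : ℂ, s.re = 1 + 1 / 100 →
    ‖∏ p ∈ D.primeFactors, (1 - u p * (p : ℂ) ^ (s - 1)) / (1 - u p * (p : ℂ) ^ (-s))‖ ≤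
      C * N.divisors.card * (N : ℝ) ^ (1 / 100 : ℝ) := by
  set Z := ∑' n : ℕ, (n : ℝ) ^ (-(1 + 1 / 100) : ℝ) with hZ
  refine ⟨Real.exp (2 * Z), Real.exp_pos _, fun D N hN hD u hu s hs => ?_⟩
  have hD0 : 0 < D := Nat.pos_of_dvd_of_pos hD hN
  rw [norm_prod]
  calc ∏ p ∈ D.primeFactors, ‖(1 - u p * (p : ℂ) ^ (s - 1)) / (1 - u p * (p : ℂ) ^ (-s))‖
      ≤ ∏ p ∈ D.primeFactors, (Real.exp (2 * (p : ℝ) ^ (-(1 + 1 / 100) : ℝ)) * 2 *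
          (p : ℝ) ^ (1 / 100 : ℝ)) := by
        refine prod_le_prod (fun _ _ => norm_nonneg _) fun p hp => ?_
        have hpp := Nat.prime_of_mem_primeFactors hp
        have hp0 := hpp.pos
        have hp2 : (2 : ℝ) ≤ p := by exact_mod_cast hpp.two_le
        have hun : ‖u p‖ = 1 := by rcases hu p hp with h | h <;> simp [h]
        set x := (p : ℝ) ^ (-(1 + 1 / 100) : ℝ) with hx
        have hx0 : 0 ≤ x := by positivity
        have hx1 : x ≤ 1 / 2 := by
          calc x ≤ (p : ℝ) ^ (-1 : ℝ) :=
                Real.rpow_le_rpow_of_exponent_le (by linarith) (by norm_num)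
            _ = 1 / p := by rw [Real.rpow_neg_one, one_div]
            _ ≤ 1 / 2 := one_div_le_one_div_of_le (by norm_num) hp2
        have n1 : ‖1 - u p * (p : ℂ) ^ (s - 1)‖ ≤ 2 * (p : ℝ) ^ (1 / 100 : ℝ) := by
          refine (norm_sub_le _ _).trans ?_
          rw [norm_one, norm_mul, hun, Complex.norm_natCast_cpow_of_pos hp0, Complex.sub_re, hs,
            Complex.one_re]
          have : 1 ≤ (p : ℝ) ^ (1 / 100 : ℝ) := Real.one_le_rpow (by linarith) (by norm_num)
          have e : (1 + 1 / 100 - 1 : ℝ) = 1 / 100 := by norm_num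
          rw [e]
          linarith
        have n2 : 1 - x ≤ ‖1 - u p * (p : ℂ) ^ (-s)‖ := by
          have := norm_sub_norm_le 1 (u p * (p : ℂ) ^ (-s))
          rw [norm_one, norm_mul, hun, Complex.norm_natCast_cpow_of_pos hp0, Complex.neg_re, hs,
            one_mul] at this
          exact this
        have n3 : 1 ≤ Real.exp (2 * x) * (1 - x) := by
          have := Real.add_one_le_exp (2 * x)
          nlinarith
        rw [norm_div, div_le_iff₀ (by linarith)]
        have hE := Real.exp_pos (2 * x)
        calc _ ≤ _ := n1
          _ = 1 * (2 * (p : ℝ) ^ (1 / 100 : ℝ)) := by ring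
          _ ≤ (Real.exp (2 * x) * ‖1 - u p * (p : ℂ) ^ (-s)‖) * (2 * (p : ℝ) ^ (1 / 100 : ℝ)) := by
              refine mul_le_mul_of_nonneg_right (n3.trans ?_) (by positivity)
              gcongr
          _ = _ := by ring
    _ = Real.exp (2 * ∑ p ∈ D.primeFactors, (p : ℝ) ^ (-(1 + 1 / 100) : ℝ)) *
          2 ^ D.primeFactors.card * ((∏ p ∈ D.primeFactors, p : ℕ) : ℝ) ^ (1 / 100 : ℝ) := by
        rw [prod_mul_distrib, prod_mul_distrib, prod_const, ← Real.exp_sum, mul_sum, Nat.cast_prod,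
          Real.finsetProd_rpow _ _ fun _ _ => by positivity]
    _ ≤ _ := by
        gcongr
        · exact aux_pow_summable.sum_le_tsum _ fun _ _ => by positivity
        · exact aux_two_pow D N hN hD
        · exact Nat.le_of_dvd hN ((Nat.prod_primeFactors_dvd D).trans hD)

/-- Bound on the line `Re s = -1/100` for the Rankin–Selberg zeta function of two
newforms, deduced from its functional equation and Deligne's bound. -/
theorem rankin_selberg_bound_left_edge :
    ∃ C : ℝ, 0 < C ∧
      ∀ (k N : ℕ), 2 ≤ k → 1 ≤ N →
        ∀ D : ℕ, 0 < D → D ∣ N →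
          ∀ (u : ℕ → ℂ), (∀ p ∈ D.primeFactors, u p = 1 ∨ u p = -1) →
            ∀ (lam mu : ℕ → ℝ),
              (∀ n : ℕ, 1 ≤ n → |lam n| ≤ (n.divisors.card : ℝ)) →
              (∀ n : ℕ, 1 ≤ n → |mu n| ≤ (n.divisors.card : ℝ)) →
              ∀ (R : ℂ → ℂ),
                (∀ s : ℂ, 1 < s.re →
                  R s = ∑' n : ℕ,
                    ((lam (n + 1) * mu (n + 1) : ℝ) : ℂ) * (((n : ℕ) + 1 : ℂ) ^ (-s))) →
                (∀ s : ℂ, s.re = 1 + 1 / 100 →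
                  zetaN N (2 - 2 * s) * R (1 - s) =
                    ((2 * Real.pi : ℝ) : ℂ) ^ (2 - 4 * s) * (N : ℂ) ^ (2 * s - 1) *
                      (Complex.Gamma s / Complex.Gamma (1 - s)) *
                      (Complex.Gamma ((k : ℂ) - 1 + s) / Complex.Gamma ((k : ℂ) - s)) *
                      (∏ p ∈ D.primeFactors,
                        (1 - u p * (p : ℂ) ^ (s - 1)) / (1 - u p * (p : ℂ) ^ (-s))) *
                      zetaN N (2 * s) * R s) →
                ∀ t : ℝ,
                  ‖zetaN N (((-2 * (1 / 100) : ℝ) : ℂ) + 2 * t * Complex.I) *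
                      R (((-(1 / 100) : ℝ) : ℂ) + t * Complex.I)‖ ≤
                    C * (N.divisors.card : ℝ) *
                      ((k : ℝ) * N) ^ (1 + 2 * (1 / 100) : ℝ) *
                      (N : ℝ) ^ (1 / 100 : ℝ) *
                      ‖(1 : ℂ) + t * Complex.I‖ ^ (2 + 4 * (1 / 100) : ℝ) := by
  obtain ⟨CG, hCG, hG⟩ := aux_gamma_quot
  obtain ⟨CR, hCR, hRb⟩ := aux_R
  obtain ⟨CZ, hCZ, hZ⟩ := aux_zetaN
  obtain ⟨CE, hCE, hE⟩ := aux_euler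
  refine ⟨CG * CG * CE * CZ * CR, by positivity, ?_⟩
  intro k N hk hN D hD hDN u hu lam mu hl hm R hR hF t
  set s : ℂ := ((1 + 1 / 100 : ℝ) : ℂ) - t * Complex.I with hs
  have hsre : s.re = 1 + 1 / 100 := by simp [hs]
  have hfun := hF s hsre
  have e1 : 2 - 2 * s = ((-2 * (1 / 100) : ℝ) : ℂ) + 2 * t * Complex.I := by
    rw [hs]; push_cast; ring
  have e2 : 1 - s = ((-(1 / 100) : ℝ) : ℂ) + t * Complex.I := by
    rw [hs]; push_cast; ring
  have b5 := hZ N s hsre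
  have b6 : ‖R s‖ ≤ CR := by
    rw [hR s (by rw [hsre]; norm_num)]
    exact hRb lam mu hl hm s hsre
  have b4 := hE D N hN hDN u hu s hsre
  have b3 := hG k t (by omega) s hs
  have b2 := hG 1 t le_rfl s hs
  simp only [Nat.cast_one, sub_self, zero_add, one_mul] at b2
  have b1 : ‖(N : ℂ) ^ (2 * s - 1)‖ = (N : ℝ) ^ (1 + 2 * (1 / 100) : ℝ) := by
    rw [Complex.norm_natCast_cpow_of_pos hN]
    congr 1
    simp [hsre]; norm_num
  have b0 : ‖((2 * Real.pi : ℝ) : ℂ) ^ (2 - 4 * s)‖ ≤ 1 := by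
    rw [Complex.norm_cpow_eq_rpow_re_of_pos (by positivity)]
    refine Real.rpow_le_one_of_one_le_of_nonpos (by linarith [Real.pi_gt_three]) ?_
    simp [hsre]; norm_num
  rw [← e1, ← e2, hfun]
  simp only [norm_mul]
  rw [b1]
  set A := ‖(1 : ℂ) + t * Complex.I‖ with hA
  have hA0 : 0 < A := by
    refine norm_pos_iff.mpr fun h => ?_
    have := congrArg Complex.re h
    simp at this
  have hAe : A ^ (2 + 4 * (1 / 100) : ℝ) =
      A ^ (1 + 2 * (1 / 100) : ℝ) * A ^ (1 + 2 * (1 / 100) : ℝ) := by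
    rw [← Real.rpow_add hA0]; norm_num
  rw [Real.mul_rpow (by positivity) hA0.le] at b3
  rw [hAe, Real.mul_rpow (by positivity) (by positivity)]
  calc _ ≤ 1 * (N : ℝ) ^ (1 + 2 * (1 / 100) : ℝ) * (CG * A ^ (1 + 2 * (1 / 100) : ℝ)) *
        (CG * ((k : ℝ) ^ (1 + 2 * (1 / 100) : ℝ) * A ^ (1 + 2 * (1 / 100) : ℝ))) *
        (CE * N.divisors.card * (N : ℝ) ^ (1 / 100 : ℝ)) * CZ * CR := by
        gcongr
    _ = _ := by ring
end

section
/- For every ε > 0 there exists an integer N₀ ≥ 16 such that for all integers N ≥ N₀ and all integers ℓ with ℓ > N³, one has ∏_{p prime, p | N} (log(ℓN)/log p) ≤ (1/2) · ℓ^{(1+ε)²}. -/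
open Finset

lemma aux_eventually : ∃ Y : ℝ, 1 ≤ Y ∧ ∀ y : ℝ, Y ≤ y →
    y ^ (Real.sqrt y + 1) ≤ (1 / 2) * Real.exp (y / 12) := by
  have h1 := (isLittleO_log_rpow_atTop (show (0:ℝ) < 1/2 by norm_num)).bound
    (show (0:ℝ) < 1/48 by norm_num)
  obtain ⟨A, hA⟩ := Filter.eventually_atTop.1 h1
  refine ⟨max A 48, by simp, fun y hy => ?_⟩
  have hyA : A ≤ y := le_trans (le_max_left _ _) hy
  have hy1 : 48 ≤ y := le_trans (le_max_right _ _) hy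
  have h := hA y hyA
  rw [← Real.sqrt_eq_rpow, Real.norm_of_nonneg (Real.log_nonneg (by linarith)),
    Real.norm_of_nonneg (Real.sqrt_nonneg y)] at h
  have hs : Real.sqrt y * Real.sqrt y = y := Real.mul_self_sqrt (by linarith)
  have hs1 : 1 ≤ Real.sqrt y := Real.one_le_sqrt.2 (by linarith)
  have hl2 : Real.log 2 < 1 := by linarith [Real.log_two_lt_d9]
  have e2 : (1 / 2 : ℝ) = Real.exp (-Real.log 2) := by
    rw [Real.exp_neg, Real.exp_log (by norm_num)]; norm_num
  rw [Real.rpow_def_of_pos (by linarith), e2, ← Real.exp_add]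
  apply Real.exp_le_exp.2
  nlinarith [mul_le_mul_of_nonneg_right h (show 0 ≤ Real.sqrt y + 1 by linarith)]

/-- For every `ε > 0` there is `N₀ ≥ 16` such that for all `N ≥ N₀` and `ℓ > N³`,
`∏_{p | N} (log(ℓN)/log p) ≤ (1/2) ℓ^{(1+ε)²}`. -/
theorem prime_factor_log_product_bound_eps :
    ∀ ε : ℝ, 0 < ε →
      ∃ N₀ : ℕ, 16 ≤ N₀ ∧
        ∀ N ℓ : ℕ, N₀ ≤ N → N ^ 3 < ℓ →
          (∏ p ∈ N.primeFactors, Real.log ((ℓ : ℝ) * N) / Real.log p) ≤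
            (1 / 2) * (ℓ : ℝ) ^ ((1 + ε) ^ 2 : ℝ) := by
  intro ε hε
  obtain ⟨Y, hY1, hY⟩ := aux_eventually
  refine ⟨max 16 ⌈Real.exp Y⌉₊, le_max_left _ _, fun N ℓ hN hl => ?_⟩
  have hN16 : 16 ≤ N := le_trans (le_max_left _ _) hN
  have hNY : Real.exp Y ≤ N := Nat.ceil_le.1 (le_trans (le_max_right _ _) hN)
  have hNl : N ≤ ℓ := le_trans (Nat.le_self_pow (by norm_num) N) hl.le
  have hN0 : (0:ℝ) < N := by exact_mod_cast (by omega : 0 < N)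
  have hNl' : (N:ℝ) ≤ ℓ := by exact_mod_cast hNl
  have hl0 : (0:ℝ) < ℓ := by linarith
  have hl1 : (1:ℝ) ≤ ℓ := by exact_mod_cast (by omega : 1 ≤ ℓ)
  have hlogN : Y ≤ Real.log N := (Real.le_log_iff_exp_le hN0).2 hNY
  have hlogl : Real.log N ≤ Real.log ℓ := Real.log_le_log hN0 hNl'
  have hl3 : 3 * Real.log N ≤ Real.log ℓ := by
    have : Real.log ((N:ℝ)^3) ≤ Real.log ℓ :=
      Real.log_le_log (by positivity) (by exact_mod_cast hl.le)
    rw [Real.log_pow] at this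
    exact_mod_cast this
  set y : ℝ := 4 * Real.log ℓ with hy
  have hy1 : 1 ≤ y := by linarith
  have hx : Real.log ((ℓ : ℝ) * N) = Real.log ℓ + Real.log N :=
    Real.log_mul hl0.ne' hN0.ne'
  have hfac0 : ∀ p ∈ N.primeFactors, 0 ≤ Real.log ((ℓ : ℝ) * N) / Real.log p := by
    intro p hp
    have := (Nat.prime_of_mem_primeFactors hp).one_le
    exact div_nonneg (by rw [hx]; linarith) (Real.log_nonneg (by exact_mod_cast this))
  have hfac : ∀ p ∈ N.primeFactors, Real.log ((ℓ : ℝ) * N) / Real.log p ≤ y := by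
    intro p hp
    have h2 := (Nat.prime_of_mem_primeFactors hp).two_le
    have h3 : Real.log 2 ≤ Real.log p := Real.log_le_log (by norm_num) (by exact_mod_cast h2)
    have h4 : 1/2 ≤ Real.log p := by linarith [Real.log_two_gt_d9]
    rw [div_le_iff₀ (by linarith), hx]
    nlinarith
  have hsmall : (∏ p ∈ N.primeFactors with ((p:ℕ):ℝ) < Real.sqrt y,
      Real.log ((ℓ : ℝ) * N) / Real.log p) ≤ y ^ (Real.sqrt y + 1) := by
    calc _ ≤ ∏ p ∈ N.primeFactors with ((p:ℕ):ℝ) < Real.sqrt y, y :=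
          prod_le_prod (fun p hp => hfac0 p (mem_filter.1 hp).1)
            (fun p hp => hfac p (mem_filter.1 hp).1)
      _ = y ^ ((#{p ∈ N.primeFactors | ((p:ℕ):ℝ) < Real.sqrt y} : ℕ) : ℝ) := by
          rw [prod_const, Real.rpow_natCast]
      _ ≤ _ := by
          apply Real.rpow_le_rpow_of_exponent_le hy1
          have hc : #{p ∈ N.primeFactors | ((p:ℕ):ℝ) < Real.sqrt y} ≤ ⌈Real.sqrt y⌉₊ := by
            rw [← card_range ⌈Real.sqrt y⌉₊]
            apply card_le_card
            intro p hp
            exact mem_range.2 (Nat.lt_ceil.2 (mem_filter.1 hp).2)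
          have := Nat.ceil_lt_add_one (Real.sqrt_nonneg y)
          have hc' : ((#{p ∈ N.primeFactors | ((p:ℕ):ℝ) < Real.sqrt y} : ℕ) : ℝ)
            ≤ (⌈Real.sqrt y⌉₊ : ℝ) := by exact_mod_cast hc
          linarith
  have hlarge : (∏ p ∈ N.primeFactors with ¬ ((p:ℕ):ℝ) < Real.sqrt y,
      Real.log ((ℓ : ℝ) * N) / Real.log p) ≤ (N:ℝ) ^ 2 := by
    calc _ ≤ ∏ p ∈ N.primeFactors with ¬ ((p:ℕ):ℝ) < Real.sqrt y, ((p:ℕ):ℝ)^2 := by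
          refine prod_le_prod (fun p hp => hfac0 p (mem_filter.1 hp).1) (fun p hp => ?_)
          obtain ⟨h1, h2⟩ := mem_filter.1 hp
          exact (hfac p h1).trans (Real.sqrt_le_left (by positivity) |>.1 (not_lt.1 h2))
      _ = ((∏ p ∈ N.primeFactors with ¬ ((p:ℕ):ℝ) < Real.sqrt y, p : ℕ) : ℝ)^2 := by
          rw [prod_pow]; push_cast; rfl
      _ ≤ _ := by
          gcongr
          exact Nat.le_of_dvd (by omega) ((prod_dvd_prod_of_subset _ _ _
            (filter_subset _ _)).trans (Nat.prod_primeFactors_dvd N))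
  have hYy := hY y (by linarith)
  have hN2 : (N:ℝ)^2 = Real.exp (2 * Real.log N) := by
    rw [two_mul, Real.exp_add, Real.exp_log hN0, sq]
  rw [← prod_filter_mul_prod_filter_not N.primeFactors (fun p => ((p:ℕ):ℝ) < Real.sqrt y)]
  calc _ ≤ ((1 / 2) * Real.exp (y / 12)) * (N:ℝ)^2 :=
        mul_le_mul (hsmall.trans hYy) hlarge
          (prod_nonneg fun p hp => hfac0 p (mem_filter.1 hp).1) (by positivity)
    _ ≤ (1/2) * (ℓ:ℝ) := by
        rw [hN2, mul_assoc, ← Real.exp_add]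
        have : Real.exp (y / 12 + 2 * Real.log N) ≤ ℓ := by
          rw [← Real.le_log_iff_exp_le hl0]; linarith
        linarith
    _ ≤ _ := by
        have := Real.rpow_le_rpow_of_exponent_le hl1 (show (1:ℝ) ≤ (1+ε)^2 by nlinarith)
        rw [Real.rpow_one] at this
        linarith
end
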